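/- Let γ ∈ (0,2] and let μ be a Borel probability measure on the unit sphere S² ⊂ ℝ³ with ∫_{S²} x dμ(x) = 0 and μ ≥ (1 − 1/γ)σ (meaning μ − (1 − 1/γ)σ is a nonnegative measure). Then D(μ‖σ) ≥ γ · E(μ), where E(μ) := 2 ∬_{S²×S²} log(1/|x−y|) dμ(x) dμ(y) + 2 log 2 − 1. -/

import Mathlib

open MeasureTheory
open scoped ENNReal Classical

/-- Euclidean three-space, containing the unit two-sphere. -/
abbrev E3 : Type := EuclideanSpace ℝ (Fin 3)

/-- The relative entropy (Kullback–Leibler divergence) `D(μ‖ν)`, equal to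
`∫ log(dμ/dν) dμ` when `μ ≪ ν` and this integral is defined, and `∞` otherwise. -/
noncomputable def relEnt {α : Type*} [MeasurableSpace α] (μ ν : Measure α) : ℝ≥0∞ :=
  if μ ≪ ν ∧ Integrable (fun x => Real.log (μ.rnDeriv ν x).toReal) μ then
    ENNReal.ofReal (∫ x, Real.log (μ.rnDeriv ν x).toReal ∂μ)
  else ∞


open MeasureTheory
open scoped ENNReal Classical

/-- Rotation invariant probability on the sphere. -/
structure Sph (σ : Measure E3) : Prop where
  prob : IsProbabilityMeasure σ
  sph : σ (Metric.sphere (0 : E3) 1) = 1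
  inv : ∀ R : E3 ≃ₗᵢ[ℝ] E3, σ.map R = σ

namespace Sph

variable {σ : Measure E3}

theorem ae_norm (h : Sph σ) : ∀ᵐ y ∂σ, ‖y‖ = 1 := by
  have := h.prob
  have h1 : σ (Metric.sphere (0 : E3) 1)ᶜ = 0 := by
    rw [prob_compl_eq_zero_iff Metric.isClosed_sphere.measurableSet]; exact h.sph
  have h2 : ∀ᵐ y ∂σ, y ∈ Metric.sphere (0 : E3) 1 := by
    rw [ae_iff]; exact h1
  filter_upwards [h2] with y hy
  simpa using hy

theorem integral_inv (h : Sph σ) (R : E3 ≃ₗᵢ[ℝ] E3) (f : E3 → ℝ) :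
    ∫ y, f (R y) ∂σ = ∫ y, f y ∂σ := by
  have h1 : MeasurePreserving R σ σ := ⟨R.continuous.measurable, h.inv R⟩
  exact h1.integral_comp R.toHomeomorph.measurableEmbedding f

theorem integral_swap (h : Sph σ) (G : ℝ → ℝ → ℝ) (x w w' : E3) (hw : ‖w‖ = ‖w'‖)
    (h1 : inner ℝ x w = 0) (h2 : inner ℝ x w' = 0) :
    ∫ y, G (inner ℝ x y) (inner ℝ w y) ∂σ = ∫ y, G (inner ℝ x y) (inner ℝ w' y) ∂σ := by
  have h3 := Submodule.reflection_sub hw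
  have h4 : (ℝ ∙ (w - w'))ᗮ.reflection x = x := by
    apply Submodule.reflection_mem_subspace_eq_self
    rw [Submodule.mem_orthogonal_singleton_iff_inner_right, real_inner_comm, inner_sub_right, h1, h2, sub_zero]
  rw [← h.integral_inv (ℝ ∙ (w - w'))ᗮ.reflection (fun y => G (inner ℝ x y) (inner ℝ w' y))]
  congr 1; ext y
  have e1 := LinearIsometryEquiv.inner_map_map (ℝ ∙ (w - w'))ᗮ.reflection x y
  have e2 := LinearIsometryEquiv.inner_map_map (ℝ ∙ (w - w'))ᗮ.reflection w y
  rw [h4] at e1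
  rw [h3] at e2
  rw [e1, e2]

theorem integral_zonal (h : Sph σ) (F : ℝ → ℝ) (w w' : E3) (hw : ‖w‖ = ‖w'‖) :
    ∫ y, F (inner ℝ w y) ∂σ = ∫ y, F (inner ℝ w' y) ∂σ :=
  h.integral_swap (fun _ b => F b) 0 w w' hw (by simp) (by simp)

theorem meas_inner (x : E3) : Measurable (fun y : E3 => inner ℝ x y) := by fun_prop

theorem abs_inner_le (h : Sph σ) (x : E3) : ∀ᵐ y ∂σ, |inner ℝ x y| ≤ ‖x‖ := by
  filter_upwards [h.ae_norm] with y hy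
  have := abs_real_inner_le_norm x y
  rwa [hy, mul_one] at this

theorem integrable_bdd (h : Sph σ) {f : E3 → ℝ} (hf : Measurable f) (C : ℝ)
    (hC : ∀ᵐ y ∂σ, |f y| ≤ C) : Integrable f σ := by
  have := h.prob
  exact Integrable.of_bound hf.aestronglyMeasurable C hC

theorem integrable_mono (h : Sph σ) (v w : E3) (i j : ℕ) :
    Integrable (fun y => (inner ℝ v y) ^ i * (inner ℝ w y) ^ j) σ := by
  apply h.integrable_bdd (by fun_prop) (‖v‖ ^ i * ‖w‖ ^ j)
  filter_upwards [h.abs_inner_le v, h.abs_inner_le w] with y h1 h2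
  rw [abs_mul, abs_pow, abs_pow]
  gcongr

noncomputable def ee (i : Fin 3) : E3 := EuclideanSpace.single i 1

theorem inner_ee (i : Fin 3) (y : E3) : inner ℝ (ee i) y = y i := by
  simp [ee, EuclideanSpace.inner_single_left]

theorem norm_ee (i : Fin 3) : ‖ee i‖ = 1 := by simp [ee]

theorem inner_ee_ee (i j : Fin 3) (hij : i ≠ j) : inner ℝ (ee i) (ee j) = 0 := by
  rw [inner_ee]; simp [ee, hij]

theorem coord_sq (y : E3) (hy : ‖y‖ = 1) : (y 0) ^ 2 + (y 1) ^ 2 + (y 2) ^ 2 = 1 := by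
  have := EuclideanSpace.norm_sq_eq y
  rw [hy] at this
  simp [Fin.sum_univ_three] at this
  linarith

theorem pow_coeff (h : Sph σ) (k : ℕ) (j : Fin 3) (hj : j ≠ 0) :
    (k : ℝ) * ∫ y, (y 0) ^ (2 * k) ∂σ =
      (Nat.choose (2 * k) 2 : ℝ) * ∫ y, (y 0) ^ (2 * k - 2) * (y j) ^ 2 ∂σ := by
  set c := ∫ y, (y 0) ^ (2 * k) ∂σ with hc
  have key : ∀ b : ℝ, ∫ y, (y 0 + b * y j) ^ (2 * k) ∂σ = (1 + b ^ 2) ^ k * c := by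
    intro b
    have hn : ‖ee 0 + b • ee j‖ ^ 2 = 1 + b ^ 2 := by
      rw [norm_add_sq_real, norm_smul, norm_ee, norm_ee, inner_smul_right, inner_ee_ee 0 j (Ne.symm hj)]
      simp
    have h1 := h.integral_zonal (fun t => t ^ (2 * k)) (ee 0 + b • ee j) (‖ee 0 + b • ee j‖ • ee 0)
      (by rw [norm_smul, norm_ee]; simp)
    have e1 : ∀ y, inner ℝ (ee 0 + b • ee j) y = y 0 + b * y j := by
      intro y; rw [inner_add_left, real_inner_smul_left, inner_ee, inner_ee]
    have e2 : ∀ y, (inner ℝ (‖ee 0 + b • ee j‖ • ee 0) y) ^ (2 * k) = (1 + b ^ 2) ^ k * (y 0) ^ (2 * k) := by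
      intro y; rw [real_inner_smul_left, inner_ee, mul_pow, pow_mul, hn]
    simp only [e1, e2] at h1
    rw [h1, integral_const_mul]
  have exp : ∀ b : ℝ, ∫ y, (y 0 + b * y j) ^ (2 * k) ∂σ =
      ∑ m ∈ Finset.range (2 * k + 1), b ^ (2 * k - m) * ((Nat.choose (2 * k) m : ℝ) * ∫ y, (y 0) ^ m * (y j) ^ (2 * k - m) ∂σ) := by
    intro b
    simp_rw [add_pow]
    have hi : ∀ m, Integrable (fun y : E3 => (y 0) ^ m * (y j) ^ (2 * k - m)) σ := by
      intro m
      have := h.integrable_mono (ee 0) (ee j) m (2 * k - m)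
      simpa only [inner_ee] using this
    rw [integral_finsetSum]
    · apply Finset.sum_congr rfl
      intro m _
      rw [← mul_assoc, ← integral_const_mul]
      congr 1; ext y; rw [mul_pow]; ring
    · intro m _
      have := (hi m).const_mul (b ^ (2 * k - m) * (Nat.choose (2 * k) m : ℝ))
      refine this.congr (Filter.Eventually.of_forall fun y => ?_)
      simp only [mul_pow]; ring
  rcases Nat.eq_zero_or_pos k with hk | hk
  · subst hk; simp
  let P : Polynomial ℝ := ∑ m ∈ Finset.range (2 * k + 1), Polynomial.C ((Nat.choose (2 * k) m : ℝ) * ∫ y, (y 0) ^ m * (y j) ^ (2 * k - m) ∂σ) * Polynomial.X ^ (2 * k - m)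
  let Q : Polynomial ℝ := Polynomial.C c * Polynomial.expand ℝ 2 ((1 + Polynomial.X) ^ k)
  have hPQ : P = Q := by
    apply Polynomial.funext
    intro b
    have h1 := (exp b).symm.trans (key b)
    simp only [P, Q, Polynomial.eval_finsetSum, Polynomial.eval_mul, Polynomial.eval_C, Polynomial.eval_pow, Polynomial.eval_X, Polynomial.expand_eval, Polynomial.eval_add, Polynomial.eval_one]
    rw [mul_comm c, ← h1]
    apply Finset.sum_congr rfl
    intro m _; ring
  have h2 := congrArg (fun p => Polynomial.coeff p 2) hPQ
  simp only [P, Q, Polynomial.finsetSum_coeff, Polynomial.coeff_C_mul, Polynomial.coeff_X_pow] at h2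
  rw [Finset.sum_eq_single (2 * k - 2)] at h2
  · have e := Polynomial.coeff_expand_mul (R := ℝ) (p := 2) (by norm_num) ((1 + Polynomial.X) ^ k) 1
    rw [one_mul, Polynomial.coeff_one_add_X_pow, Nat.choose_one_right] at e
    rw [e] at h2
    have e3 : 2 * k - (2 * k - 2) = 2 := by omega
    rw [e3, if_pos rfl, mul_one, Nat.choose_symm (by omega)] at h2
    linarith
  · intro m hm hne
    rw [Finset.mem_range] at hm
    rw [if_neg (by omega), mul_zero]
  · intro hm; exfalso; apply hm; rw [Finset.mem_range]; omega

theorem moment_even (h : Sph σ) (k : ℕ) : ∫ y, (y 0) ^ (2 * k) ∂σ = 1 / (2 * k + 1) := by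
  have := h.prob
  induction k with
  | zero => simp
  | succ k ih =>
    have h1 := h.pow_coeff (k + 1) 1 (by decide)
    have h2 := h.pow_coeff (k + 1) 2 (by decide)
    have e : 2 * (k + 1) - 2 = 2 * k := by omega
    rw [e] at h1 h2
    have hi : ∀ j : Fin 3, Integrable (fun y : E3 => (y 0) ^ (2 * k) * (y j) ^ 2) σ := by
      intro j
      have := h.integrable_mono (ee 0) (ee j) (2 * k) 2
      simpa only [inner_ee] using this
    have h3 : ∫ y, (y 0) ^ (2 * k) * (y 0) ^ 2 ∂σ + ∫ y, (y 0) ^ (2 * k) * (y 1) ^ 2 ∂σ + ∫ y, (y 0) ^ (2 * k) * (y 2) ^ 2 ∂σ = ∫ y, (y 0) ^ (2 * k) ∂σ := by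
      have a1 := integral_add (hi 0) (hi 1)
      have a2 := integral_add ((hi 0).add (hi 1)) (hi 2)
      simp only [Pi.add_apply] at a1 a2
      rw [← a1, ← a2]
      apply integral_congr_ae
      filter_upwards [h.ae_norm] with y hy
      have := coord_sq y hy
      calc _ = (y 0) ^ (2 * k) * ((y 0) ^ 2 + (y 1) ^ 2 + (y 2) ^ 2) := by ring
        _ = _ := by rw [this, mul_one]
    have h4 : ∫ y, (y 0) ^ (2 * k) * (y 0) ^ 2 ∂σ = ∫ y, (y 0) ^ (2 * (k + 1)) ∂σ := by
      congr 1; ext y; ring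
    rw [h4, ih] at h3
    have hch : (Nat.choose (2 * (k + 1)) 2 : ℝ) = (k + 1) * (2 * k + 1) := by
      rw [Nat.cast_choose_two]; push_cast; ring
    rw [hch] at h1 h2
    have hk : (0 : ℝ) < k + 1 := by positivity
    push_cast at h1 h2 ⊢
    set C := ∫ y, (y 0) ^ (2 * (k + 1)) ∂σ
    set A := ∫ y, (y 0) ^ (2 * k) * (y 1) ^ 2 ∂σ
    set B := ∫ y, (y 0) ^ (2 * k) * (y 2) ^ 2 ∂σ
    have h1' : C = (2 * k + 1) * A := by
      apply mul_left_cancel₀ hk.ne'; linarith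
    have h2' : C = (2 * k + 1) * B := by
      apply mul_left_cancel₀ hk.ne'; linarith
    have h5 : (2 * k + 1 : ℝ) * (1 / (2 * k + 1)) = 1 := by field_simp
    have h6 : C * (2 * k + 3) = 1 := by
      have : (2 * k + 1 : ℝ) * (C + A + B) = 1 := by rw [h3, h5]
      linarith
    rw [eq_div_iff (by positivity)]; linarith

theorem moment_odd (h : Sph σ) (k : ℕ) : ∫ y, (y 0) ^ (2 * k + 1) ∂σ = 0 := by
  have h1 := h.integral_zonal (fun t => t ^ (2 * k + 1)) (ee 0) (- ee 0) (by simp)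
  simp only [inner_neg_left, inner_ee, Odd.neg_pow (⟨k, rfl⟩ : Odd (2 * k + 1)), integral_neg] at h1
  linarith

theorem moment (h : Sph σ) (n : ℕ) : ∫ y, (y 0) ^ n ∂σ = ∫ s in (0:ℝ)..1, (1 - 2 * s) ^ n := by
  rw [intervalIntegral.integral_comp_sub_mul (fun t : ℝ => t ^ n) (by norm_num : (2:ℝ) ≠ 0), integral_pow]
  rcases Nat.even_or_odd' n with ⟨k, rfl | rfl⟩
  · rw [h.moment_even]
    have : (-1 : ℝ) ^ (2 * k + 1) = -1 := Odd.neg_one_pow ⟨k, rfl⟩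
    norm_num [this]; ring
  · rw [h.moment_odd]
    have : (-1 : ℝ) ^ (2 * k + 1 + 1) = 1 := Even.neg_one_pow ⟨k + 1, by ring⟩
    norm_num [this]

theorem integral_poly (h : Sph σ) (p : Polynomial ℝ) :
    ∫ y, p.eval (y 0) ∂σ = ∫ s in (0:ℝ)..1, p.eval (1 - 2 * s) := by
  have hm : ∀ n, Integrable (fun y : E3 => (y 0) ^ n) σ := fun n => by
    have := h.integrable_mono (ee 0) (ee 0) n 0
    simpa only [inner_ee, pow_zero, mul_one] using this
  simp_rw [Polynomial.eval_eq_sum_range]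
  rw [integral_finsetSum _ (fun i _ => (hm i).const_mul _), intervalIntegral.integral_finsetSum]
  · apply Finset.sum_congr rfl
    intro i _
    rw [integral_const_mul, h.moment, intervalIntegral.integral_const_mul]
  · intro i _
    apply Continuous.intervalIntegrable
    fun_prop

theorem law0 (h : Sph σ) : σ.map (fun y : E3 => y 0) = (volume.restrict (Set.Icc (0:ℝ) 1)).map (fun s => 1 - 2 * s) := by
  have := h.prob
  have m0 : Measurable (fun y : E3 => y 0) := by fun_prop
  have m1 : Measurable (fun s : ℝ => 1 - 2 * s) := by fun_prop
  have : IsFiniteMeasure (volume.restrict (Set.Icc (0:ℝ) 1)) := ⟨by simp⟩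
  have hae : ∀ᵐ y ∂σ, y 0 ∈ Set.Icc (-1:ℝ) 1 := by
    filter_upwards [h.abs_inner_le (ee 0)] with y hy
    rw [inner_ee, norm_ee] at hy
    exact abs_le.mp hy
  apply ext_of_forall_integral_eq_of_IsFiniteMeasure
  intro f
  have fc : Continuous f := f.continuous
  rw [integral_map m0.aemeasurable fc.aestronglyMeasurable, integral_map m1.aemeasurable fc.aestronglyMeasurable]
  rw [integral_Icc_eq_integral_Ioc, ← intervalIntegral.integral_of_le zero_le_one]
  apply eq_of_forall_dist_le
  intro ε hε
  obtain ⟨p, hp⟩ := exists_polynomial_near_of_continuousOn (-1) 1 f fc.continuousOn (ε / 2) (by positivity)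
  have pint : Integrable (fun y : E3 => p.eval (y 0)) σ := by
    have : (fun y : E3 => p.eval (y 0)) = fun y : E3 => ∑ i ∈ Finset.range (p.natDegree + 1), p.coeff i * (y 0) ^ i := by
      ext y; rw [Polynomial.eval_eq_sum_range]
    rw [this]
    apply integrable_finsetSum
    intro i _
    have := h.integrable_mono (ee 0) (ee 0) i 0
    simp only [inner_ee, pow_zero, mul_one] at this
    exact this.const_mul _
  have fint : Integrable (fun y : E3 => f (y 0)) σ := by
    apply h.integrable_bdd (fc.measurable.comp m0) ‖f‖
    exact Filter.Eventually.of_forall fun y => f.norm_coe_le_norm _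
  have b1 : |∫ y, f (y 0) ∂σ - ∫ y, p.eval (y 0) ∂σ| ≤ ε / 2 := by
    rw [← integral_sub fint pint]
    have := norm_integral_le_of_norm_le_const (μ := σ) (f := fun y : E3 => f (y 0) - p.eval (y 0)) (C := ε / 2) (by
      filter_upwards [hae] with y hy
      rw [norm_sub_rev]; exact (hp _ hy).le)
    simpa using this
  have b2 : |(∫ s in (0:ℝ)..1, p.eval (1 - 2 * s)) - ∫ s in (0:ℝ)..1, f (1 - 2 * s)| ≤ ε / 2 := by
    rw [← intervalIntegral.integral_sub]
    · have := intervalIntegral.norm_integral_le_of_norm_le_const (a := 0) (b := 1) (f := fun s : ℝ => p.eval (1 - 2 * s) - f (1 - 2 * s)) (C := ε / 2) (by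
        intro s hs
        rw [Set.uIoc_of_le zero_le_one] at hs
        exact (hp _ ⟨by linarith [hs.2], by linarith [hs.1]⟩).le)
      simpa using this
    · exact Continuous.intervalIntegrable (by fun_prop) _ _
    · exact Continuous.intervalIntegrable (by fun_prop) _ _
  rw [h.integral_poly] at b1
  rw [Real.dist_eq]
  calc _ ≤ _ := abs_sub_le _ (∫ s in (0:ℝ)..1, p.eval (1 - 2 * s)) _
    _ ≤ ε := by linarith

/-- the variable `s = (1 - ⟨x,y⟩)/2 = |x-y|²/4` -/
noncomputable def sv (x y : E3) : ℝ := (1 - inner ℝ x y) / 2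

theorem sv_comm (x y : E3) : sv x y = sv y x := by unfold sv; rw [real_inner_comm]

theorem meas_sv2 : Measurable (fun p : E3 × E3 => sv p.1 p.2) := by unfold sv; fun_prop

theorem meas_sv (x : E3) : Measurable (sv x) := by unfold sv; fun_prop

theorem inner_eq_sv (x y : E3) : inner ℝ x y = 1 - 2 * sv x y := by unfold sv; ring

theorem law (h : Sph σ) (x : E3) (hx : ‖x‖ = 1) : σ.map (sv x) = volume.restrict (Set.Icc (0:ℝ) 1) := by
  have m0 : Measurable (fun y : E3 => y 0) := by fun_prop
  have m1 : Measurable (fun s : ℝ => 1 - 2 * s) := by fun_prop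
  have m2 : Measurable (fun s : ℝ => (1 - s) / 2) := by fun_prop
  -- reduce to e0
  have h1 : σ.map (fun y => inner ℝ x y) = σ.map (fun y : E3 => y 0) := by
    have e := Submodule.reflection_sub (v := x) (w := ee 0) (by rw [hx, norm_ee])
    set Rf := (ℝ ∙ (x - ee 0))ᗮ.reflection
    have e1 : (fun y => inner ℝ x y) = (fun y : E3 => y 0) ∘ Rf := by
      ext y
      rw [← LinearIsometryEquiv.inner_map_map Rf x y, e, inner_ee]; rfl
    rw [e1, ← Measure.map_map m0 Rf.continuous.measurable, h.inv]
  have h2 : sv x = (fun s : ℝ => (1 - s) / 2) ∘ (fun y => inner ℝ x y) := by ext y; rfl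
  rw [h2, ← Measure.map_map m2 (meas_inner x), h1, h.law0, Measure.map_map m2 m1]
  have : (fun s : ℝ => (1 - s) / 2) ∘ (fun s : ℝ => 1 - 2 * s) = id := by ext s; simp
  rw [this, Measure.map_id]

end Sph

open MeasureTheory
open scoped ENNReal Classical

namespace Sph

variable {σ : Measure E3}

/-- admissible zonal kernels -/
structure Ker (F : ℝ → ℝ) : Prop where
  meas : Measurable F
  int : IntervalIntegrable F volume 0 1

theorem Ker.of_cont {F : ℝ → ℝ} (hF : Continuous F) : Ker F :=
  ⟨hF.measurable, hF.intervalIntegrable _ _⟩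

theorem integrable_sv (h : Sph σ) {F : ℝ → ℝ} (hF : Ker F) {x : E3} (hx : ‖x‖ = 1) :
    Integrable (fun y => F (sv x y)) σ := by
  have h1 := h.law x hx
  have h2 : Integrable F (σ.map (sv x)) := by
    rw [h1]
    have := (intervalIntegrable_iff_integrableOn_Icc_of_le zero_le_one).mp hF.int
    exact this
  exact (integrable_map_measure hF.meas.aestronglyMeasurable (meas_sv x).aemeasurable).mp h2

theorem integral_sv (h : Sph σ) {F : ℝ → ℝ} (hF : Measurable F) {x : E3} (hx : ‖x‖ = 1) :
    ∫ y, F (sv x y) ∂σ = ∫ s in (0:ℝ)..1, F s := by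
  have h1 := h.law x hx
  have h2 := integral_map (μ := σ) (φ := sv x) (f := F) (meas_sv x).aemeasurable hF.aestronglyMeasurable
  rw [← h2, h1, integral_Icc_eq_integral_Ioc, ← intervalIntegral.integral_of_le zero_le_one]

theorem abs_inner_le_one (h : Sph σ) {x : E3} (hx : ‖x‖ = 1) : ∀ᵐ y ∂σ, |inner ℝ x y| ≤ 1 := by
  have := h.abs_inner_le x
  rwa [hx] at this

theorem sv_mem (h : Sph σ) {x : E3} (hx : ‖x‖ = 1) : ∀ᵐ y ∂σ, sv x y ∈ Set.Icc (0:ℝ) 1 := by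
  filter_upwards [h.abs_inner_le_one hx] with y hy
  have := abs_le.mp hy
  unfold sv
  constructor <;> linarith [this.1, this.2]

theorem Ker.mul_cont {F G : ℝ → ℝ} (hF : Ker F) (hG : Continuous G) : Ker (fun s => F s * G s) :=
  ⟨hF.meas.mul hG.measurable, hF.int.mul_continuousOn hG.continuousOn⟩

theorem Ker.add {F G : ℝ → ℝ} (hF : Ker F) (hG : Ker G) : Ker (fun s => F s + G s) :=
  ⟨hF.meas.add hG.meas, hF.int.add hG.int⟩
theorem Ker.sub {F G : ℝ → ℝ} (hF : Ker F) (hG : Ker G) : Ker (fun s => F s - G s) :=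
  ⟨hF.meas.sub hG.meas, hF.int.sub hG.int⟩
theorem Ker.const_mul {F : ℝ → ℝ} (c : ℝ) (hF : Ker F) : Ker (fun s => c * F s) :=
  ⟨hF.meas.const_mul c, hF.int.const_mul c⟩
theorem Ker.abs {F : ℝ → ℝ} (hF : Ker F) : Ker (fun s => |F s|) :=
  ⟨by have := hF.meas; fun_prop, hF.int.abs⟩

theorem integrable_sv_inner (h : Sph σ) {F : ℝ → ℝ} (hF : Ker F) {x : E3} (hx : ‖x‖ = 1) (w : E3) (n : ℕ) :
    Integrable (fun y => F (sv x y) * (inner ℝ w y) ^ n) σ := by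
  refine (h.integrable_sv hF hx).mul_bdd (c := ‖w‖ ^ n) (by fun_prop) ?_
  filter_upwards [h.abs_inner_le w] with y hy
  rw [Real.norm_eq_abs, abs_pow]
  gcongr

theorem perp_sq (h : Sph σ) {F : ℝ → ℝ} (hF : Ker F) {x : E3} (hx : ‖x‖ = 1) (w : E3)
    (hw : inner ℝ x w = 0) :
    2 * ∫ y, F (sv x y) * (inner ℝ w y) ^ 2 ∂σ = ‖w‖ ^ 2 * ∫ s in (0:ℝ)..1, F s * (1 - (1 - 2 * s) ^ 2) := by
  set I : E3 → ℝ := fun w => ∫ y, F (sv x y) * (inner ℝ w y) ^ 2 ∂σ with hI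
  have hom : ∀ (c : ℝ) w, I (c • w) = c ^ 2 * I w := by
    intro c w
    simp only [hI, real_inner_smul_left]
    rw [← integral_const_mul]
    congr 1; ext y; ring
  have prop : ∀ w', inner ℝ x w' = 0 → ‖w'‖ ^ 2 * I w = ‖w‖ ^ 2 * I w' := by
    intro w' hw'
    rw [← hom, ← hom]
    have := h.integral_swap (fun a b => F ((1 - a) / 2) * b ^ 2) x (‖w'‖ • w) (‖w‖ • w')
      (by rw [norm_smul, norm_smul]; simp [mul_comm]) (by rw [inner_smul_right, hw, mul_zero])
      (by rw [inner_smul_right, hw', mul_zero])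
    exact this
  let e : Fin 3 → E3 := fun i => ee i - (x i) • x
  have hxi : ∀ i, inner ℝ x (ee i) = x i := fun i => by rw [real_inner_comm, inner_ee]
  have hxx : inner ℝ x x = 1 := by rw [real_inner_self_eq_norm_sq, hx]; norm_num
  have he : ∀ i, inner ℝ x (e i) = 0 := by
    intro i; simp only [e]; rw [inner_sub_right, inner_smul_right, hxx, hxi]; ring
  have hen : ∀ i, ‖e i‖ ^ 2 = 1 - (x i) ^ 2 := by
    intro i; simp only [e]
    rw [norm_sub_sq_real, inner_smul_right, real_inner_comm, hxi, norm_smul, norm_ee, hx]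
    simp; ring
  have hs := coord_sq x hx
  have p0 := prop _ (he 0)
  have p1 := prop _ (he 1)
  have p2 := prop _ (he 2)
  rw [hen] at p0 p1 p2
  have i0 : ∀ i, Integrable (fun y => F (sv x y) * (inner ℝ (e i) y) ^ 2) σ := fun i =>
    h.integrable_sv_inner hF hx (e i) 2
  have hsum : I (e 0) + I (e 1) + I (e 2) = ∫ s in (0:ℝ)..1, F s * (1 - (1 - 2 * s) ^ 2) := by
    have a1 := integral_add (i0 0) (i0 1)
    have a2 := integral_add ((i0 0).add (i0 1)) (i0 2)
    simp only [Pi.add_apply] at a1 a2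
    have a3 := h.integral_sv (F := fun s => F s * (1 - (1 - 2 * s) ^ 2)) (hF.mul_cont (by fun_prop)).meas hx
    rw [← a3]
    simp only [hI]
    rw [← a1, ← a2]
    apply integral_congr_ae
    filter_upwards [h.ae_norm] with y hy
    have e1 : ∀ i, inner ℝ (e i) y = y i - x i * inner ℝ x y := by
      intro i; simp only [e]; rw [inner_sub_left, real_inner_smul_left, inner_ee]
    have e2 : inner ℝ x y = x 0 * y 0 + x 1 * y 1 + x 2 * y 2 := by
      rw [PiLp.inner_apply, Fin.sum_univ_three]; simp [mul_comm]
    have hys := coord_sq y hy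
    rw [e1, e1, e1, ← inner_eq_sv]
    have : (y 0 - x 0 * inner ℝ x y) ^ 2 + (y 1 - x 1 * inner ℝ x y) ^ 2 + (y 2 - x 2 * inner ℝ x y) ^ 2 = 1 - (inner ℝ x y) ^ 2 := by
      set t := inner ℝ x y
      have : (y 0 - x 0 * t) ^ 2 + (y 1 - x 1 * t) ^ 2 + (y 2 - x 2 * t) ^ 2 = ((y 0) ^ 2 + (y 1) ^ 2 + (y 2) ^ 2) - 2 * t * (x 0 * y 0 + x 1 * y 1 + x 2 * y 2) + ((x 0) ^ 2 + (x 1) ^ 2 + (x 2) ^ 2) * t ^ 2 := by ring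
      rw [this, hys, hs, ← e2]; ring
    rw [← this]; ring
  rw [← hsum]
  have hIw : I w = ∫ y, F (sv x y) * (inner ℝ w y) ^ 2 ∂σ := rfl
  rw [← hIw]
  have : (3 - ((x 0) ^ 2 + (x 1) ^ 2 + (x 2) ^ 2)) * I w = ‖w‖ ^ 2 * (I (e 0) + I (e 1) + I (e 2)) := by
    linarith
  rw [hs] at this
  linarith

theorem perp_odd (h : Sph σ) (F : ℝ → ℝ) {x : E3} (w : E3) (hw : inner ℝ x w = 0) :
    ∫ y, F (sv x y) * (inner ℝ w y) ∂σ = 0 := by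
  have := h.integral_swap (fun a b => F ((1 - a) / 2) * b) x w (-w) (by simp) hw (by simp [hw])
  simp only [inner_neg_left, mul_neg, integral_neg] at this
  have e : ∫ y, F (sv x y) * (inner ℝ w y) ∂σ = ∫ y, F ((1 - inner ℝ x y) / 2) * (inner ℝ w y) ∂σ := rfl
  linarith

/-- quadratic polynomial in `t = 1 - 2 s`. -/
def quad (a b c : ℝ) (s : ℝ) : ℝ := a + b * (1 - 2 * s) + c * (1 - 2 * s) ^ 2

theorem quad_cont (a b c : ℝ) : Continuous (quad a b c) := by unfold quad; fun_prop

theorem fhq (h : Sph σ) {K : ℝ → ℝ} (hK : Ker K) {x z : E3} (hx : ‖x‖ = 1) (hz : ‖z‖ = 1) (a b c T0 T1 T2 : ℝ)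
    (h0 : ∫ s in (0:ℝ)..1, K s = T0) (h1 : ∫ s in (0:ℝ)..1, K s * (1 - 2 * s) = T1)
    (h2 : ∫ s in (0:ℝ)..1, K s * (1 - 2 * s) ^ 2 = T2) :
    ∫ y, quad a b c (sv x y) * K (sv y z) ∂σ = quad (a * T0 + c / 2 * (T0 - T2)) (b * T1) (c * (3 * T2 - T0) / 2) (sv x z) := by
  set τ : ℝ := inner ℝ z x with hτ
  set w : E3 := x - τ • z with hw
  have hzz : inner ℝ z z = 1 := by rw [real_inner_self_eq_norm_sq, hz]; norm_num
  have hzw : inner ℝ z w = 0 := by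
    rw [hw, inner_sub_right, inner_smul_right, hzz, ← hτ]; ring
  have hwn : ‖w‖ ^ 2 = 1 - τ ^ 2 := by
    rw [hw, norm_sub_sq_real, inner_smul_right, real_inner_comm, ← hτ, norm_smul, hx, hz]
    simp; ring
  have hsq := h.perp_sq hK hz w hzw
  have ho1 := h.perp_odd K w hzw
  have ho2 := h.perp_odd (fun s => K s * (1 - 2 * s)) w hzw
  have hexp : ∀ y, quad a b c (sv x y) * K (sv y z) =
      (K (sv z y) * (a + b * τ * (1 - 2 * sv z y) + c * τ ^ 2 * (1 - 2 * sv z y) ^ 2)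
        + b * (K (sv z y) * inner ℝ w y)) + ((2 * c * τ) * (K (sv z y) * (1 - 2 * sv z y) * inner ℝ w y)
        + c * (K (sv z y) * (inner ℝ w y) ^ 2)) := by
    intro y
    have e1 : inner ℝ x y = τ * inner ℝ z y + inner ℝ w y := by
      rw [hw, inner_sub_left, real_inner_smul_left]; ring
    rw [sv_comm y z]
    unfold quad
    rw [← inner_eq_sv x y, e1, inner_eq_sv z y]
    ring
  have hP : Continuous (fun s : ℝ => a + b * τ * (1 - 2 * s) + c * τ ^ 2 * (1 - 2 * s) ^ 2) := by fun_prop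
  have I1 := h.integrable_sv (hK.mul_cont hP) hz
  have I2 : Integrable (fun y => K (sv z y) * inner ℝ w y) σ := by
    simpa using h.integrable_sv_inner hK hz w 1
  have I3 : Integrable (fun y => K (sv z y) * (1 - 2 * sv z y) * inner ℝ w y) σ := by
    simpa using h.integrable_sv_inner (hK.mul_cont (by fun_prop : Continuous fun s : ℝ => 1 - 2 * s)) hz w 1
  have I4 := h.integrable_sv_inner hK hz w 2
  simp_rw [hexp]
  rw [integral_add (by exact I1.add (I2.const_mul b)) (by exact (I3.const_mul _).add (I4.const_mul c)), integral_add (by exact I1) (by exact I2.const_mul b),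
    integral_add (by exact I3.const_mul _) (by exact I4.const_mul c), integral_const_mul, integral_const_mul, integral_const_mul, ho1, ho2,
    h.integral_sv (hK.mul_cont hP).meas hz]
  have e5 : ∫ s in (0:ℝ)..1, K s * (a + b * τ * (1 - 2 * s) + c * τ ^ 2 * (1 - 2 * s) ^ 2) = a * T0 + b * τ * T1 + c * τ ^ 2 * T2 := by
    have j0 := hK.int
    have j1 := (hK.mul_cont (by fun_prop : Continuous fun s : ℝ => 1 - 2 * s)).int
    have j2 := (hK.mul_cont (by fun_prop : Continuous fun s : ℝ => (1 - 2 * s) ^ 2)).int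
    rw [← h0, ← h1, ← h2, ← intervalIntegral.integral_const_mul, ← intervalIntegral.integral_const_mul, ← intervalIntegral.integral_const_mul,
      ← intervalIntegral.integral_add (j0.const_mul _) (j1.const_mul _), ← intervalIntegral.integral_add ((j0.const_mul _).add (j1.const_mul _)) (j2.const_mul _)]
    congr 1; ext s; ring
  have e6 : ∫ s in (0:ℝ)..1, K s * (1 - (1 - 2 * s) ^ 2) = T0 - T2 := by
    have j0 := hK.int
    have j2 := (hK.mul_cont (by fun_prop : Continuous fun s : ℝ => (1 - 2 * s) ^ 2)).int
    rw [← h0, ← h2, ← intervalIntegral.integral_sub j0 j2]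
    congr 1; ext s; ring
  rw [e5]
  rw [e6, hwn] at hsq
  have e7 : 1 - 2 * sv x z = τ := by rw [← inner_eq_sv, real_inner_comm]
  unfold quad
  rw [e7]
  linear_combination (c / 2) * hsq

end Sph

open MeasureTheory
open scoped ENNReal Classical

namespace Sph

variable {σ : Measure E3}

theorem integrable_prod_sv (h : Sph σ) {F : ℝ → ℝ} (hF : Ker F) :
    Integrable (fun p : E3 × E3 => F (sv p.1 p.2)) (σ.prod σ) := by
  have := h.prob
  have hm : Measurable (fun p : E3 × E3 => F (sv p.1 p.2)) := hF.meas.comp meas_sv2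
  rw [integrable_prod_iff hm.aestronglyMeasurable]
  constructor
  · filter_upwards [h.ae_norm] with x hx
    exact h.integrable_sv hF hx
  · refine (integrable_const (∫ s in (0:ℝ)..1, |F s|)).congr ?_
    filter_upwards [h.ae_norm] with x hx
    have := h.integral_sv hF.abs.meas hx
    simp only [Real.norm_eq_abs]
    rw [this]

/-- bounded measurable functions -/
structure Bd (σ : Measure E3) (u : E3 → ℝ) : Prop where
  meas : Measurable u
  bd : ∃ C, ∀ᵐ x ∂σ, |u x| ≤ C

theorem Bd.integrable {u : E3 → ℝ} (h : Sph σ) (hu : Bd σ u) : Integrable u σ := by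
  obtain ⟨C, hC⟩ := hu.bd
  exact h.integrable_bdd hu.meas C hC

theorem Bd.mul_integrable {u f : E3 → ℝ} (hu : Bd σ u) (hf : Integrable f σ) :
    Integrable (fun x => u x * f x) σ := by
  obtain ⟨C, hC⟩ := hu.bd
  exact hf.bdd_mul hu.meas.aestronglyMeasurable hC

theorem Bd.sub {u v : E3 → ℝ} (hu : Bd σ u) (hv : Bd σ v) : Bd σ (fun x => u x - v x) := by
  obtain ⟨C, hC⟩ := hu.bd
  obtain ⟨D, hD⟩ := hv.bd
  refine ⟨hu.meas.sub hv.meas, C + D, ?_⟩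
  filter_upwards [hC, hD] with x h1 h2
  exact (abs_sub _ _).trans (add_le_add h1 h2)

/-- zonal convolution -/
noncomputable def TT (σ : Measure E3) (F : ℝ → ℝ) (u : E3 → ℝ) (x : E3) : ℝ := ∫ y, F (sv x y) * u y ∂σ

theorem Ker.bd_integrable (h : Sph σ) {F : ℝ → ℝ} (hF : Ker F) {u : E3 → ℝ} (hu : Bd σ u) {x : E3} (hx : ‖x‖ = 1) :
    Integrable (fun y => F (sv x y) * u y) σ := by
  have := hu.mul_integrable (h.integrable_sv hF hx)
  simpa only [mul_comm] using this

theorem TT_meas (h : Sph σ) {F : ℝ → ℝ} (hF : Ker F) {u : E3 → ℝ} (hu : Bd σ u) : Measurable (TT σ F u) := by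
  have := h.prob
  have hm : Measurable (fun p : E3 × E3 => F (sv p.1 p.2) * u p.2) :=
    (hF.meas.comp meas_sv2).mul (hu.meas.comp measurable_snd)
  exact (hm.stronglyMeasurable.integral_prod_right (ν := σ)).measurable

theorem TT_bd (h : Sph σ) {F : ℝ → ℝ} (hF : Ker F) {u : E3 → ℝ} (hu : Bd σ u) : Bd σ (TT σ F u) := by
  refine ⟨TT_meas h hF hu, ?_⟩
  obtain ⟨C, hC⟩ := hu.bd
  refine ⟨(∫ s in (0:ℝ)..1, |F s|) * C, ?_⟩
  filter_upwards [h.ae_norm] with x hx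
  rw [← h.integral_sv hF.abs.meas hx, ← integral_mul_const]
  have := norm_integral_le_of_norm_le (μ := σ) (f := fun y => F (sv x y) * u y) (g := fun y => |F (sv x y)| * C)
    ((h.integrable_sv hF.abs hx).mul_const C) (by
      filter_upwards [hC] with y hy
      rw [Real.norm_eq_abs, abs_mul]
      gcongr)
  exact this

theorem prod_integrable (h : Sph σ) {F : ℝ → ℝ} (hF : Ker F) {u w : E3 → ℝ} (hu : Bd σ u) (hw : Bd σ w) :
    Integrable (fun p : E3 × E3 => u p.1 * (F (sv p.1 p.2) * w p.2)) (σ.prod σ) := by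
  have := h.prob
  obtain ⟨C, hC⟩ := hu.bd
  obtain ⟨D, hD⟩ := hw.bd
  have h1 := h.integrable_prod_sv hF
  have h2 : Integrable (fun p : E3 × E3 => F (sv p.1 p.2) * w p.2) (σ.prod σ) :=
    h1.mul_bdd (c := D) (hw.meas.comp measurable_snd).aestronglyMeasurable
      (Measure.quasiMeasurePreserving_snd.ae hD)
  exact h2.bdd_mul (c := C) (hu.meas.comp measurable_fst).aestronglyMeasurable
      (Measure.quasiMeasurePreserving_fst.ae hC)

theorem TT_symm (h : Sph σ) {F : ℝ → ℝ} (hF : Ker F) {u w : E3 → ℝ} (hu : Bd σ u) (hw : Bd σ w) :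
    ∫ x, u x * TT σ F w x ∂σ = ∫ x, w x * TT σ F u x ∂σ := by
  have := h.prob
  have h1 := prod_integrable h hF hu hw
  simp only [TT, ← integral_const_mul]
  rw [integral_integral_swap h1]
  congr 1; ext y
  congr 1; ext x
  rw [sv_comm x y]; ring

theorem TT_comp (h : Sph σ) {K : ℝ → ℝ} (hK : Ker K) {u : E3 → ℝ} (hu : Bd σ u) {x : E3} (hx : ‖x‖ = 1) (a b c T0 T1 T2 : ℝ)
    (h0 : ∫ s in (0:ℝ)..1, K s = T0) (h1 : ∫ s in (0:ℝ)..1, K s * (1 - 2 * s) = T1)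
    (h2 : ∫ s in (0:ℝ)..1, K s * (1 - 2 * s) ^ 2 = T2) :
    TT σ (quad a b c) (TT σ K u) x = TT σ (quad (a * T0 + c / 2 * (T0 - T2)) (b * T1) (c * (3 * T2 - T0) / 2)) u x := by
  have := h.prob
  have hb : Bd σ (fun y => quad a b c (sv x y)) := by
    refine ⟨(quad_cont a b c).measurable.comp (meas_sv x), ?_⟩
    obtain ⟨C, hC⟩ := isCompact_Icc.exists_bound_of_continuousOn (quad_cont a b c).continuousOn (s := Set.Icc (0:ℝ) 1)
    refine ⟨C, ?_⟩
    filter_upwards [h.sv_mem hx] with y hy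
    exact hC _ hy
  have hi := prod_integrable h hK hb hu
  simp only [TT, ← integral_const_mul]
  rw [integral_integral_swap hi]
  apply integral_congr_ae
  filter_upwards [h.ae_norm] with z hz
  rw [← h.fhq hK hx hz a b c T0 T1 T2 h0 h1 h2, ← integral_mul_const]
  congr 1; ext y; ring

theorem int_poly4 (a0 a1 a2 a3 a4 : ℝ) :
    ∫ s in (0:ℝ)..1, (a0 + a1 * s + a2 * s ^ 2 + a3 * s ^ 3 + a4 * s ^ 4) = a0 + a1 / 2 + a2 / 3 + a3 / 4 + a4 / 5 := by
  have hd : ∀ x ∈ Set.uIcc (0:ℝ) 1, HasDerivAt (fun s : ℝ => a0 * s + a1 * (s ^ 2 / 2) + a2 * (s ^ 3 / 3) + a3 * (s ^ 4 / 4) + a4 * (s ^ 5 / 5))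
      (a0 + a1 * x + a2 * x ^ 2 + a3 * x ^ 3 + a4 * x ^ 4) x := by
    intro x _
    have := (((((hasDerivAt_id x).const_mul a0).add (((hasDerivAt_pow 2 x).div_const 2).const_mul a1)).add
      (((hasDerivAt_pow 3 x).div_const 3).const_mul a2)).add (((hasDerivAt_pow 4 x).div_const 4).const_mul a3)).add
      (((hasDerivAt_pow 5 x).div_const 5).const_mul a4)
    exact this.congr_deriv (by norm_num; try ring)
  rw [intervalIntegral.integral_eq_sub_of_hasDerivAt hd (Continuous.intervalIntegrable (by fun_prop) _ _)]
  norm_num; ring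

/-- Abstract spectral bound. -/
theorem spectral_abs (h : Sph σ) {K : ℝ → ℝ} (hK : Ker K) {u : E3 → ℝ} (hu : Bd σ u) (κ T0 T1 T2 : ℝ)
    (h0 : ∫ s in (0:ℝ)..1, K s = T0) (h1 : ∫ s in (0:ℝ)..1, K s * (1 - 2 * s) = T1)
    (h2 : ∫ s in (0:ℝ)..1, K s * (1 - 2 * s) ^ 2 = T2) (hκ : ∫ s in (0:ℝ)..1, |K s| ≤ κ) :
    ∫ x, u x * TT σ K u x ∂σ - ∫ x, u x * TT σ (quad (-3/2 * T0 + 15/4 * (T0 - T2)) (3 * T1) (15/4 * (3 * T2 - T0))) u x ∂σ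
      ≤ κ * (∫ x, u x ^ 2 ∂σ - ∫ x, u x * TT σ (quad (-3/2) 3 (15/2)) u x ∂σ) := by
  have := h.prob
  set Z := quad (-3/2) 3 (15/2) with hZ
  set Zk := quad (-3/2 * T0 + 15/4 * (T0 - T2)) (3 * T1) (15/4 * (3 * T2 - T0)) with hZk
  have kZ : Ker Z := Ker.of_cont (quad_cont _ _ _)
  have kZk : Ker Zk := Ker.of_cont (quad_cont _ _ _)
  have z0 : ∫ s in (0:ℝ)..1, Z s = 1 := by
    rw [show Z = fun s => 9 + (-36) * s + 30 * s ^ 2 + 0 * s ^ 3 + 0 * s ^ 4 by ext s; rw [hZ]; unfold quad; ring, int_poly4]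
    norm_num
  have z1 : ∫ s in (0:ℝ)..1, Z s * (1 - 2 * s) = 1 := by
    rw [show (fun s => Z s * (1 - 2 * s)) = fun s => 9 + (-54) * s + 102 * s ^ 2 + (-60) * s ^ 3 + 0 * s ^ 4 by ext s; rw [hZ]; unfold quad; ring, int_poly4]
    norm_num
  have z2 : ∫ s in (0:ℝ)..1, Z s * (1 - 2 * s) ^ 2 = 1 := by
    rw [show (fun s => Z s * (1 - 2 * s) ^ 2) = fun s => 9 + (-72) * s + 210 * s ^ 2 + (-264) * s ^ 3 + 120 * s ^ 4 by ext s; rw [hZ]; unfold quad; ring, int_poly4]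
    norm_num
  set p := TT σ Z u with hp
  have bp : Bd σ p := TT_bd h kZ hu
  have bKu : Bd σ (TT σ K u) := TT_bd h hK hu
  have bKp : Bd σ (TT σ K p) := TT_bd h hK bp
  set v : E3 → ℝ := fun x => u x - p x with hv
  have bv : Bd σ v := hu.sub bp
  -- compositions
  have cK : ∀ w, Bd σ w → ∀ᵐ x ∂σ, TT σ Z (TT σ K w) x = TT σ Zk w x := by
    intro w hw
    filter_upwards [h.ae_norm] with x hx
    rw [hZ, TT_comp h hK hw hx _ _ _ T0 T1 T2 h0 h1 h2, hZk]
    congr 2 <;> ring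
  have cZ : ∀ᵐ x ∂σ, TT σ Z p x = p x := by
    filter_upwards [h.ae_norm] with x hx
    have := TT_comp h kZ hu hx (-3/2) 3 (15/2) 1 1 1 z0 z1 z2
    rw [hp, hZ]
    rw [hZ] at this
    rw [this]
    congr 2 <;> norm_num
  have cZk : ∀ᵐ x ∂σ, TT σ Zk p x = TT σ Zk u x := by
    filter_upwards [h.ae_norm] with x hx
    rw [hp, hZk, TT_comp h kZ hu hx _ _ _ 1 1 1 z0 z1 z2]
    congr 2 <;> ring
  -- p·T_K u
  have A1 : ∫ x, p x * TT σ K u x ∂σ = ∫ x, u x * TT σ Zk u x ∂σ := by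
    have e : ∫ x, p x * TT σ K u x ∂σ = ∫ x, TT σ K u x * TT σ Z u x ∂σ := by
      congr 1; ext x; rw [mul_comm]
    rw [e, TT_symm h kZ bKu hu]
    apply integral_congr_ae
    filter_upwards [cK u hu] with x hx
    rw [hx]
  have A2 : ∫ x, p x * TT σ K p x ∂σ = ∫ x, u x * TT σ Zk u x ∂σ := by
    have e : ∫ x, p x * TT σ K p x ∂σ = ∫ x, TT σ K p x * TT σ Z u x ∂σ := by
      congr 1; ext x; rw [mul_comm]
    rw [e, TT_symm h kZ bKp hu]
    apply integral_congr_ae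
    filter_upwards [cK p bp, cZk] with x hx h2x
    rw [hx, h2x]
  have A3 : ∫ x, u x * TT σ K p x ∂σ = ∫ x, u x * TT σ Zk u x ∂σ := by
    rw [TT_symm h hK hu bp, A1]
  have A4 : ∫ x, p x * p x ∂σ = ∫ x, u x * p x ∂σ := by
    have e : ∫ x, p x * p x ∂σ = ∫ x, p x * TT σ Z u x ∂σ := rfl
    rw [e, TT_symm h kZ bp hu]
    apply integral_congr_ae
    filter_upwards [cZ] with x hx
    rw [hx]
  have TKv : ∀ᵐ x ∂σ, TT σ K v x = TT σ K u x - TT σ K p x := by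
    filter_upwards [h.ae_norm] with x hx
    simp only [TT, hv]
    rw [← integral_sub (hK.bd_integrable h hu hx) (hK.bd_integrable h bp hx)]
    congr 1; ext y; ring
  have i1 := hu.mul_integrable (bKu.integrable h)
  have i2 := hu.mul_integrable (bKp.integrable h)
  have i3 := bp.mul_integrable (bKu.integrable h)
  have i4 := bp.mul_integrable (bKp.integrable h)
  have B1 : ∫ x, v x * TT σ K v x ∂σ = ∫ x, u x * TT σ K u x ∂σ - ∫ x, u x * TT σ Zk u x ∂σ := by
    have e : ∫ x, v x * TT σ K v x ∂σ = ∫ x, ((u x * TT σ K u x - u x * TT σ K p x) - (p x * TT σ K u x - p x * TT σ K p x)) ∂σ := by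
      apply integral_congr_ae
      filter_upwards [TKv] with x hx
      rw [hx]; simp only [hv]; ring
    rw [e, integral_sub (by exact i1.sub i2) (by exact i3.sub i4), integral_sub i1 i2, integral_sub i3 i4, A1, A2, A3]
    ring
  have j1 := hu.mul_integrable (hu.integrable h)
  have j2 := hu.mul_integrable (bp.integrable h)
  have j3 := bp.mul_integrable (bp.integrable h)
  have B2 : ∫ x, v x ^ 2 ∂σ = ∫ x, u x ^ 2 ∂σ - ∫ x, u x * p x ∂σ := by
    have e : ∫ x, v x ^ 2 ∂σ = ∫ x, ((u x * u x - u x * p x) - (u x * p x - p x * p x)) ∂σ := by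
      congr 1; ext x; simp only [hv]; ring
    rw [e, integral_sub (by exact j1.sub j2) (by exact j2.sub j3), integral_sub j1 j2, integral_sub j2 j3, A4]
    have : ∫ x, u x ^ 2 ∂σ = ∫ x, u x * u x ∂σ := by congr 1; ext x; ring
    rw [this]; ring
  -- Schur
  have iv2 : Integrable (fun x => v x ^ 2) σ := by
    have := bv.mul_integrable (bv.integrable h)
    refine this.congr (Filter.Eventually.of_forall fun x => ?_); ring
  have bv2 : Bd σ (fun x => v x ^ 2) := by
    refine ⟨bv.meas.pow_const 2, ?_⟩
    obtain ⟨C, hC⟩ := bv.bd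
    refine ⟨C ^ 2, ?_⟩
    filter_upwards [hC] with x hx
    rw [abs_pow]; gcongr
  have one : Bd σ (fun _ => 1) := ⟨measurable_const, 1, by simp⟩
  have S : ∫ x, v x * TT σ K v x ∂σ ≤ (∫ s in (0:ℝ)..1, |K s|) * ∫ x, v x ^ 2 ∂σ := by
    set N := ∫ s in (0:ℝ)..1, |K s|
    have hN : ∀ᵐ x ∂σ, TT σ (fun s => |K s|) (fun _ => 1) x = N := by
      filter_upwards [h.ae_norm] with x hx
      simp only [TT, mul_one]
      exact h.integral_sv hK.abs.meas hx
    have s1 : ∫ x, v x ^ 2 * TT σ (fun s => |K s|) (fun _ => 1) x ∂σ = N * ∫ x, v x ^ 2 ∂σ := by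
      rw [← integral_const_mul]
      apply integral_congr_ae
      filter_upwards [hN] with x hx
      rw [hx]; ring
    have s2 : ∫ x, 1 * TT σ (fun s => |K s|) (fun x => v x ^ 2) x ∂σ = N * ∫ x, v x ^ 2 ∂σ := by
      rw [TT_symm h hK.abs one bv2, s1]
    have k1 := bv2.mul_integrable ((TT_bd h hK.abs one).integrable h)
    have k2 := one.mul_integrable ((TT_bd h hK.abs bv2).integrable h)
    have k3 := bv.mul_integrable ((TT_bd h hK bv).integrable h)
    have : ∫ x, v x * TT σ K v x ∂σ ≤ ∫ x, ((1/2) * (v x ^ 2 * TT σ (fun s => |K s|) (fun _ => 1) x) + (1/2) * (1 * TT σ (fun s => |K s|) (fun x => v x ^ 2) x)) ∂σ := by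
      apply integral_mono_ae k3 ((k1.const_mul _).add (k2.const_mul _))
      filter_upwards [h.ae_norm] with x hx
      simp only [TT, ← integral_const_mul]
      have q1 := (hK.bd_integrable h bv hx).const_mul (v x)
      have q2 := ((hK.abs.bd_integrable h one hx).const_mul (v x ^ 2)).const_mul (1/2)
      have q3 := ((hK.abs.bd_integrable h bv2 hx).const_mul 1).const_mul (1/2)
      rw [Pi.add_apply]
      rw [← integral_add q2 q3]
      apply integral_mono q1 (q2.add q3)
      intro y
      simp only [Pi.add_apply]
      have a1 : v x * (K (sv x y) * v y) ≤ |K (sv x y)| * (|v x| * |v y|) := by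
        calc _ ≤ |v x * (K (sv x y) * v y)| := le_abs_self _
          _ = _ := by rw [abs_mul, abs_mul]; ring
      have a2 : |v x| * |v y| ≤ (v x ^ 2 + v y ^ 2) / 2 := by
        nlinarith [sq_nonneg (|v x| - |v y|), sq_abs (v x), sq_abs (v y)]
      nlinarith [mul_le_mul_of_nonneg_left a2 (abs_nonneg (K (sv x y)))]
    rw [integral_add (k1.const_mul _) (k2.const_mul _), integral_const_mul, integral_const_mul, s1, s2] at this
    linarith
  rw [← B1, ← B2]
  refine S.trans (mul_le_mul_of_nonneg_right hκ (integral_nonneg fun x => sq_nonneg _))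

end Sph

open MeasureTheory
open scoped ENNReal Classical

namespace Sph

variable {σ : Measure E3}

theorem cont_rpow_log {c : ℝ} (hc : 0 < c) : ContinuousOn (fun s : ℝ => s ^ c * Real.log s) (Set.Icc 0 1) := by
  have h1 : Continuous (fun s : ℝ => s ^ c) := Real.continuous_rpow_const hc.le
  have h2 : Continuous (fun s : ℝ => (1 / c) * (s ^ c * Real.log (s ^ c))) :=
    (Real.continuous_mul_log.comp h1).const_mul _
  refine h2.continuousOn.congr ?_
  intro s hs
  rcases eq_or_lt_of_le hs.1 with h | h
  · rw [← h]; simp [Real.zero_rpow hc.ne']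
  · simp only [Real.log_rpow h]; field_simp

theorem cont_rpow_log_sq {c : ℝ} (hc : 0 < c) : ContinuousOn (fun s : ℝ => s ^ c * (Real.log s) ^ 2) (Set.Icc 0 1) := by
  have h1 := (cont_rpow_log (half_pos hc)).pow 2
  refine h1.congr ?_
  intro s hs
  rcases eq_or_lt_of_le hs.1 with h | h
  · rw [← h]; simp [Real.zero_rpow hc.ne']
  · change _ = (s ^ (c / 2) * Real.log s) ^ 2
    rw [mul_pow, ← Real.rpow_mul_natCast h.le]
    have e : c / 2 * ((2:ℕ):ℝ) = c := by push_cast; ring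
    rw [e]

theorem J1 {c : ℝ} (hc : -1 < c) : IntervalIntegrable (fun s : ℝ => s ^ c * (-Real.log s)) volume 0 1 ∧
    ∫ s in (0:ℝ)..1, s ^ c * (-Real.log s) = 1 / (c + 1) ^ 2 := by
  have hc1 : 0 < c + 1 := by linarith
  set A : ℝ → ℝ := fun s => -(1 / (c + 1)) * (s ^ (c + 1) * Real.log s) + (1 / (c + 1) ^ 2) * s ^ (c + 1) with hA
  have hcont : ContinuousOn A (Set.Icc 0 1) :=
    ((cont_rpow_log hc1).const_smul (-(1 / (c + 1)))).add ((Real.continuous_rpow_const hc1.le).const_smul (1 / (c + 1) ^ 2)).continuousOn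
  have hd : ∀ s ∈ Set.Ioo (0:ℝ) 1, HasDerivAt A (s ^ c * (-Real.log s)) s := by
    intro s hs
    have e1 := Real.hasDerivAt_rpow_const (x := s) (p := c + 1) (Or.inl hs.1.ne')
    have e2 := Real.hasDerivAt_log hs.1.ne'
    have := ((e1.mul e2).const_mul (-(1 / (c + 1)))).add (e1.const_mul (1 / (c + 1) ^ 2))
    refine this.congr_deriv ?_
    have : s ^ (c + 1) = s ^ c * s := by rw [Real.rpow_add_one hs.1.ne']
    rw [this, add_sub_cancel_right]
    have := hs.1.ne'
    field_simp; ring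
  have hintg : IntervalIntegrable (fun s : ℝ => s ^ c * (-Real.log s)) volume 0 1 := by
    apply intervalIntegral.intervalIntegrable_deriv_of_nonneg (g := A)
    · rwa [Set.uIcc_of_le zero_le_one]
    · simpa using hd
    · intro s hs
      rw [min_eq_left zero_le_one, max_eq_right zero_le_one] at hs
      exact mul_nonneg (Real.rpow_nonneg hs.1.le _) (by linarith [Real.log_nonpos hs.1.le hs.2.le])
  refine ⟨hintg, ?_⟩
  rw [intervalIntegral.integral_eq_sub_of_hasDerivAt_of_le zero_le_one hcont hd hintg]
  simp [hA, Real.zero_rpow hc1.ne']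

theorem J2 {c : ℝ} (hc : -1 < c) : IntervalIntegrable (fun s : ℝ => s ^ c * (Real.log s) ^ 2) volume 0 1 ∧
    ∫ s in (0:ℝ)..1, s ^ c * (Real.log s) ^ 2 = 2 / (c + 1) ^ 3 := by
  have hc1 : 0 < c + 1 := by linarith
  set A : ℝ → ℝ := fun s => ((1 / (c + 1)) * (s ^ (c + 1) * (Real.log s) ^ 2) + -(2 / (c + 1) ^ 2) * (s ^ (c + 1) * Real.log s)) + (2 / (c + 1) ^ 3) * s ^ (c + 1) with hA
  have hcont : ContinuousOn A (Set.Icc 0 1) :=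
    (((cont_rpow_log_sq hc1).const_smul (1 / (c + 1))).add ((cont_rpow_log hc1).const_smul (-(2 / (c + 1) ^ 2)))).add ((Real.continuous_rpow_const hc1.le).const_smul (2 / (c + 1) ^ 3)).continuousOn
  have hd : ∀ s ∈ Set.Ioo (0:ℝ) 1, HasDerivAt A (s ^ c * (Real.log s) ^ 2) s := by
    intro s hs
    have e1 := Real.hasDerivAt_rpow_const (x := s) (p := c + 1) (Or.inl hs.1.ne')
    have e2 := Real.hasDerivAt_log hs.1.ne'
    have := (((e1.mul (e2.pow 2)).const_mul (1 / (c + 1))).add ((e1.mul e2).const_mul (-(2 / (c + 1) ^ 2)))).add (e1.const_mul (2 / (c + 1) ^ 3))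
    refine this.congr_deriv ?_
    have : s ^ (c + 1) = s ^ c * s := by rw [Real.rpow_add_one hs.1.ne']
    simp only [Pi.pow_apply]
    rw [this, add_sub_cancel_right]
    have := hs.1.ne'
    field_simp; norm_num; ring
  have hintg : IntervalIntegrable (fun s : ℝ => s ^ c * (Real.log s) ^ 2) volume 0 1 := by
    apply intervalIntegral.intervalIntegrable_deriv_of_nonneg (g := A)
    · rwa [Set.uIcc_of_le zero_le_one]
    · simpa using hd
    · intro s hs
      rw [min_eq_left zero_le_one, max_eq_right zero_le_one] at hs
      exact mul_nonneg (Real.rpow_nonneg hs.1.le _) (sq_nonneg _)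
  refine ⟨hintg, ?_⟩
  rw [intervalIntegral.integral_eq_sub_of_hasDerivAt_of_le zero_le_one hcont hd hintg]
  simp [hA, Real.zero_rpow hc1.ne']

theorem J0 {c : ℝ} (hc : -1 < c) : IntervalIntegrable (fun s : ℝ => s ^ c) volume 0 1 ∧
    ∫ s in (0:ℝ)..1, s ^ c = 1 / (c + 1) := by
  refine ⟨intervalIntegral.intervalIntegrable_rpow' hc, ?_⟩
  rw [integral_rpow (Or.inl hc), Real.one_rpow, Real.zero_rpow (by linarith)]; simp

/-- the logarithmic kernel -/
noncomputable def gk (s : ℝ) : ℝ := -Real.log s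

theorem ker_gk : Ker gk := ⟨Real.measurable_log.neg, intervalIntegral.intervalIntegrable_log'.neg⟩

noncomputable def qq (s : ℝ) : ℝ := 273/100 - 553/100 * s + 292/100 * s ^ 2

theorem ker_qq : Ker qq := Ker.of_cont (by unfold qq; fun_prop)

theorem gk_mom (n : ℕ) : IntervalIntegrable (fun s : ℝ => gk s * s ^ n) volume 0 1 ∧
    ∫ s in (0:ℝ)..1, gk s * s ^ n = 1 / ((n:ℝ) + 1) ^ 2 := by
  have := J1 (c := (n:ℝ)) (by have : (0:ℝ) ≤ n := n.cast_nonneg; linarith)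
  simp only [Real.rpow_natCast] at this
  have e : (fun s : ℝ => gk s * s ^ n) = fun s => s ^ n * (-Real.log s) := by ext s; unfold gk; ring
  rw [e]
  exact this

theorem gk_quad (a b c : ℝ) : ∫ s in (0:ℝ)..1, gk s * (a + b * s + c * s ^ 2) = a + b / 4 + c / 9 := by
  have h0 := gk_mom 0
  have h1 := gk_mom 1
  have h2 := gk_mom 2
  have e : (fun s : ℝ => gk s * (a + b * s + c * s ^ 2)) = fun s => (a * (gk s * s ^ 0) + b * (gk s * s ^ 1)) + c * (gk s * s ^ 2) := by
    ext s; ring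
  rw [e, intervalIntegral.integral_add ((h0.1.const_mul a).add (h1.1.const_mul b)) (h2.1.const_mul c),
    intervalIntegral.integral_add (h0.1.const_mul a) (h1.1.const_mul b), intervalIntegral.integral_const_mul, intervalIntegral.integral_const_mul,
    intervalIntegral.integral_const_mul, h0.2, h1.2, h2.2]
  norm_num; ring

theorem schur_const : ∫ s in (0:ℝ)..1, |gk s - qq s| ≤ 1 / 6 := by
  have hK := (ker_gk.sub ker_qq).abs.int
  have r1 : ∀ k : ℕ, IntervalIntegrable (fun s : ℝ => s ^ ((7/10 : ℝ) + k)) volume 0 1 ∧ ∫ s in (0:ℝ)..1, s ^ ((7/10 : ℝ) + k) = 1 / (7/10 + k + 1) := fun k =>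
    J0 (by have : (0:ℝ) ≤ k := k.cast_nonneg; linarith)
  have r2 : ∀ k : ℕ, IntervalIntegrable (fun s : ℝ => s ^ ((7/10 : ℝ) + k) * (-Real.log s)) volume 0 1 ∧ ∫ s in (0:ℝ)..1, s ^ ((7/10 : ℝ) + k) * (-Real.log s) = 1 / (7/10 + k + 1) ^ 2 := fun k =>
    J1 (by have : (0:ℝ) ≤ k := k.cast_nonneg; linarith)
  have r3 := J2 (c := 7/10) (by norm_num)
  have r4 := J0 (c := -(7/10)) (by norm_num)
  set Bd : ℝ → ℝ := fun s => 1/40 * s ^ (-(7/10) : ℝ) + (10 * (s ^ (7/10 : ℝ) * (Real.log s) ^ 2) + ((-20 * 273/100) * (s ^ ((7/10 : ℝ) + (0:ℕ)) * (-Real.log s)) + ((20 * 553/100) * (s ^ ((7/10 : ℝ) + (1:ℕ)) * (-Real.log s)) + ((-20*292/100) * (s ^ ((7/10 : ℝ) + (2:ℕ)) * (-Real.log s)) +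
    (10 * (273/100)^2 * s ^ ((7/10 : ℝ) + (0:ℕ)) + (10 * (-2 * 273/100*553/100) * s ^ ((7/10 : ℝ) + (1:ℕ)) + (10 * ((553/100)^2 + 2*273/100*292/100) * s ^ ((7/10 : ℝ) + (2:ℕ)) + (10 * (-2*553/100*292/100) * s ^ ((7/10 : ℝ) + (3:ℕ)) + 10 * (292/100)^2 * s ^ ((7/10 : ℝ) + (4:ℕ)))))))))) with hBd
  have i10 := (r1 4).1.const_mul (10 * (292/100)^2)
  have i9 := (r1 3).1.const_mul (10 * (-2*553/100*292/100))
  have i8 := (r1 2).1.const_mul (10 * ((553/100)^2 + 2*273/100*292/100))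
  have i7 := (r1 1).1.const_mul (10 * (-2 * 273/100*553/100))
  have i6 := (r1 0).1.const_mul (10 * (273/100)^2)
  have i5 := (r2 2).1.const_mul (-20*292/100)
  have i4 := (r2 1).1.const_mul (20 * 553/100)
  have i3 := (r2 0).1.const_mul (-20 * 273/100)
  have i2 := r3.1.const_mul 10
  have i1 := r4.1.const_mul (1/40)
  have j9 := i9.add i10
  have j8 := i8.add j9
  have j7 := i7.add j8
  have j6 := i6.add j7
  have j5 := i5.add j6
  have j4 := i4.add j5
  have j3 := i3.add j4
  have j2 := i2.add j3
  have j1 := i1.add j2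
  have hle : ∫ s in (0:ℝ)..1, |gk s - qq s| ≤ ∫ s in (0:ℝ)..1, Bd s := by
    apply intervalIntegral.integral_mono_on_of_le_Ioo zero_le_one hK j1
    intro s hs
    have hs0 := hs.1
    have p0 : 0 < s ^ (7/10 : ℝ) := Real.rpow_pos_of_pos hs0 _
    have e0 : ∀ k : ℕ, s ^ ((7/10 : ℝ) + k) = s ^ (7/10 : ℝ) * s ^ k := fun k => by
      rw [Real.rpow_add_natCast hs0.ne']
    have em : s ^ (-(7/10) : ℝ) = (s ^ (7/10 : ℝ))⁻¹ := Real.rpow_neg hs0.le _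
    simp only [e0, em]
    set w := s ^ (7/10 : ℝ)
    set N := gk s - qq s with hN
    have h1 : |N| ≤ 1/40 * w⁻¹ + 10 * (N ^ 2 * w) := by
      have h2 : (0:ℝ) ≤ w⁻¹ / 40 * (1 - 20 * (|N| * w)) ^ 2 := by positivity
      have h3 : w⁻¹ / 40 * (1 - 20 * (|N| * w)) ^ 2 = 1/40 * w⁻¹ - |N| + 10 * (|N| ^ 2 * w) := by
        field_simp; ring
      rw [sq_abs] at h3
      linarith
    refine h1.trans (le_of_eq ?_)
    rw [hN]; unfold gk qq; ring
  refine hle.trans ?_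
  simp only [hBd]
  rw [intervalIntegral.integral_add i1 j2, intervalIntegral.integral_add i2 j3, intervalIntegral.integral_add i3 j4, intervalIntegral.integral_add i4 j5, intervalIntegral.integral_add i5 j6, intervalIntegral.integral_add i6 j7, intervalIntegral.integral_add i7 j8, intervalIntegral.integral_add i8 j9, intervalIntegral.integral_add i9 i10]
  simp only [intervalIntegral.integral_const_mul]
  rw [r4.2, r3.2, (r2 0).2, (r2 1).2, (r2 2).2, (r1 0).2, (r1 1).2, (r1 2).2, (r1 3).2, (r1 4).2]
  norm_num

theorem spectral (h : Sph σ) {u : E3 → ℝ} (hu : Bd σ u) :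
    ∫ x, u x * TT σ gk u x ∂σ ≤ (1/6) * ∫ x, u x ^ 2 ∂σ + ∫ x, u x * TT σ (fun s => 5/6 + (1 - 2 * s)) u x ∂σ := by
  have hK : Ker (fun s => gk s - qq s) := ker_gk.sub ker_qq
  have mom : ∀ a b c : ℝ, ∫ s in (0:ℝ)..1, (gk s - qq s) * (a + b * s + c * s ^ 2) =
      a + b / 4 + c / 9 - (273/100 * a + (273/100 * b - 553/100 * a) / 2 + (273/100 * c - 553/100 * b + 292/100 * a) / 3 + (292/100 * b - 553/100 * c) / 4 + 292/100 * c / 5) := by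
    intro a b c
    have e : (fun s => (gk s - qq s) * (a + b * s + c * s ^ 2)) = fun s => gk s * (a + b * s + c * s ^ 2) - (273/100 * a + (273/100 * b - 553/100 * a) * s + (273/100 * c - 553/100 * b + 292/100 * a) * s ^ 2 + (292/100 * b - 553/100 * c) * s ^ 3 + 292/100 * c * s ^ 4) := by
      ext s; unfold qq; ring
    rw [e, intervalIntegral.integral_sub (ker_gk.mul_cont (by fun_prop)).int (Continuous.intervalIntegrable (by fun_prop) _ _), gk_quad, int_poly4]
  have m0 := mom 1 0 0
  have m1 := mom 1 (-2) 0
  have m2 := mom 1 (-4) 4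
  have c0 : ∫ s in (0:ℝ)..1, (gk s - qq s) = 37/600 := by
    have : (fun s => (gk s - qq s)) = fun s => (gk s - qq s) * (1 + 0 * s + 0 * s ^ 2) := by ext s; ring
    rw [this, m0]; norm_num
  have c1 : ∫ s in (0:ℝ)..1, (gk s - qq s) * (1 - 2 * s) = 13/200 := by
    have : (fun s => (gk s - qq s) * (1 - 2 * s)) = fun s => (gk s - qq s) * (1 + (-2) * s + 0 * s ^ 2) := by ext s; ring
    rw [this, m1]; norm_num
  have c2 : ∫ s in (0:ℝ)..1, (gk s - qq s) * (1 - 2 * s) ^ 2 = 601/9000 := by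
    have : (fun s => (gk s - qq s) * (1 - 2 * s) ^ 2) = fun s => (gk s - qq s) * (1 + (-4) * s + 4 * s ^ 2) := by ext s; ring
    rw [this, m2]; norm_num
  have key := spectral_abs h hK hu (1/6) _ _ _ c0 c1 c2 schur_const
  set Zk := quad (-3/2 * (37/600) + 15/4 * (37/600 - 601/9000)) (3 * (13/200)) (15/4 * (3 * (601/9000) - 37/600)) with hZk
  have kZk : Ker Zk := Ker.of_cont (quad_cont _ _ _)
  have kZ : Ker (quad (-3 / 2) 3 (15 / 2)) := Ker.of_cont (quad_cont _ _ _)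
  have kl : Ker (fun s : ℝ => 5/6 + (1 - 2 * s)) := Ker.of_cont (by fun_prop)
  have hpt : ∀ᵐ x ∂σ, TT σ gk u x = (TT σ (fun s => gk s - qq s) u x - TT σ Zk u x) + (1/6) * TT σ (quad (-3/2) 3 (15/2)) u x + TT σ (fun s => 5/6 + (1 - 2 * s)) u x := by
    filter_upwards [h.ae_norm] with x hx
    simp only [TT]
    have a1 := hK.bd_integrable h hu hx
    have a2 := kZk.bd_integrable h hu hx
    have a3 := kZ.bd_integrable h hu hx
    have a4 := kl.bd_integrable h hu hx
    rw [← integral_const_mul, ← integral_sub a1 a2, ← integral_add (by exact a1.sub a2) (a3.const_mul _), ← integral_add (by exact (a1.sub a2).add (a3.const_mul _)) a4]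
    congr 1; ext y
    rw [hZk]; unfold quad qq; ring
  have b1 := hu.mul_integrable ((TT_bd h hK hu).integrable h)
  have b2 := hu.mul_integrable ((TT_bd h kZk hu).integrable h)
  have b3 := hu.mul_integrable ((TT_bd h kZ hu).integrable h)
  have b4 := hu.mul_integrable ((TT_bd h kl hu).integrable h)
  have tot : ∫ x, u x * TT σ gk u x ∂σ = (∫ x, u x * TT σ (fun s => gk s - qq s) u x ∂σ - ∫ x, u x * TT σ Zk u x ∂σ) + (1/6) * ∫ x, u x * TT σ (quad (-3/2) 3 (15/2)) u x ∂σ + ∫ x, u x * TT σ (fun s => 5/6 + (1 - 2 * s)) u x ∂σ := by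
    rw [← integral_const_mul, ← integral_sub b1 b2, ← integral_add (by exact b1.sub b2) (b3.const_mul _), ← integral_add (by exact (b1.sub b2).add (b3.const_mul _)) b4]
    apply integral_congr_ae
    filter_upwards [hpt] with x hx
    rw [hx]; ring
  rw [tot]
  linarith

end Sph

open MeasureTheory
open scoped ENNReal Classical

noncomputable def phi (h : ℝ) : ℝ := (2 + h) * Real.log (1 + h / 2) - h

theorem meas_phi : Measurable phi := by unfold phi; fun_prop

theorem young (h k : ℝ) (hh : -1 ≤ h) : h * k ≤ phi h + 2 * (Real.exp k - 1 - k) := by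
  have hX : 0 < 1 + h / 2 := by linarith
  have h1 := Real.add_one_le_exp (k - Real.log (1 + h / 2))
  rw [Real.exp_sub, Real.exp_log hX, le_div_iff₀ hX] at h1
  unfold phi
  nlinarith

theorem phi_nonneg (h : ℝ) (hh : -1 ≤ h) : 0 ≤ phi h := by
  have := young h 0 hh
  simpa using this

namespace Sph

variable {σ : Measure E3}

theorem gk_nonneg {s : ℝ} (hs : s ∈ Set.Icc (0:ℝ) 1) : 0 ≤ gk s := by
  unfold gk
  have := Real.log_nonpos hs.1 hs.2
  linarith

/-- functions with uniformly bounded logarithmic potential -/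
structure Good (σ : Measure E3) (f : E3 → ℝ) : Prop where
  meas : Measurable f
  int : Integrable f σ
  pot : ∃ C, ∀ x, ‖x‖ = 1 → Integrable (fun y => gk (sv x y) * f y) σ ∧ ∫ y, |gk (sv x y) * f y| ∂σ ≤ C

theorem Good.mono {f f' : E3 → ℝ} (hf : Good σ f) (hm : Measurable f') (c : ℝ) (hc : ∀ x, |f' x| ≤ c * |f x|) : Good σ f' := by
  refine ⟨hm, ?_, ?_⟩
  · refine (hf.int.abs.const_mul c).mono' hm.aestronglyMeasurable (Filter.Eventually.of_forall hc)
  · obtain ⟨C, hC⟩ := hf.pot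
    refine ⟨|c| * C, fun x hx => ?_⟩
    have hmm : Measurable (fun y => gk (sv x y) * f' y) := (ker_gk.meas.comp (meas_sv x)).mul hm
    have hle : ∀ y, |gk (sv x y) * f' y| ≤ |c| * |gk (sv x y) * f y| := by
      intro y
      rw [abs_mul, abs_mul]
      have h1 : |f' y| ≤ |c| * |f y| := (hc y).trans (mul_le_mul_of_nonneg_right (le_abs_self c) (abs_nonneg _))
      nlinarith [mul_le_mul_of_nonneg_left h1 (abs_nonneg (gk (sv x y)))]
    have hi : Integrable (fun y => gk (sv x y) * f' y) σ :=
      ((hC x hx).1.abs.const_mul |c|).mono' hmm.aestronglyMeasurable (Filter.Eventually.of_forall hle)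
    refine ⟨hi, ?_⟩
    calc _ ≤ ∫ y, |c| * |gk (sv x y) * f y| ∂σ := integral_mono hi.abs ((hC x hx).1.abs.const_mul |c|) hle
      _ = |c| * ∫ y, |gk (sv x y) * f y| ∂σ := integral_const_mul _ _
      _ ≤ _ := mul_le_mul_of_nonneg_left (hC x hx).2 (abs_nonneg _)

theorem Good.TT_bd (h : Sph σ) {f : E3 → ℝ} (hf : Good σ f) : Bd σ (TT σ gk f) := by
  have := h.prob
  refine ⟨?_, ?_⟩
  · have hm : Measurable (fun p : E3 × E3 => gk (sv p.1 p.2) * f p.2) :=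
      (ker_gk.meas.comp meas_sv2).mul (hf.meas.comp measurable_snd)
    exact (hm.stronglyMeasurable.integral_prod_right (ν := σ)).measurable
  · obtain ⟨C, hC⟩ := hf.pot
    refine ⟨C, ?_⟩
    filter_upwards [h.ae_norm] with x hx
    exact (abs_integral_le_integral_abs).trans (hC x hx).2

theorem Good.prod_integrable (h : Sph σ) {f u : E3 → ℝ} (hf : Good σ f) (hu : Integrable u σ) (hum : Measurable u) :
    Integrable (fun p : E3 × E3 => u p.1 * (gk (sv p.1 p.2) * f p.2)) (σ.prod σ) := by
  have := h.prob
  have hm : Measurable (fun p : E3 × E3 => u p.1 * (gk (sv p.1 p.2) * f p.2)) :=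
    (hum.comp measurable_fst).mul ((ker_gk.meas.comp meas_sv2).mul (hf.meas.comp measurable_snd))
  obtain ⟨C, hC⟩ := hf.pot
  rw [integrable_prod_iff hm.aestronglyMeasurable]
  constructor
  · filter_upwards [h.ae_norm] with x hx
    exact (hC x hx).1.const_mul _
  · refine (hu.abs.mul_const C).mono' ?_ ?_
    · exact (hm.norm.stronglyMeasurable.integral_prod_right (ν := σ)).aestronglyMeasurable
    · filter_upwards [h.ae_norm] with x hx
      rw [Real.norm_eq_abs, abs_of_nonneg (integral_nonneg fun y => norm_nonneg _)]
      simp only [Real.norm_eq_abs, abs_mul (u x)]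
      rw [integral_const_mul]
      exact mul_le_mul_of_nonneg_left (hC x hx).2 (abs_nonneg _)

theorem Good.symm (h : Sph σ) {f u : E3 → ℝ} (hf : Good σ f) (hu : Integrable u σ) (hum : Measurable u) :
    ∫ x, u x * TT σ gk f x ∂σ = ∫ x, f x * TT σ gk u x ∂σ := by
  have := h.prob
  have h1 := hf.prod_integrable h hu hum
  simp only [TT, ← integral_const_mul]
  rw [integral_integral_swap h1]
  congr 1; ext y
  congr 1; ext x
  rw [sv_comm x y]; ring

/-- The hypotheses on `h`. -/
structure Hyp (σ : Measure E3) (f : E3 → ℝ) : Prop where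
  meas : Measurable f
  lb : ∀ x, -1 ≤ f x
  int : Integrable f σ
  ph : Integrable (fun x => phi (f x)) σ
  mean : ∫ x, f x ∂σ = 0
  bary : ∀ x, ∫ y, inner ℝ x y * f y ∂σ = 0

theorem Hyp.good2 (h : Sph σ) {f : E3 → ℝ} (hf : Hyp σ f) : Good σ (fun x => f x + 2) := by
  have := h.prob
  refine ⟨hf.meas.add_const 2, hf.int.add (integrable_const 2), ?_⟩
  have kr : Ker (fun s : ℝ => 4 * s ^ (-(1/2) : ℝ) + 2 * gk s) :=
    ⟨by have := ker_gk.meas; fun_prop, ((intervalIntegral.intervalIntegrable_rpow' (by norm_num)).const_mul 4).add (ker_gk.int.const_mul 2)⟩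
  refine ⟨∫ y, 2 * phi (f y) ∂σ + ∫ s in (0:ℝ)..1, (4 * s ^ (-(1/2) : ℝ) + 2 * gk s), fun x hx => ?_⟩
  have hm : Measurable (fun y => gk (sv x y) * (f y + 2)) := (ker_gk.meas.comp (meas_sv x)).mul (hf.meas.add_const 2)
  have i1 := hf.ph.const_mul 2
  have i2 := h.integrable_sv kr hx
  have hle : ∀ᵐ y ∂σ, |gk (sv x y) * (f y + 2)| ≤ 2 * phi (f y) + (4 * (sv x y) ^ (-(1/2) : ℝ) + 2 * gk (sv x y)) := by
    filter_upwards [h.sv_mem hx] with y hy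
    have g0 := gk_nonneg hy
    have l0 := hf.lb y
    rw [abs_of_nonneg (mul_nonneg g0 (by linarith))]
    have yo := young (f y) (gk (sv x y) / 2) l0
    have ex : Real.exp (gk (sv x y) / 2) ≤ (sv x y) ^ (-(1/2) : ℝ) ∨ sv x y = 0 := by
      rcases eq_or_lt_of_le hy.1 with h0 | h0
      · right; exact h0.symm
      · left; rw [Real.rpow_def_of_pos h0]; unfold gk; apply le_of_eq; congr 1; ring
    rcases ex with ex | ex
    · linarith
    · rw [ex]; unfold gk; simp [Real.log_zero]
      have := phi_nonneg (f y) l0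
      have : (0:ℝ) ≤ 0 ^ (-(1/2) : ℝ) := by positivity
      norm_num at this ⊢
      linarith
  have hi : Integrable (fun y => gk (sv x y) * (f y + 2)) σ := (i1.add i2).mono' hm.aestronglyMeasurable hle
  refine ⟨hi, ?_⟩
  rw [← h.integral_sv kr.meas hx, ← integral_add i1 i2]
  exact integral_mono_ae hi.abs (i1.add i2) hle

theorem Hyp.good (h : Sph σ) {f f' : E3 → ℝ} (hf : Hyp σ f) (hm : Measurable f') (c : ℝ) (hc : ∀ x, |f' x| ≤ c * (f x + 2)) : Good σ f' := by
  refine (hf.good2 h).mono hm c fun x => ?_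
  have e : |f x + 2| = f x + 2 := abs_of_nonneg (by linarith [hf.lb x])
  rw [e]
  exact hc x

noncomputable def Ff (H R α β γ h s : ℝ) : ℝ :=
  R * ((h + min h H) * (gk s - 1) + (h - min h H) * (1 - 2 * s)) + (α + β * (s - 1/2)) * h + γ * (h - min h H) - phi h + (min h H) ^ 2 / 6

/-- certificate: integrable majorant of `Ff` -/
def NodeOK (H R α β γ c : ℝ) : Prop :=
  ∃ M : ℝ → ℝ, Ker M ∧ (∀ h s, -1 ≤ h → 0 < s → s ≤ 1 → Ff H R α β γ h s ≤ M s) ∧ ∫ s in (0:ℝ)..1, M s ≤ c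

theorem NodeOK.comb {H R α β γ c R' α' β' γ' c' : ℝ} (h1 : NodeOK H R α β γ c) (h2 : NodeOK H R' α' β' γ' c') (l m : ℝ) (hl : 0 ≤ l) (hm : 0 ≤ m) (hlm : l + m = 1) :
    NodeOK H (l * R + m * R') (l * α + m * α') (l * β + m * β') (l * γ + m * γ') (l * c + m * c') := by
  obtain ⟨M, k, b, i⟩ := h1
  obtain ⟨M', k', b', i'⟩ := h2
  refine ⟨fun s => l * M s + m * M' s, (k.const_mul l).add (k'.const_mul m), ?_, ?_⟩
  · intro h s hh hs hs1
    have e : Ff H (l * R + m * R') (l * α + m * α') (l * β + m * β') (l * γ + m * γ') h s = l * Ff H R α β γ h s + m * Ff H R' α' β' γ' h s := by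
      have : l = 1 - m := by linarith
      subst this
      unfold Ff; ring
    rw [e]
    exact add_le_add (mul_le_mul_of_nonneg_left (b h s hh hs hs1) hl) (mul_le_mul_of_nonneg_left (b' h s hh hs hs1) hm)
  · rw [intervalIntegral.integral_add (k.int.const_mul l) (k'.int.const_mul m), intervalIntegral.integral_const_mul, intervalIntegral.integral_const_mul]
    exact add_le_add (mul_le_mul_of_nonneg_left i hl) (mul_le_mul_of_nonneg_left i' hm)

theorem NodeOK.le {H R α β γ c c' : ℝ} (h1 : NodeOK H R α β γ c) (h : c ≤ c') : NodeOK H R α β γ c' := by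
  obtain ⟨M, k, b, i⟩ := h1
  exact ⟨M, k, b, i.trans h⟩

/-- `∫ max(h - H, 0)` -/
noncomputable def RH (σ : Measure E3) (f : E3 → ℝ) (H : ℝ) : ℝ := ∫ x, (f x - min (f x) H) ∂σ

theorem sv_pos_ae (h : Sph σ) {x : E3} (hx : ‖x‖ = 1) : ∀ᵐ y ∂σ, 0 < sv x y ∧ sv x y ≤ 1 := by
  have h1 : ∀ᵐ s ∂(σ.map (sv x)), 0 < s ∧ s ≤ 1 := by
    rw [h.law x hx, ae_restrict_iff' measurableSet_Icc]
    have : ∀ᵐ s : ℝ ∂volume, s ≠ 0 := by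
      rw [ae_iff]; simp
    filter_upwards [this] with s hs hs2
    exact ⟨lt_of_le_of_ne hs2.1 (Ne.symm hs), hs2.2⟩
  exact ae_of_ae_map (meas_sv x).aemeasurable h1

theorem coupling0 (h : Sph σ) {f : E3 → ℝ} (hf : Hyp σ f) {H : ℝ} (hH : 1 ≤ H) :
    ∫ x, f x * TT σ gk f x ∂σ ≤ (1/6) * ∫ x, (min (f x) H) ^ 2 ∂σ + 5/6 * (RH σ f H) ^ 2
      + ∫ x, (f x - min (f x) H) * (TT σ gk (fun y => f y + min (f y) H) x + TT σ (fun s => 1 - 2 * s) (fun y => f y - min (f y) H) x) ∂σ := by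
  have := h.prob
  set u : E3 → ℝ := fun x => min (f x) H with hu
  set r : E3 → ℝ := fun x => f x - min (f x) H with hr
  set w : E3 → ℝ := fun x => f x + min (f x) H with hw
  have mu : Measurable u := hf.meas.min measurable_const
  have mr : Measurable r := hf.meas.sub mu
  have mw : Measurable w := hf.meas.add mu
  have ub : ∀ x, -1 ≤ u x ∧ u x ≤ H ∧ u x ≤ f x := fun x => ⟨le_min (hf.lb x) (by linarith), min_le_right _ _, min_le_left _ _⟩
  have bu : Bd σ u := ⟨mu, H, Filter.Eventually.of_forall fun x => abs_le.mpr ⟨by linarith [(ub x).1], (ub x).2.1⟩⟩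
  have rb : ∀ x, 0 ≤ r x ∧ r x ≤ f x + 2 := fun x => ⟨by simp only [hr]; linarith [(ub x).2.2], by have := (ub x).1; simp only [hr]; simp only [hu] at this; linarith⟩
  have gf : Good σ f := hf.good h hf.meas 1 fun x => by rw [abs_le]; constructor <;> linarith [hf.lb x]
  have gr : Good σ r := hf.good h mr 1 fun x => by rw [abs_le]; constructor <;> linarith [(rb x).1, (rb x).2, hf.lb x]
  have gu : Good σ u := hf.good h mu 1 fun x => by rw [abs_le]; constructor <;> linarith [(ub x).1, (ub x).2.2, hf.lb x]
  have gw : Good σ w := hf.good h mw 2 fun x => by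
    have := ub x
    simp only [hw]; simp only [hu] at this
    rw [abs_le]; constructor <;> linarith [hf.lb x]
  have kt : Ker (fun s : ℝ => 1 - 2 * s) := Ker.of_cont (by fun_prop)
  have kc : Ker (fun s : ℝ => 5/6 + (1 - 2 * s)) := Ker.of_cont (by fun_prop)
  have it : ∀ v : E3 → ℝ, Integrable v σ → ∀ x, ‖x‖ = 1 → Integrable (fun y => (1 - 2 * sv x y) * v y) σ := by
    intro v hv x hx
    refine hv.bdd_mul (c := 1) (by have := meas_sv x; fun_prop) ?_
    filter_upwards [h.abs_inner_le_one hx] with y hy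
    rw [← inner_eq_sv]; exact hy
  -- TT_t f = 0
  have t0 : ∀ x, TT σ (fun s => 1 - 2 * s) f x = 0 := by
    intro x
    have := hf.bary x
    simp only [TT, ← inner_eq_sv]
    exact this
  have tu : ∀ x, ‖x‖ = 1 → TT σ (fun s => 1 - 2 * s) u x = - TT σ (fun s => 1 - 2 * s) r x := by
    intro x hx
    have e : TT σ (fun s => 1 - 2 * s) u x + TT σ (fun s => 1 - 2 * s) r x = TT σ (fun s => 1 - 2 * s) f x := by
      simp only [TT]
      rw [← integral_add (it u gu.int x hx) (it r gr.int x hx)]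
      congr 1; ext y; simp only [hu, hr]; ring
    rw [t0] at e; linarith
  have mean_u : ∫ x, u x ∂σ = - RH σ f H := by
    have : ∫ x, u x ∂σ + ∫ x, r x ∂σ = ∫ x, f x ∂σ := by
      rw [← integral_add gu.int gr.int]
      congr 1; ext y; simp only [hu, hr]; ring
    rw [hf.mean] at this
    have e : RH σ f H = ∫ x, r x ∂σ := rfl
    rw [e]; linarith
  -- measurability/boundedness of TT_t r
  have btr : Bd σ (TT σ (fun s => 1 - 2 * s) r) := by
    refine ⟨?_, ∫ y, |r y| ∂σ, ?_⟩
    · have hm : Measurable (fun p : E3 × E3 => (1 - 2 * sv p.1 p.2) * r p.2) :=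
        (kt.meas.comp meas_sv2).mul (mr.comp measurable_snd)
      exact (hm.stronglyMeasurable.integral_prod_right (ν := σ)).measurable
    · filter_upwards [h.ae_norm] with x hx
      refine (abs_integral_le_integral_abs).trans ?_
      apply integral_mono_ae (it r gr.int x hx).abs gr.int.abs
      filter_upwards [h.abs_inner_le_one hx] with y hy
      rw [abs_mul, ← inner_eq_sv]
      nlinarith [abs_nonneg (r y)]
  have kbr : Bd σ (TT σ gk r) := gr.TT_bd h
  have kbu : Bd σ (TT σ gk u) := gu.TT_bd h
  have kbw : Bd σ (TT σ gk w) := gw.TT_bd h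
  have mulint : ∀ {v p : E3 → ℝ}, Integrable v σ → Bd σ p → Integrable (fun x => v x * p x) σ := by
    intro v p hv hp
    have := hp.mul_integrable hv
    simpa only [mul_comm] using this
  -- spectral term
  have S := h.spectral bu
  have S2 : ∫ x, u x * TT σ (fun s => 5/6 + (1 - 2 * s)) u x ∂σ = 5/6 * (RH σ f H) ^ 2 + ∫ x, r x * TT σ (fun s => 1 - 2 * s) r x ∂σ := by
    have e1 : ∫ x, u x * TT σ (fun s => 5/6 + (1 - 2 * s)) u x ∂σ = ∫ x, (u x * (5/6 * (- RH σ f H)) - u x * TT σ (fun s => 1 - 2 * s) r x) ∂σ := by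
      apply integral_congr_ae
      filter_upwards [h.ae_norm] with x hx
      have : TT σ (fun s => 5/6 + (1 - 2 * s)) u x = 5/6 * (- RH σ f H) + TT σ (fun s => 1 - 2 * s) u x := by
        rw [← mean_u]
        simp only [TT]
        rw [← integral_const_mul, ← integral_add (gu.int.const_mul _) (it u gu.int x hx)]
        congr 1; ext y; ring
      rw [this, tu x hx]; ring
    rw [e1, integral_sub (gu.int.mul_const _) (mulint gu.int btr), integral_mul_const, mean_u]
    have e2 : ∫ x, u x * TT σ (fun s => 1 - 2 * s) r x ∂σ = ∫ x, r x * TT σ (fun s => 1 - 2 * s) u x ∂σ := by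
      have hp : Integrable (fun p : E3 × E3 => u p.1 * ((1 - 2 * sv p.1 p.2) * r p.2)) (σ.prod σ) := by
        have h1 : Integrable (fun p : E3 × E3 => u p.1 * r p.2) (σ.prod σ) := gu.int.mul_prod gr.int
        have h2 : Integrable (fun p : E3 × E3 => (1 - 2 * sv p.1 p.2) * (u p.1 * r p.2)) (σ.prod σ) := by
          refine h1.bdd_mul (c := 1) (kt.meas.comp meas_sv2).aestronglyMeasurable ?_
          have a1 : ∀ᵐ p ∂(σ.prod σ), ‖p.1‖ = 1 := Measure.quasiMeasurePreserving_fst.ae h.ae_norm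
          have a2 : ∀ᵐ p ∂(σ.prod σ), ‖p.2‖ = 1 := Measure.quasiMeasurePreserving_snd.ae h.ae_norm
          filter_upwards [a1, a2] with p h1 h2
          rw [← inner_eq_sv]
          have := abs_real_inner_le_norm p.1 p.2
          rw [h1, h2] at this
          simpa using this
        refine h2.congr (Filter.Eventually.of_forall fun p => ?_)
        simp only; ring
      simp only [TT, ← integral_const_mul]
      rw [integral_integral_swap hp]
      congr 1; ext y
      congr 1; ext x
      rw [sv_comm x y]; ring
    have e3 : ∫ x, r x * TT σ (fun s => 1 - 2 * s) u x ∂σ = - ∫ x, r x * TT σ (fun s => 1 - 2 * s) r x ∂σ := by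
      rw [← integral_neg]
      apply integral_congr_ae
      filter_upwards [h.ae_norm] with x hx
      rw [tu x hx]; ring
    rw [e2, e3]; ring
  -- decomposition
  have D : ∫ x, f x * TT σ gk f x ∂σ = ∫ x, u x * TT σ gk u x ∂σ + ∫ x, r x * TT σ gk w x ∂σ := by
    have tf : ∀ x, ‖x‖ = 1 → TT σ gk f x = TT σ gk u x + TT σ gk r x := by
      intro x hx
      obtain ⟨_, hC⟩ := gu.pot
      obtain ⟨_, hC'⟩ := gr.pot
      simp only [TT]
      rw [← integral_add (hC x hx).1 (hC' x hx).1]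
      congr 1; ext y; simp only [hu, hr]; ring
    have tw : ∀ x, ‖x‖ = 1 → TT σ gk w x = TT σ gk u x + (TT σ gk u x + TT σ gk r x) := by
      intro x hx
      obtain ⟨_, hC⟩ := gu.pot
      obtain ⟨_, hC'⟩ := gf.pot
      rw [← tf x hx]
      simp only [TT]
      rw [← integral_add (hC x hx).1 (hC' x hx).1]
      congr 1; ext y; simp only [hw, hu]; ring
    have sy := gr.symm h gu.int mu
    have i1 := mulint gu.int kbu
    have i2 := mulint gu.int kbr
    have i3 := mulint gr.int kbu
    have i4 := mulint gr.int kbr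
    have e1 : ∫ x, f x * TT σ gk f x ∂σ = ∫ x, ((u x * TT σ gk u x + u x * TT σ gk r x) + (r x * TT σ gk u x + r x * TT σ gk r x)) ∂σ := by
      apply integral_congr_ae
      filter_upwards [h.ae_norm] with x hx
      rw [tf x hx]
      have : f x = u x + r x := by simp only [hu, hr]; ring
      rw [this]; ring
    have e2 : ∫ x, r x * TT σ gk w x ∂σ = ∫ x, (r x * TT σ gk u x + (r x * TT σ gk u x + r x * TT σ gk r x)) ∂σ := by
      apply integral_congr_ae
      filter_upwards [h.ae_norm] with x hx
      rw [tw x hx]; ring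
    have e3 : ∫ x, (r x * TT σ gk u x + (r x * TT σ gk u x + r x * TT σ gk r x)) ∂σ = ∫ x, r x * TT σ gk u x ∂σ + ∫ x, (r x * TT σ gk u x + r x * TT σ gk r x) ∂σ := integral_add i3 (i3.add i4)
    have e4 : ∫ x, ((u x * TT σ gk u x + u x * TT σ gk r x) + (r x * TT σ gk u x + r x * TT σ gk r x)) ∂σ = ∫ x, (u x * TT σ gk u x + u x * TT σ gk r x) ∂σ + ∫ x, (r x * TT σ gk u x + r x * TT σ gk r x) ∂σ := integral_add (i1.add i2) (i3.add i4)
    have e5 : ∫ x, (u x * TT σ gk u x + u x * TT σ gk r x) ∂σ = ∫ x, u x * TT σ gk u x ∂σ + ∫ x, u x * TT σ gk r x ∂σ := integral_add i1 i2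
    rw [e1, e2, e3, e4, e5, sy]
    ring
  have fin : ∫ x, r x * (TT σ gk w x + TT σ (fun s => 1 - 2 * s) r x) ∂σ = ∫ x, r x * TT σ gk w x ∂σ + ∫ x, r x * TT σ (fun s => 1 - 2 * s) r x ∂σ := by
    rw [← integral_add (mulint gr.int kbw) (mulint gr.int btr)]
    congr 1; ext x; ring
  rw [D, fin]
  linarith

theorem coupling (h : Sph σ) {f : E3 → ℝ} (hf : Hyp σ f) {H α β γ c : ℝ} (hH : 1 ≤ H) (hR : 0 < RH σ f H)
    (hN : NodeOK H (RH σ f H) α β γ c) :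
    ∫ x, f x * TT σ gk f x ∂σ ≤ ∫ x, phi (f x) ∂σ + (c - γ * RH σ f H - (RH σ f H) ^ 2 / 6) := by
  have := h.prob
  have key := coupling0 h hf hH
  set R := RH σ f H with hRdef
  set u : E3 → ℝ := fun x => min (f x) H with hu
  set r : E3 → ℝ := fun x => f x - min (f x) H with hr
  set w : E3 → ℝ := fun x => f x + min (f x) H with hw
  have mu : Measurable u := hf.meas.min measurable_const
  have mr : Measurable r := hf.meas.sub mu
  have mw : Measurable w := hf.meas.add mu
  have ub : ∀ x, -1 ≤ u x ∧ u x ≤ H ∧ u x ≤ f x := fun x => ⟨le_min (hf.lb x) (by linarith), min_le_right _ _, min_le_left _ _⟩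
  have rb : ∀ x, 0 ≤ r x ∧ r x ≤ f x + 2 := fun x => ⟨by simp only [hr]; linarith [(ub x).2.2], by have := (ub x).1; simp only [hr]; simp only [hu] at this; linarith⟩
  have gr : Good σ r := hf.good h mr 1 fun x => by rw [abs_le]; constructor <;> linarith [(rb x).1, (rb x).2, hf.lb x]
  have gw : Good σ w := hf.good h mw 2 fun x => by
    have := ub x
    simp only [hw]; simp only [hu] at this
    rw [abs_le]; constructor <;> linarith [hf.lb x]
  have iu : Integrable u σ := by
    refine (gw.int.sub hf.int).congr (Filter.Eventually.of_forall fun x => ?_)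
    simp only [hw, hu, Pi.sub_apply]; ring
  have iu2 : Integrable (fun x => u x ^ 2) σ := by
    apply h.integrable_bdd (mu.pow_const 2) (H ^ 2)
    refine Filter.Eventually.of_forall fun x => ?_
    rw [abs_pow]
    have : |u x| ≤ H := abs_le.mpr ⟨by linarith [(ub x).1], (ub x).2.1⟩
    gcongr
  have it : ∀ v : E3 → ℝ, Integrable v σ → ∀ x, ‖x‖ = 1 → Integrable (fun y => (1 - 2 * sv x y) * v y) σ := by
    intro v hv x hx
    refine hv.bdd_mul (c := 1) (by have := meas_sv x; fun_prop) ?_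
    filter_upwards [h.abs_inner_le_one hx] with y hy
    rw [← inner_eq_sv]; exact hy
  have mean_r : ∫ x, r x ∂σ = R := rfl
  have mean_w : ∫ x, w x ∂σ = -R := by
    have : ∫ x, w x ∂σ + ∫ x, r x ∂σ = ∫ x, (f x + f x) ∂σ := by
      rw [← integral_add gw.int gr.int]
      congr 1; ext y; simp only [hw, hr]; ring
    rw [integral_add hf.int hf.int, hf.mean, mean_r] at this
    linarith
  obtain ⟨M, kM, bM, iM⟩ := hN
  set V : E3 → ℝ := fun x => TT σ gk w x + TT σ (fun s => 1 - 2 * s) r x with hV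
  set Φ := ∫ x, phi (f x) ∂σ with hΦ
  set U := ∫ x, u x ^ 2 ∂σ with hU
  have pt : ∀ x, ‖x‖ = 1 → R * (V x + R) + γ * R - Φ + U / 6 ≤ c := by
    intro x hx
    obtain ⟨_, hC⟩ := gw.pot
    have a1 := (hC x hx).1
    have a2 := it r gr.int x hx
    have a3 := it f hf.int x hx
    have t0 : ∫ y, (1 - 2 * sv x y) * f y ∂σ = 0 := by
      have := hf.bary x
      simpa only [inner_eq_sv] using this
    have i1 : Integrable (fun y => R * ((gk (sv x y) * w y + (1 - 2 * sv x y) * r y) - w y)) σ := ((a1.add a2).sub gw.int).const_mul R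
    have i2 : Integrable (fun y => α * f y - β / 2 * ((1 - 2 * sv x y) * f y)) σ := (hf.int.const_mul α).sub (a3.const_mul _)
    have i3 : Integrable (fun y => γ * r y - phi (f y) + (1/6) * u y ^ 2) σ := ((gr.int.const_mul γ).sub hf.ph).add (iu2.const_mul (1/6))
    have le : ∫ y, (R * ((gk (sv x y) * w y + (1 - 2 * sv x y) * r y) - w y) + (α * f y - β / 2 * ((1 - 2 * sv x y) * f y)) + (γ * r y - phi (f y) + (1/6) * u y ^ 2)) ∂σ ≤ ∫ y, M (sv x y) ∂σ := by
      apply integral_mono_ae ((i1.add i2).add i3) (h.integrable_sv kM hx)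
      filter_upwards [sv_pos_ae h hx] with y hy
      have := bM (f y) (sv x y) (hf.lb y) hy.1 hy.2
      refine le_trans (le_of_eq ?_) this
      simp only [Pi.add_apply]
      unfold Ff
      simp only [hw, hr, hu]
      ring
    rw [h.integral_sv kM.meas hx] at le
    have e1 : ∫ y, R * ((gk (sv x y) * w y + (1 - 2 * sv x y) * r y) - w y) ∂σ = R * (V x + R) := by
      rw [integral_const_mul, integral_sub (by exact a1.add a2) gw.int, integral_add a1 a2, mean_w]
      simp only [hV, TT]; ring
    have e2 : ∫ y, (α * f y - β / 2 * ((1 - 2 * sv x y) * f y)) ∂σ = 0 := by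
      rw [integral_sub (hf.int.const_mul α) (a3.const_mul _), integral_const_mul, integral_const_mul, t0, hf.mean]; ring
    have e3 : ∫ y, (γ * r y - phi (f y) + (1/6) * u y ^ 2) ∂σ = γ * R - Φ + U / 6 := by
      rw [integral_add (by exact (gr.int.const_mul γ).sub hf.ph) (iu2.const_mul (1/6)), integral_sub (gr.int.const_mul γ) hf.ph, integral_const_mul, integral_const_mul, mean_r]; ring
    rw [integral_add (by exact i1.add i2) i3, integral_add i1 i2, e1, e2, e3] at le
    linarith
  have last : ∫ x, r x * V x ∂σ ≤ c - γ * R + Φ - U / 6 - R ^ 2 := by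
    have : ∫ x, r x * V x ∂σ ≤ ∫ x, r x * ((c - γ * R + Φ - U / 6) / R - R) ∂σ := by
      by_cases hi : Integrable (fun x => r x * V x) σ
      · apply integral_mono_ae hi (gr.int.mul_const _)
        filter_upwards [h.ae_norm] with x hx
        apply mul_le_mul_of_nonneg_left _ (rb x).1
        rw [le_sub_iff_add_le, le_div_iff₀ hR]
        linarith [pt x hx]
      · exfalso
        apply hi
        have bV : Bd σ V := by
          refine ⟨?_, ?_⟩
          · have hm : Measurable (fun p : E3 × E3 => (1 - 2 * sv p.1 p.2) * r p.2) :=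
              ((Ker.of_cont (F := fun s : ℝ => 1 - 2 * s) (by fun_prop)).meas.comp meas_sv2).mul (mr.comp measurable_snd)
            exact (gw.TT_bd h).meas.add (hm.stronglyMeasurable.integral_prod_right (ν := σ)).measurable
          · obtain ⟨C, hC⟩ := (gw.TT_bd h).bd
            refine ⟨C + ∫ y, |r y| ∂σ, ?_⟩
            filter_upwards [h.ae_norm, hC] with x hx hCx
            refine (abs_add_le _ _).trans (add_le_add hCx ?_)
            refine (abs_integral_le_integral_abs).trans ?_
            apply integral_mono_ae (it r gr.int x hx).abs gr.int.abs
            filter_upwards [h.abs_inner_le_one hx] with y hy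
            rw [abs_mul, ← inner_eq_sv]
            nlinarith [abs_nonneg (r y)]
        have := bV.mul_integrable gr.int
        simpa only [mul_comm] using this
    rw [integral_mul_const, mean_r] at this
    have e : R * ((c - γ * R + Φ - U / 6) / R - R) = c - γ * R + Φ - U / 6 - R ^ 2 := by
      field_simp
    linarith
  linarith

end Sph

open MeasureTheory
open scoped ENNReal Classical

namespace Sph


theorem log_ser (y : ℝ) (h0 : 0 ≤ y) (h1 : y < 1) :
    2 * (y + y ^ 3 / 3 + y ^ 5 / 5 + y ^ 7 / 7) ≤ Real.log (1 + y) - Real.log (1 - y) := by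
  have hs := Real.hasSum_log_sub_log_of_abs_lt_one (x := y) (by rw [abs_of_nonneg h0]; exact h1)
  have := sum_le_hasSum (Finset.range 4) (fun i _ => by positivity) hs
  refine le_trans (le_of_eq ?_) this
  simp [Finset.sum_range_succ]
  ring

theorem loglb (x L y : ℝ) (k : ℕ) (h0 : 0 ≤ y) (h1 : y < 1) (hx : x * (1 - y) = 2 ^ k * (1 + y))
    (hL : L ≤ k * 0.6931471803 + 2 * (y + y ^ 3 / 3 + y ^ 5 / 5 + y ^ 7 / 7)) : L ≤ Real.log x := by
  have hx' : x = 2 ^ k * ((1 + y) / (1 - y)) := by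
    have : (1 - y) ≠ 0 := by linarith
    field_simp; linarith
  have e : Real.log x = k * Real.log 2 + (Real.log (1 + y) - Real.log (1 - y)) := by
    rw [hx', Real.log_mul (by positivity) (by have : 0 < 1 - y := by linarith
                                              positivity), Real.log_pow, Real.log_div (by linarith) (by linarith)]
  have := log_ser y h0 h1
  have l2 := Real.log_two_gt_d9
  have : (k:ℝ) * 0.6931471803 ≤ k * Real.log 2 := mul_le_mul_of_nonneg_left l2.le (by positivity)
  linarith

theorem loglb' (x L y : ℝ) (k : ℕ) (h0 : 0 ≤ y) (h1 : y < 1) (hx : x * 2 ^ k * (1 - y) = 1 + y)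
    (hL : L ≤ 2 * (y + y ^ 3 / 3 + y ^ 5 / 5 + y ^ 7 / 7) - k * 0.6931471808) : L ≤ Real.log x := by
  have hx' : x = ((1 + y) / (1 - y)) / 2 ^ k := by
    have : (1 - y) ≠ 0 := by linarith
    field_simp; linarith
  have e : Real.log x = (Real.log (1 + y) - Real.log (1 - y)) - k * Real.log 2 := by
    have : 0 < 1 - y := by linarith
    rw [hx', Real.log_div (by positivity) (by positivity), Real.log_pow, Real.log_div (by linarith) (by linarith)]
  have := log_ser y h0 h1
  have l2 := Real.log_two_lt_d9
  have : (k:ℝ) * Real.log 2 ≤ k * 0.6931471808 := mul_le_mul_of_nonneg_left l2.le (by positivity)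
  linarith


theorem phi_tan (h X L : ℝ) (hh : -1 ≤ h) (hX : 0 < X) (hL : L ≤ Real.log X) :
    (2 + h) * L - 2 * (X - 1) ≤ phi h := by
  have h1 := young h (Real.log X) hh
  rw [Real.exp_log hX] at h1
  nlinarith [mul_le_mul_of_nonneg_left hL (by linarith : (0:ℝ) ≤ 2 + h)]

theorem phi_hasDeriv (h : ℝ) (hh : -2 < h) : HasDerivAt phi (Real.log (1 + h / 2)) h := by
  unfold phi
  have hX : 1 + h / 2 ≠ 0 := by linarith
  have h1 : HasDerivAt (fun h : ℝ => 1 + h / 2) (1 / 2) h := ((hasDerivAt_id h).div_const 2).const_add 1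
  have h2 := ((hasDerivAt_id h).const_add 2).mul (h1.log hX)
  have h3 := h2.sub (hasDerivAt_id h)
  refine h3.congr_deriv ?_
  have : 2 + h ≠ 0 := by linarith
  simp only [id]
  field_simp
  ring

noncomputable def psi (h : ℝ) : ℝ := phi h - h ^ 2 / 6

theorem psi_hasDeriv (h : ℝ) (hh : -2 < h) : HasDerivAt psi (Real.log (1 + h / 2) - h / 3) h := by
  unfold psi
  have := (phi_hasDeriv h hh).sub (((hasDerivAt_id h).pow 2).div_const 6)
  refine this.congr_deriv ?_
  simp only [id]; ring

theorem dpsi_hasDeriv (h : ℝ) (hh : -2 < h) : HasDerivAt (fun h => Real.log (1 + h / 2) - h / 3) (1 / (2 + h) - 1 / 3) h := by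
  have hX : 1 + h / 2 ≠ 0 := by linarith
  have h1 : HasDerivAt (fun h : ℝ => 1 + h / 2) (1 / 2) h := ((hasDerivAt_id h).div_const 2).const_add 1
  have := (h1.log hX).sub ((hasDerivAt_id h).div_const 3)
  refine this.congr_deriv ?_
  have : 2 + h ≠ 0 := by linarith
  field_simp

theorem psi_convex : ConvexOn ℝ (Set.Icc (-1) 1) psi := by
  apply convexOn_of_hasDerivWithinAt2_nonneg (convex_Icc _ _) (f' := fun h => Real.log (1 + h / 2) - h / 3) (f'' := fun h => 1 / (2 + h) - 1 / 3)
  · intro x hx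
    exact (psi_hasDeriv x (by linarith [hx.1])).continuousAt.continuousWithinAt
  · intro x hx
    rw [interior_Icc] at hx
    exact (psi_hasDeriv x (by linarith [hx.1])).hasDerivWithinAt
  · intro x hx
    rw [interior_Icc] at hx
    exact (dpsi_hasDeriv x (by linarith [hx.1])).hasDerivWithinAt
  · intro x hx
    rw [interior_Icc] at hx
    rw [sub_nonneg]
    apply one_div_le_one_div_of_le <;> linarith [hx.1, hx.2]

theorem psi_concave : ConcaveOn ℝ (Set.Ici 1) psi := by
  apply concaveOn_of_hasDerivWithinAt2_nonpos (convex_Ici _) (f' := fun h => Real.log (1 + h / 2) - h / 3) (f'' := fun h => 1 / (2 + h) - 1 / 3)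
  · intro x hx
    have : (1:ℝ) ≤ x := hx
    exact (psi_hasDeriv x (by linarith)).continuousAt.continuousWithinAt
  · intro x hx
    rw [interior_Ici] at hx
    have : (1:ℝ) < x := hx
    exact (psi_hasDeriv x (by linarith)).hasDerivWithinAt
  · intro x hx
    rw [interior_Ici] at hx
    have : (1:ℝ) < x := hx
    exact (dpsi_hasDeriv x (by linarith)).hasDerivWithinAt
  · intro x hx
    rw [interior_Ici] at hx
    have : (1:ℝ) < x := hx
    rw [sub_nonpos]
    apply one_div_le_one_div_of_le <;> linarith

/-- tangent lower bound for `psi` on `[-1,1]` -/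
theorem psi_tan (h h0 L : ℝ) (hh : -1 ≤ h) (hh1 : h ≤ 1) (h00 : -1 ≤ h0) (h01 : h0 ≤ 1) (hL : L ≤ Real.log (1 + h0 / 2)) :
    (L - h0 / 3) * h - (h0 - h0 ^ 2 / 6 - 2 * L) ≤ psi h := by
  have key : psi h0 + (Real.log (1 + h0 / 2) - h0 / 3) * (h - h0) ≤ psi h := by
    have hd := psi_hasDeriv h0 (by linarith)
    rcases lt_trichotomy h h0 with hlt | heq | hgt
    · have := psi_convex.slope_le_of_hasDerivAt (x := h) (y := h0) ⟨hh, hh1⟩ ⟨h00, h01⟩ hlt hd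
      rw [slope_def_field, div_le_iff₀ (by linarith)] at this
      linarith
    · rw [heq]; simp
    · have := psi_convex.le_slope_of_hasDerivAt (x := h0) (y := h) ⟨h00, h01⟩ ⟨hh, hh1⟩ hgt hd
      rw [slope_def_field, le_div_iff₀ (by linarith)] at this
      linarith
  have e : psi h0 = (2 + h0) * Real.log (1 + h0 / 2) - h0 - h0 ^ 2 / 6 := rfl
  rw [e] at key
  nlinarith [mul_le_mul_of_nonneg_left hL (by linarith : (0:ℝ) ≤ 2 + h)]

/-- line bound for the truncated branch -/
def BL (H t c : ℝ) : Prop := ∀ h, -1 ≤ h → h ≤ H → t * h - psi h ≤ c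

theorem BL.tan (H h0 L LH c : ℝ) (hH : 1 < H) (h00 : -1 ≤ h0) (h01 : h0 ≤ 1) (hL : L ≤ Real.log (1 + h0 / 2))
    (hLH : LH ≤ Real.log (1 + H / 2)) (c1 : h0 - h0 ^ 2 / 6 - 2 * L ≤ c)
    (c2 : H * (L - h0 / 3) - ((2 + H) * LH - H - H ^ 2 / 6) ≤ c) : BL H (L - h0 / 3) c := by
  intro h hh hh2
  have one : ∀ h, -1 ≤ h → h ≤ 1 → (L - h0 / 3) * h - psi h ≤ c := fun h a b => by
    have := psi_tan h h0 L a b h00 h01 hL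
    linarith
  rcases le_total h 1 with h1 | h1
  · exact one h hh h1
  · have a1 := one 1 (by norm_num) le_rfl
    have a2 : (L - h0 / 3) * H - psi H ≤ c := by
      have : psi H = (2 + H) * Real.log (1 + H / 2) - H - H ^ 2 / 6 := rfl
      rw [this]
      nlinarith [mul_le_mul_of_nonneg_left hLH (by linarith : (0:ℝ) ≤ 2 + H)]
    have cc := psi_concave.2 (Set.mem_Ici.mpr (le_refl (1:ℝ))) (Set.mem_Ici.mpr hH.le)
      (div_nonneg (by linarith) (by linarith) : 0 ≤ (H - h) / (H - 1)) (div_nonneg (by linarith) (by linarith) : 0 ≤ (h - 1) / (H - 1)) (by rw [← add_div, div_eq_one_iff_eq (by linarith)]; ring)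
    simp only [smul_eq_mul] at cc
    have hne : H - 1 ≠ 0 := by linarith
    have e : (H - h) / (H - 1) * 1 + (h - 1) / (H - 1) * H = h := by field_simp; ring
    rw [e] at cc
    have e2 : (H - h) / (H - 1) = 1 - (h - 1) / (H - 1) := by field_simp; ring
    set b := (h - 1) / (H - 1) with hb
    have hb0 : 0 ≤ b := div_nonneg (by linarith) (by linarith)
    have hb1 : b ≤ 1 := by rw [hb, div_le_one (by linarith)]; linarith
    have e3 : h = (1 - b) + b * H := by rw [← e2]; linarith
    rw [e2] at cc
    have e4 : (L - h0 / 3) * h = (1 - b) * ((L - h0 / 3) * 1) + b * ((L - h0 / 3) * H) := by linear_combination (L - h0 / 3) * e3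
    rw [e4]
    nlinarith [mul_le_mul_of_nonneg_left a1 (by linarith : 0 ≤ 1 - b), mul_le_mul_of_nonneg_left a2 hb0]

theorem BL.left {H t c : ℝ} (b : BL H t c) (t' c' : ℝ) (ht : t' ≤ t) (hc : c + (t - t') ≤ c') : BL H t' c' := by
  intro h h1 h2
  have := b h h1 h2
  nlinarith

theorem BL.right {H t c : ℝ} (b : BL H t c) (t' c' : ℝ) (ht : t ≤ t') (hc : c + H * (t' - t) ≤ c') : BL H t' c' := by
  intro h h1 h2
  have := b h h1 h2
  nlinarith

theorem BL.mid {H t1 c1 t2 c2 : ℝ} (b1 : BL H t1 c1) (b2 : BL H t2 c2) (t l c : ℝ) (l0 : 0 ≤ l) (l1 : l ≤ 1) (ht : t = (1 - l) * t1 + l * t2)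
    (hc : (1 - l) * c1 + l * c2 ≤ c) : BL H t c := by
  intro h h1 h2
  have a1 := mul_le_mul_of_nonneg_left (b1 h h1 h2) (by linarith : 0 ≤ 1 - l)
  have a2 := mul_le_mul_of_nonneg_left (b2 h h1 h2) l0
  rw [ht]
  nlinarith


def IB (F : ℝ → ℝ → ℝ) (a b c : ℝ) : Prop :=
  ∃ M : ℝ → ℝ, Measurable M ∧ IntervalIntegrable M volume a b ∧ (∀ h s, -1 ≤ h → a < s → s ≤ b → F h s ≤ M s) ∧ ∫ s in a..b, M s ≤ c

theorem IB.append {F : ℝ → ℝ → ℝ} {a b d c c' : ℝ} (hab : a ≤ b) (hbd : b ≤ d) (h1 : IB F a b c) (h2 : IB F b d c') : IB F a d (c + c') := by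
  obtain ⟨M, m, i, p, e⟩ := h1
  obtain ⟨M', m', i', p', e'⟩ := h2
  have ea : Set.EqOn M (fun s => if s ≤ b then M s else M' s) (Set.uIoc a b) := by
    intro s hs
    rw [Set.uIoc_of_le hab] at hs
    simp [hs.2]
  have eb : Set.EqOn M' (fun s => if s ≤ b then M s else M' s) (Set.uIoc b d) := by
    intro s hs
    rw [Set.uIoc_of_le hbd] at hs
    simp [not_le.mpr hs.1]
  have ia := i.congr ea
  have ib := i'.congr eb
  refine ⟨fun s => if s ≤ b then M s else M' s, Measurable.ite measurableSet_Iic m m', ia.trans ib, ?_, ?_⟩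
  · intro h s hh hs1 hs2
    by_cases hsb : s ≤ b
    · simp only [hsb, if_true]; exact p h s hh hs1 hsb
    · simp only [hsb, if_false]; exact p' h s hh (not_le.mp hsb) hs2
  · rw [← intervalIntegral.integral_add_adjacent_intervals ia ib]
    have e1 := intervalIntegral.integral_congr_ae (μ := volume) (f := M) (g := fun s => if s ≤ b then M s else M' s) (a := a) (b := b) (Filter.Eventually.of_forall fun s hs => ea hs)
    have e2 := intervalIntegral.integral_congr_ae (μ := volume) (f := M') (g := fun s => if s ≤ b then M s else M' s) (a := b) (b := d) (Filter.Eventually.of_forall fun s hs => eb hs)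
    rw [← e1, ← e2]
    exact add_le_add e e'

def Pt (F : ℝ → ℝ → ℝ) (s m : ℝ) : Prop := ∀ h, -1 ≤ h → F h s ≤ m

theorem IB.trap {F : ℝ → ℝ → ℝ} (hF : ∀ h, -1 ≤ h → ConvexOn ℝ (Set.Ioi 0) (F h)) {a b m m' : ℝ} (ha : 0 < a) (hab : a < b)
    (h1 : Pt F a m) (h2 : Pt F b m') : IB F a b ((b - a) * (m + m') / 2) := by
  refine ⟨fun s => m + (m' - m) / (b - a) * (s - a), by fun_prop, (by fun_prop : Continuous _).intervalIntegrable _ _, ?_, ?_⟩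
  · intro h s hh hs1 hs2
    have hne : b - a ≠ 0 := by linarith
    set l := (s - a) / (b - a) with hl
    have l0 : 0 ≤ l := div_nonneg (by linarith) (by linarith)
    have l1 : l ≤ 1 := by rw [hl, div_le_one (by linarith)]; linarith
    have cc := (hF h hh).2 (Set.mem_Ioi.mpr ha) (Set.mem_Ioi.mpr (ha.trans hab)) (by linarith : 0 ≤ 1 - l) l0 (by ring)
    simp only [smul_eq_mul] at cc
    have e : (1 - l) * a + l * b = s := by rw [hl]; field_simp; ring
    rw [e] at cc
    have e2 : (m' - m) / (b - a) * (s - a) = l * (m' - m) := by rw [hl]; field_simp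
    show F h s ≤ m + (m' - m) / (b - a) * (s - a)
    rw [e2]
    nlinarith [mul_le_mul_of_nonneg_left (h1 h hh) (by linarith : 0 ≤ 1 - l), mul_le_mul_of_nonneg_left (h2 h hh) l0]
  · have hne : b - a ≠ 0 := by linarith
    rw [intervalIntegral.integral_add (by simp) ((by fun_prop : Continuous _).intervalIntegrable _ _), intervalIntegral.integral_const_mul, intervalIntegral.integral_sub (by simp) (by simp)]
    simp only [intervalIntegral.integral_const, integral_id, smul_eq_mul]
    apply le_of_eq
    field_simp
    ring

/-- chain state -/
def St (F : ℝ → ℝ → ℝ) (a m c : ℝ) : Prop := IB F 0 a c ∧ Pt F a m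

theorem St.step {F : ℝ → ℝ → ℝ} {a m c : ℝ} (h : St F a m c) (hF : ∀ h, -1 ≤ h → ConvexOn ℝ (Set.Ioi 0) (F h)) (b m' c' : ℝ) (ha : 0 < a) (hab : a < b)
    (h2 : Pt F b m') (hc : c + (b - a) * (m + m') / 2 ≤ c') : St F b m' c' := by
  refine ⟨?_, h2⟩
  obtain ⟨M, q1, q2, q3, q4⟩ := IB.append ha.le hab.le h.1 (IB.trap hF ha hab h.2 h2)
  exact ⟨M, q1, q2, q3, q4.trans hc⟩

theorem gk_convex : ConvexOn ℝ (Set.Ioi 0) gk := by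
  have := strictConcaveOn_log_Ioi.concaveOn.neg
  exact this

theorem lin_convex (A B C : ℝ) (hA : 0 ≤ A) : ConvexOn ℝ (Set.Ioi 0) (fun s => A * gk s + B + C * s) := by
  have h1 : ConvexOn ℝ (Set.Ioi (0:ℝ)) (fun s => A * gk s) := by simpa [Pi.smul_def] using gk_convex.smul hA
  have h2 : ConvexOn ℝ (Set.Ioi (0:ℝ)) (fun s : ℝ => B + C * s) := by
    refine ⟨convex_Ioi _, fun x _ y _ a b _ _ hab => le_of_eq ?_⟩
    simp only [smul_eq_mul]
    have : a = 1 - b := by linarith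
    subst this; ring
  have := h1.add h2
  refine this.congr fun s _ => ?_
  simp only [Pi.add_apply]; ring

end Sph

open MeasureTheory
open scoped ENNReal Classical

namespace Sph

noncomputable def Ft (H R α β γ h s : ℝ) : ℝ := Ff H R α β γ h s + 2 * R * gk s

theorem Ft_convex (H R α β γ : ℝ) (hH : 1 ≤ H) (hR : 0 ≤ R) (h : ℝ) (hh : -1 ≤ h) : ConvexOn ℝ (Set.Ioi 0) (Ft H R α β γ h) := by
  have hm : -1 ≤ min h H := le_min hh (by linarith)
  refine (lin_convex (R * (h + min h H + 2)) (-R * (h + min h H) + R * (h - min h H) + (α - β / 2) * h + γ * (h - min h H) - phi h + (min h H) ^ 2 / 6)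
    (-2 * R * (h - min h H) + β * h) (mul_nonneg hR (by linarith))).congr fun s _ => ?_
  simp only [Ft, Ff]; ring

theorem pt_node (H R α β γ s G : ℝ) (t1 c X L m : ℝ) (hH : 1 ≤ H) (hR : 0 ≤ R) (hG : -G ≤ Real.log s)
    (b : BL H t1 c) (ht1 : t1 = 2 * R * (G - 1) + α + β * (s - 1 / 2)) (hX : 0 < X) (hL : L ≤ Real.log X)
    (ht2 : R * (G - 1) + R * (1 - 2 * s) + α + β * (s - 1 / 2) + γ ≤ L)
    (m1 : c + 2 * R * G ≤ m) (m2 : H * t1 - (2 + H) * L + 2 * (X - 1) + H ^ 2 / 6 + 2 * R * G ≤ m) : Pt (Ft H R α β γ) s m := by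
  intro h hh
  have hg : gk s ≤ G := by unfold gk; linarith
  rcases le_total h H with hle | hle
  · have := b h hh hle
    unfold psi at this
    unfold Ft Ff
    rw [min_eq_left hle]
    have p1 : 0 ≤ R * (h + h + 2) := mul_nonneg hR (by linarith)
    have p2 := mul_le_mul_of_nonneg_left hg p1
    rw [ht1] at this
    nlinarith
  · have tn := phi_tan h X L hh hX hL
    unfold Ft Ff
    rw [min_eq_right hle]
    have p1 : 0 ≤ R * (h + H + 2) := mul_nonneg hR (by linarith)
    have p2 := mul_le_mul_of_nonneg_left hg p1
    have p3 := mul_le_mul_of_nonneg_left ht2 (by linarith : 0 ≤ h - H)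
    rw [ht1] at m2
    nlinarith

theorem exp_le_of (a b : ℝ) (hb : 0 < b) (h : a ≤ Real.log b) : Real.exp a ≤ b := by
  rw [← Real.exp_log hb]; exact Real.exp_le_exp.mpr h

theorem chord_exp (c s s0 E0 : ℝ) (hs : 0 ≤ s) (hs0 : 0 < s0) (hle : s ≤ s0) (hE : Real.exp (c * s0) ≤ E0) :
    Real.exp (c * s) ≤ 1 + (E0 - 1) / s0 * s := by
  have l0 : 0 ≤ s / s0 := by positivity
  have l1 : s / s0 ≤ 1 := (div_le_one hs0).mpr hle
  have cc := convexOn_exp.2 (Set.mem_univ 0) (Set.mem_univ (c * s0)) (by linarith : 0 ≤ 1 - s / s0) l0 (by ring)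
  simp only [smul_eq_mul, mul_zero, Real.exp_zero, zero_add] at cc
  have e : s / s0 * (c * s0) = c * s := by field_simp
  rw [e] at cc
  have := mul_le_mul_of_nonneg_left hE l0
  have e2 : (E0 - 1) / s0 * s = s / s0 * (E0 - 1) := by field_simp
  rw [e2]; nlinarith

theorem rpow_le_of (s p P G : ℝ) (hs : 0 < s) (hp : 0 ≤ p) (hP : 0 < P) (hG : Real.log s ≤ -G) (h : -(p * G) ≤ Real.log P) : s ^ p ≤ P := by
  rw [Real.rpow_def_of_pos hs]
  apply exp_le_of _ _ hP
  nlinarith [mul_le_mul_of_nonneg_left hG hp]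

theorem int_rpow (p s0 : ℝ) (hp : -1 < p) : ∫ s in (0:ℝ)..s0, s ^ p = s0 ^ (p + 1) / (p + 1) := by
  rw [integral_rpow (Or.inl hp), Real.zero_rpow (by linarith), sub_zero]

theorem int_gk (s0 : ℝ) : ∫ s in (0:ℝ)..s0, gk s = s0 - s0 * Real.log s0 := by
  unfold gk
  rw [intervalIntegral.integral_neg, integral_log]; simp

theorem gk_ii (a b : ℝ) : IntervalIntegrable gk volume a b := by
  unfold gk; exact intervalIntegral.intervalIntegrable_log'.neg

/-- generic tail integral -/
theorem tail_int (p q A B C D E s0 G P : ℝ) (hp : p = 1 + q) (hq : -1 < q) (hs0 : 0 < s0) (hA : 0 ≤ A) (hB : 0 ≤ B) 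
    (hG : C * -Real.log s0 ≤ C * G) (hP : s0 ^ p ≤ P) :
    IntervalIntegrable (fun s : ℝ => A * s ^ q + B * s ^ p + C * gk s + (D + E * s)) volume 0 s0 ∧
    ∫ s in (0:ℝ)..s0, (A * s ^ q + B * s ^ p + C * gk s + (D + E * s)) ≤
      A * (P / (1 + q)) + B * (s0 * P / (2 + q)) + C * (s0 + s0 * G) + (D * s0 + E * (s0 ^ 2 / 2)) := by
  have i1 : IntervalIntegrable (fun s : ℝ => A * s ^ q) volume 0 s0 := (intervalIntegral.intervalIntegrable_rpow' hq).const_mul A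
  have i2 : IntervalIntegrable (fun s : ℝ => B * s ^ p) volume 0 s0 := (intervalIntegral.intervalIntegrable_rpow' (by linarith)).const_mul B
  have i3 : IntervalIntegrable (fun s : ℝ => C * gk s) volume 0 s0 := (gk_ii _ _).const_mul C
  have i4 : IntervalIntegrable (fun s : ℝ => D + E * s) volume 0 s0 := (by fun_prop : Continuous _).intervalIntegrable _ _
  refine ⟨((i1.add i2).add i3).add i4, ?_⟩
  rw [intervalIntegral.integral_add ((i1.add i2).add i3) i4, intervalIntegral.integral_add (i1.add i2) i3, intervalIntegral.integral_add i1 i2,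
    intervalIntegral.integral_const_mul, intervalIntegral.integral_const_mul, intervalIntegral.integral_const_mul, int_rpow q s0 hq, int_rpow p s0 (by linarith), int_gk]
  have e4 : ∫ s in (0:ℝ)..s0, (D + E * s) = D * s0 + E * (s0 ^ 2 / 2) := by
    rw [intervalIntegral.integral_add (by simp) ((by fun_prop : Continuous _).intervalIntegrable _ _), intervalIntegral.integral_const_mul]
    simp; ring
  rw [e4]
  have e1 : s0 ^ (q + 1) / (q + 1) ≤ P / (1 + q) := by
    rw [add_comm q 1, ← hp]
    have : 0 < p := by linarith
    gcongr
  have e2 : s0 ^ (p + 1) / (p + 1) ≤ s0 * P / (2 + q) := by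
    have ee : p + 1 = 2 + q := by linarith
    rw [Real.rpow_add_one hs0.ne', ee, mul_comm]
    have : 0 < 2 + q := by linarith
    gcongr
  have e3 := mul_le_mul_of_nonneg_left hG hs0.le
  have := mul_le_mul_of_nonneg_left e1 hA
  have := mul_le_mul_of_nonneg_left e2 hB
  linarith

set_option maxHeartbeats 1000000 in
theorem tail_node (H R α β γ T cT LU s0 G Gl K E0 P c : ℝ) (hH : 1 ≤ H) (hR : 0 < R) (hR1 : R < 1)
    (bT : BL H T cT) (hLU : Real.log (1 + H / 2) ≤ LU) (hs0 : 0 < s0) (hG : -G ≤ Real.log s0) (hGl : Real.log s0 ≤ -Gl)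
    (hT : T ≤ 2 * R * (Gl - 1) + α + β * (s0 - 1 / 2)) (hsl : β * s0 ≤ 2 * R)
    (hK0 : 0 < K) (hK : α - β / 2 + γ ≤ Real.log K) (hE0 : 0 < E0) (hE1 : 1 ≤ E0) (hE : (β - 2 * R) * s0 ≤ Real.log E0) (hP0 : 0 < P)
    (hP : -((1 - R) * Gl) ≤ Real.log P)
    (hc : 2 * K * (P / (1 - R)) + 2 * K * ((E0 - 1) / s0) * (s0 * P / (2 - R)) + H * R * (s0 + s0 * G)
      + ((-2 - 2 * (α - β / 2 + γ) - 2 * H * R - H * γ + H ^ 2 / 6 + (cT - H * T + (2 + H) * LU - H - H ^ 2 / 6)) * s0 + (-2 * (β - 2 * R) + 2 * H * R) * (s0 ^ 2 / 2)) ≤ c)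
    (hd : 0 ≤ cT - H * T + (2 + H) * LU - H - H ^ 2 / 6) : IB (Ft H R α β γ) 0 s0 c := by
  have hPP := rpow_le_of s0 (1 - R) P Gl hs0 (by linarith) hP0 hGl hP
  have hEE := exp_le_of _ _ hE0 hE
  have hKK := exp_le_of _ _ hK0 hK
  set δ := cT - H * T + (2 + H) * LU - H - H ^ 2 / 6 with hδ
  set κ := (E0 - 1) / s0 with hκ
  have κ0 : 0 ≤ κ := div_nonneg (by linarith) hs0.le
  obtain ⟨ii, il⟩ := tail_int (1 - R) (-R) (2 * K) (2 * K * κ) (H * R) (-2 - 2 * (α - β / 2 + γ) - 2 * H * R - H * γ + H ^ 2 / 6 + δ) (-2 * (β - 2 * R) + 2 * H * R) s0 G P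
    (by ring) (by linarith) hs0 (by positivity) (by positivity) (mul_le_mul_of_nonneg_left (by linarith) (by positivity)) hPP
  refine ⟨_, ?_, ii, ?_, il.trans (le_trans (le_of_eq ?_) hc)⟩
  · have := ker_gk.meas
    fun_prop
  · intro h s hh hs1 hs2
    have hexp : Real.exp (R * gk s + (β - 2 * R) * s + (α - β / 2 + γ)) ≤ K * s ^ (-R) + K * κ * s ^ (1 - R) := by
      rw [Real.exp_add, Real.exp_add]
      have e1 : Real.exp (R * gk s) = s ^ (-R) := by
        rw [Real.rpow_def_of_pos hs1]; unfold gk; congr 1; ring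
      have e2 := chord_exp (β - 2 * R) s s0 E0 hs1.le hs0 hs2 hEE
      have e3 : s ^ (1 - R) = s * s ^ (-R) := by
        rw [sub_eq_add_neg, Real.rpow_add hs1, Real.rpow_one]
      rw [e1, e3]
      have p0 : 0 ≤ s ^ (-R) := by positivity
      calc s ^ (-R) * Real.exp ((β - 2 * R) * s) * Real.exp (α - β / 2 + γ)
          ≤ s ^ (-R) * (1 + κ * s) * K := by
            apply mul_le_mul (mul_le_mul_of_nonneg_left e2 p0) hKK (Real.exp_pos _).le
            have := hs1.le
            positivity
        _ = _ := by ring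
    set t2 := R * gk s + (β - 2 * R) * s + (α - β / 2 + γ) with ht2
    have gT : gk s ≥ Gl + (1 - s / s0) := by
      have := Real.log_le_sub_one_of_pos (div_pos hs1 hs0)
      rw [Real.log_div hs1.ne' hs0.ne'] at this
      unfold gk; linarith
    have t1T : T ≤ 2 * R * (gk s - 1) + α + β * (s - 1 / 2) := by
      have e : β * s0 * (1 - s / s0) = β * s0 - β * s := by field_simp
      have l1 : 0 ≤ 1 - s / s0 := by rw [sub_nonneg, div_le_one hs0]; exact hs2
      have := mul_le_mul_of_nonneg_right hsl l1
      nlinarith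
    set t1 := 2 * R * (gk s - 1) + α + β * (s - 1 / 2) with ht1
    have yH := young H t2 (by linarith)
    have pH : phi H ≤ (2 + H) * LU - H := by
      unfold phi
      have := mul_le_mul_of_nonneg_left hLU (by linarith : 0 ≤ 2 + H)
      linarith
    have fin : Ff H R α β γ h s ≤ 2 * (Real.exp t2 - 1 - t2) + H * (t1 - t2) + H ^ 2 / 6 + δ := by
      rcases le_total h H with hle | hle
      · have b2 := BL.right bT t1 _ t1T le_rfl h hh hle
        have e : Ff H R α β γ h s = t1 * h - psi h := by
          unfold Ff psi; rw [min_eq_left hle, ht1]; ring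
        rw [e]
        linarith
      · have yh := young h t2 hh
        have e : Ff H R α β γ h s = t1 * H + t2 * (h - H) - phi h + H ^ 2 / 6 := by
          unfold Ff; rw [min_eq_right hle, ht1, ht2]; ring
        rw [e]
        linarith
    have e : 2 * K * s ^ (-R) + 2 * K * κ * s ^ (1 - R) + H * R * gk s + (-2 - 2 * (α - β / 2 + γ) - 2 * H * R - H * γ + H ^ 2 / 6 + δ + (-2 * (β - 2 * R) + 2 * H * R) * s)
        = 2 * (K * s ^ (-R) + K * κ * s ^ (1 - R)) - 2 - 2 * t2 + H * (t1 - t2) + H ^ 2 / 6 + δ + 2 * R * gk s := by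
      rw [ht1, ht2]; ring
    show Ft H R α β γ h s ≤ 2 * K * s ^ (-R) + 2 * K * κ * s ^ (1 - R) + H * R * gk s + (-2 - 2 * (α - β / 2 + γ) - 2 * H * R - H * γ + H ^ 2 / 6 + δ + (-2 * (β - 2 * R) + 2 * H * R) * s)
    rw [e]
    unfold Ft
    linarith
  · ring

theorem node_of {H R α β γ m c c' : ℝ} (h : St (Ft H R α β γ) 1 m c) (hc : c - 2 * R ≤ c') : NodeOK H R α β γ c' := by
  obtain ⟨M, mm, ii, p, e⟩ := h.1
  refine ⟨fun s => M s - 2 * R * gk s, ⟨mm.sub (ker_gk.meas.const_mul _), ii.sub ((gk_ii _ _).const_mul _)⟩, ?_, ?_⟩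
  · intro h s hh hs hs1
    have := p h s hh hs hs1
    unfold Ft at this
    simp only; linarith
  · rw [intervalIntegral.integral_sub ii ((gk_ii _ _).const_mul _), intervalIntegral.integral_const_mul, int_gk]
    simp; linarith

end Sph

open MeasureTheory
open scoped ENNReal Classical

namespace Sph

theorem lhA : (974559 / 1000000) ≤ Real.log (1 + (33 / 10) / 2) := (loglb _ _ (13 / 93) 1 (by norm_num) (by norm_num) (by norm_num) (by norm_num))

theorem luA : Real.log (1 + (33 / 10) / 2) ≤ (6091 / 6250) := by
  have h : (-6091 / 6250) ≤ Real.log (20 / 53) := (loglb' _ _ (27 / 133) 2 (by norm_num) (by norm_num) (by norm_num) (by norm_num))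
  have e : (1 + (33 / 10) / 2 : ℝ) = ((20 / 53))⁻¹ := by norm_num
  rw [e, Real.log_inv]
  linarith

theorem blA_0 : BL (33 / 10) (-269861 / 750000) (82361 / 375000) := by
  have h := BL.tan (33 / 10) (-1) (-173287 / 250000) (974559 / 1000000) (82361 / 375000) (by norm_num) (by norm_num) (by norm_num) (loglb' _ _ 0 1 (by norm_num) (by norm_num) (by norm_num) (by norm_num)) lhA (by norm_num) (by norm_num)
  norm_num at h ⊢
  exact h

theorem blA_1 : BL (33 / 10) (-55001 / 250000) (48129 / 500000) := by
  have h := BL.tan (33 / 10) (-3 / 4) (-117501 / 250000) (974559 / 1000000) (48129 / 500000) (by norm_num) (by norm_num) (by norm_num) (loglb' _ _ (1 / 9) 1 (by norm_num) (by norm_num) (by norm_num) (by norm_num)) lhA (by norm_num) (by norm_num)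
  norm_num at h ⊢
  exact h

theorem blA_2 : BL (33 / 10) (-363049 / 3000000) (50549 / 1500000) := by
  have h := BL.tan (33 / 10) (-1 / 2) (-287683 / 1000000) (974559 / 1000000) (50549 / 1500000) (by norm_num) (by norm_num) (by norm_num) (loglb' _ _ (1 / 5) 1 (by norm_num) (by norm_num) (by norm_num) (by norm_num)) lhA (by norm_num) (by norm_num)
  norm_num at h ⊢
  exact h

theorem blA_3 : BL (33 / 10) (-75301 / 1500000) (9977 / 1500000) := by
  have h := BL.tan (33 / 10) (-1 / 4) (-66767 / 500000) (974559 / 1000000) (9977 / 1500000) (by norm_num) (by norm_num) (by norm_num) (loglb' _ _ (3 / 11) 1 (by norm_num) (by norm_num) (by norm_num) (by norm_num)) lhA (by norm_num) (by norm_num)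
  norm_num at h ⊢
  exact h

theorem blA_4 : BL (33 / 10) 0 0 := by
  have h := BL.tan (33 / 10) 0 0 (974559 / 1000000) 0 (by norm_num) (by norm_num) (by norm_num) (by norm_num) lhA (by norm_num) (by norm_num)
  norm_num at h ⊢
  exact h

theorem blA_5 : BL (33 / 10) (2531 / 150000) (55193 / 10000000) := by
  have h := BL.tan (33 / 10) (11 / 100) (2677 / 50000) (974559 / 1000000) (55193 / 10000000) (by norm_num) (by norm_num) (by norm_num) (loglb _ _ (11 / 411) 0 (by norm_num) (by norm_num) (by norm_num) (by norm_num)) lhA (by norm_num) (by norm_num)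
  norm_num at h ⊢
  exact h

theorem lhB : (589327 / 500000) ≤ Real.log (1 + (9 / 2) / 2) := (loglb _ _ (5 / 21) 1 (by norm_num) (by norm_num) (by norm_num) (by norm_num))

theorem luB : Real.log (1 + (9 / 2) / 2) ≤ (235731 / 200000) := by
  have h : (-235731 / 200000) ≤ Real.log (4 / 13) := (loglb' _ _ (3 / 29) 2 (by norm_num) (by norm_num) (by norm_num) (by norm_num))
  have e : (1 + (9 / 2) / 2 : ℝ) = ((4 / 13))⁻¹ := by norm_num
  rw [e, Real.log_inv]
  linarith

theorem blB_0 : BL (9 / 2) (-269861 / 750000) (82361 / 375000) := by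
  have h := BL.tan (9 / 2) (-1) (-173287 / 250000) (589327 / 500000) (82361 / 375000) (by norm_num) (by norm_num) (by norm_num) (loglb' _ _ 0 1 (by norm_num) (by norm_num) (by norm_num) (by norm_num)) lhB (by norm_num) (by norm_num)
  norm_num at h ⊢
  exact h

theorem blB_1 : BL (9 / 2) (-55001 / 250000) (48129 / 500000) := by
  have h := BL.tan (9 / 2) (-3 / 4) (-117501 / 250000) (589327 / 500000) (48129 / 500000) (by norm_num) (by norm_num) (by norm_num) (loglb' _ _ (1 / 9) 1 (by norm_num) (by norm_num) (by norm_num) (by norm_num)) lhB (by norm_num) (by norm_num)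
  norm_num at h ⊢
  exact h

theorem blB_2 : BL (9 / 2) (-363049 / 3000000) (50549 / 1500000) := by
  have h := BL.tan (9 / 2) (-1 / 2) (-287683 / 1000000) (589327 / 500000) (50549 / 1500000) (by norm_num) (by norm_num) (by norm_num) (loglb' _ _ (1 / 5) 1 (by norm_num) (by norm_num) (by norm_num) (by norm_num)) lhB (by norm_num) (by norm_num)
  norm_num at h ⊢
  exact h

theorem blB_3 : BL (9 / 2) (-129611 / 3000000) (7733 / 400000) := by
  have h := BL.tan (9 / 2) (-11 / 50) (-116537 / 1000000) (589327 / 500000) (7733 / 400000) (by norm_num) (by norm_num) (by norm_num) (loglb' _ _ (39 / 139) 1 (by norm_num) (by norm_num) (by norm_num) (by norm_num)) lhB (by norm_num) (by norm_num)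
  norm_num at h ⊢
  exact h

theorem lhC : (31319 / 25000) ≤ Real.log (1 + 5 / 2) := (loglb _ _ (3 / 11) 1 (by norm_num) (by norm_num) (by norm_num) (by norm_num))

theorem luC : Real.log (1 + 5 / 2) ≤ (1252763 / 1000000) := by
  have h : (-1252763 / 1000000) ≤ Real.log (2 / 7) := (loglb' _ _ (1 / 15) 2 (by norm_num) (by norm_num) (by norm_num) (by norm_num))
  have e : (1 + 5 / 2 : ℝ) = ((2 / 7))⁻¹ := by norm_num
  rw [e, Real.log_inv]
  linarith

theorem blC_0 : BL 5 (-269861 / 750000) (82361 / 375000) := by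
  have h := BL.tan 5 (-1) (-173287 / 250000) (31319 / 25000) (82361 / 375000) (by norm_num) (by norm_num) (by norm_num) (loglb' _ _ 0 1 (by norm_num) (by norm_num) (by norm_num) (by norm_num)) lhC (by norm_num) (by norm_num)
  norm_num at h ⊢
  exact h

theorem blC_1 : BL 5 (-55001 / 250000) (48129 / 500000) := by
  have h := BL.tan 5 (-3 / 4) (-117501 / 250000) (31319 / 25000) (48129 / 500000) (by norm_num) (by norm_num) (by norm_num) (loglb' _ _ (1 / 9) 1 (by norm_num) (by norm_num) (by norm_num) (by norm_num)) lhC (by norm_num) (by norm_num)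
  norm_num at h ⊢
  exact h

theorem blC_2 : BL 5 (-363049 / 3000000) (50549 / 1500000) := by
  have h := BL.tan 5 (-1 / 2) (-287683 / 1000000) (31319 / 25000) (50549 / 1500000) (by norm_num) (by norm_num) (by norm_num) (loglb' _ _ (1 / 5) 1 (by norm_num) (by norm_num) (by norm_num) (by norm_num)) lhC (by norm_num) (by norm_num)
  norm_num at h ⊢
  exact h

theorem blC_3 : BL 5 (-218993 / 3000000) (3883 / 120000) := by
  have h := BL.tan 5 (-17 / 50) (-186331 / 1000000) (31319 / 25000) (3883 / 120000) (by norm_num) (by norm_num) (by norm_num) (loglb' _ _ (33 / 133) 1 (by norm_num) (by norm_num) (by norm_num) (by norm_num)) lhC (by norm_num) (by norm_num)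
  norm_num at h ⊢
  exact h

theorem lhD : (693147 / 500000) ≤ Real.log (1 + 6 / 2) := (loglb _ _ 0 2 (by norm_num) (by norm_num) (by norm_num) (by norm_num))

theorem luD : Real.log (1 + 6 / 2) ≤ (277259 / 200000) := by
  have h : (-277259 / 200000) ≤ Real.log (1 / 4) := (loglb' _ _ 0 2 (by norm_num) (by norm_num) (by norm_num) (by norm_num))
  have e : (1 + 6 / 2 : ℝ) = ((1 / 4))⁻¹ := by norm_num
  rw [e, Real.log_inv]
  linarith

theorem blD_0 : BL 6 (-269861 / 750000) (82361 / 375000) := by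
  have h := BL.tan 6 (-1) (-173287 / 250000) (693147 / 500000) (82361 / 375000) (by norm_num) (by norm_num) (by norm_num) (loglb' _ _ 0 1 (by norm_num) (by norm_num) (by norm_num) (by norm_num)) lhD (by norm_num) (by norm_num)
  norm_num at h ⊢
  exact h

theorem blD_1 : BL 6 (-55001 / 250000) (48129 / 500000) := by
  have h := BL.tan 6 (-3 / 4) (-117501 / 250000) (693147 / 500000) (48129 / 500000) (by norm_num) (by norm_num) (by norm_num) (loglb' _ _ (1 / 9) 1 (by norm_num) (by norm_num) (by norm_num) (by norm_num)) lhD (by norm_num) (by norm_num)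
  norm_num at h ⊢
  exact h

theorem blD_2 : BL 6 (-85103 / 600000) (29309 / 500000) := by
  have h := BL.tan 6 (-14 / 25) (-65701 / 200000) (693147 / 500000) (29309 / 500000) (by norm_num) (by norm_num) (by norm_num) (loglb' _ _ (11 / 61) 1 (by norm_num) (by norm_num) (by norm_num) (by norm_num)) lhD (by norm_num) (by norm_num)
  norm_num at h ⊢
  exact h

theorem node_a : NodeOK (33 / 10) (3 / 10) (-19 / 100) (87 / 50) (11 / 10) (1599 / 5000) := by
  have hF := Ft_convex (33 / 10) (3 / 10) (-19 / 100) (87 / 50) (11 / 10) (by norm_num) (by norm_num)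
  have hl : Real.log (279 / 10000) ≤ -(447391 / 125000) := by
    have h : (447391 / 125000) ≤ Real.log ((279 / 10000))⁻¹ := (loglb _ _ (67 / 1183) 5 (by norm_num) (by norm_num) (by norm_num) (by norm_num))
    rw [Real.log_inv] at h
    linarith
  have hb : IB (Ft (33 / 10) (3 / 10) (-19 / 100) (87 / 50) (11 / 10)) 0 (279 / 10000) (208491 / 1000000) := tail_node (33 / 10) (3 / 10) (-19 / 100) (87 / 50) (11 / 10) (2531 / 150000) (55193 / 10000000) (6091 / 6250) (279 / 10000) (894783 / 250000) (447391 / 125000) (52041 / 50000) (3226 / 3125) (1633 / 20000) (208491 / 1000000)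
    (by norm_num) (by norm_num) (by norm_num) blA_5 luA (by norm_num) (loglb' _ _ (491 / 1741) 6 (by norm_num) (by norm_num) (by norm_num) (by norm_num)) hl (by norm_num) (by norm_num) (by norm_num)
    (loglb _ _ (2041 / 102041) 0 (by norm_num) (by norm_num) (by norm_num) (by norm_num)) (by norm_num) (by norm_num) (loglb _ _ (101 / 6351) 0 (by norm_num) (by norm_num) (by norm_num) (by norm_num)) (by norm_num)
    (loglb' _ _ (383 / 2883) 4 (by norm_num) (by norm_num) (by norm_num) (by norm_num)) (by norm_num) (by norm_num)
  have S0 : St (Ft (33 / 10) (3 / 10) (-19 / 100) (87 / 50) (11 / 10)) (279 / 10000) (3948371 / 1000000) (208491 / 1000000) := ⟨hb, (pt_node (33 / 10) (3 / 10) (-19 / 100) (87 / 50) (11 / 10) (279 / 10000) (894783 / 250000) (1340063 / 2500000) (1718721 / 1000000) (15721 / 5000) (357983 / 312500) (3948371 / 1000000) (by norm_num) (by norm_num) (loglb' _ _ (491 / 1741) 6 (by norm_num) (by norm_num) (by norm_num) (by norm_num)) (blA_5.right _ _ (by norm_num) (by norm_num)) (by norm_num) (by norm_num) (loglb _ _ (5721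 / 25721) 1 (by norm_num) (by norm_num) (by norm_num) (by norm_num)) (by norm_num) (by norm_num) (by norm_num))⟩
  have S1 := S0.step hF (6 / 125) (258439 / 100000) (137073 / 500000) (by norm_num) (by norm_num) (pt_node (33 / 10) (3 / 10) (-19 / 100) (87 / 50) (11 / 10) (6 / 125) (607311 / 200000) (245453 / 1000000) (759833 / 1000000) (13669 / 5000) (2011373 / 2000000) (258439 / 100000) (by norm_num) (by norm_num) (loglb' _ _ (67 / 317) 5 (by norm_num) (by norm_num) (by norm_num) (by norm_num)) (blA_5.right _ _ (by norm_num) (by norm_num)) (by norm_num) (by norm_num) (loglb _ _ (3669 / 23669) 1 (by norm_num) (by norm_num) (by norm_num) (by norm_num)) (by norm_num) (by norm_num) (by norm_num)) (by norm_num)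
  have S2 := S1.step hF (3 / 40) (1585379 / 1000000) (165219 / 500000) (by norm_num) (by norm_num) (pt_node (33 / 10) (3 / 10) (-19 / 100) (87 / 50) (11 / 10) (3 / 40) (647567 / 250000) (15413 / 625000) (15609 / 500000) (1 + (33 / 10) / 2) (974559 / 1000000) (1585379 / 1000000) (by norm_num) (by norm_num) (loglb' _ _ (1 / 11) 4 (by norm_num) (by norm_num) (by norm_num) (by norm_num)) (blA_5.right _ _ (by norm_num) (by norm_num)) (by norm_num) (by norm_num) lhA (by norm_num) (by norm_num) (by norm_num)) (by norm_num)
  have S3 := S2.step hF (13 / 125) (695861 / 500000) (186803 / 500000) (by norm_num) (by norm_num) (pt_node (33 / 10) (3 / 10) (-19 / 100) (87 / 50) (11 / 10) (13 / 125) (1131683 / 500000) (-302551 / 2500000) (16851 / 500000) (1 + (33 / 10) / 2) (974559 / 1000000) (695861 / 500000) (by norm_num) (by norm_num) (loglb' _ _ (83 / 333) 4 (by norm_num) (by norm_num) (by norm_num) (by norm_num)) (blA_1.mid blA_2 _ (1484754 / 1484815) _ (by norm_num) (by norm_num) (by norm_num) (by norm_num)) (by norm_num) (by norm_num) lhA (by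 norm_num) (by norm_num) (by norm_num)) (by norm_num)
  have S4 := S3.step hF (21 / 100) (288651 / 250000) (254281 / 500000) (by norm_num) (by norm_num) (pt_node (33 / 10) (3 / 10) (-19 / 100) (87 / 50) (11 / 10) (21 / 100) (1560649 / 1000000) (-1791053 / 5000000) (109107 / 500000) (1 + (33 / 10) / 2) (974559 / 1000000) (288651 / 250000) (by norm_num) (by norm_num) (loglb' _ _ (17 / 67) 3 (by norm_num) (by norm_num) (by norm_num) (by norm_num)) (blA_0.mid blA_1 _ (24061 / 2097160) _ (by norm_num) (by norm_num) (by norm_num) (by norm_num)) (by norm_num) (by norm_num) lhA (by norm_num) (by norm_num) (by norm_num)) (by norm_num)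
  have S5 := S4.step hF (521 / 1000) (153319 / 250000) (195867 / 250000) (by norm_num) (by norm_num) (pt_node (33 / 10) (3 / 10) (-19 / 100) (87 / 50) (11 / 10) (521 / 1000) (326003 / 500000) (-905641 / 2500000) (27759 / 125000) (1 + (33 / 10) / 2) (974559 / 1000000) (153319 / 250000) (by norm_num) (by norm_num) (loglb' _ _ (21 / 1021) 1 (by norm_num) (by norm_num) (by norm_num) (by norm_num)) (blA_0.left _ _ (by norm_num) (by norm_num)) (by norm_num) (by norm_num) lhA (by norm_num) (by norm_num) (by norm_num)) (by norm_num)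
  have S6 := S5.step hF (707 / 1000) (61173 / 200000) (868949 / 1000000) (by norm_num) (by norm_num) (pt_node (33 / 10) (3 / 10) (-19 / 100) (87 / 50) (11 / 10) (707 / 1000) (13869 / 40000) (-44357 / 200000) (9783 / 100000) (1 + (33 / 10) / 2) (974559 / 1000000) (61173 / 200000) (by norm_num) (by norm_num) (loglb' _ _ (207 / 1207) 1 (by norm_num) (by norm_num) (by norm_num) (by norm_num)) (blA_0.mid blA_1 _ (31853 / 32264) _ (by norm_num) (by norm_num) (by norm_num) (by norm_num)) (by norm_num) (by norm_num) lhA (by norm_num) (by norm_num) (by norm_num)) (by norm_num)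
  have S7 := S6.step hF (407 / 500) (39213 / 250000) (178741 / 200000) (by norm_num) (by norm_num) (pt_node (33 / 10) (3 / 10) (-19 / 100) (87 / 50) (11 / 10) (407 / 500) (51449 / 250000) (-150203 / 1250000) (16687 / 500000) (28003 / 10000) (2574247 / 2500000) (39213 / 250000) (by norm_num) (by norm_num) (loglb' _ _ (157 / 657) 1 (by norm_num) (by norm_num) (by norm_num) (by norm_num)) (blA_2.mid blA_3 _ (12809 / 1062235) _ (by norm_num) (by norm_num) (by norm_num) (by norm_num)) (by norm_num) (by norm_num) (loglb _ _ (8003 / 48003) 1 (by norm_num) (by norm_num) (by norm_num) (by norm_num)) (by norm_num) (by norm_num) (by norm_num)) (by norm_num)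
  have S8 := S7.step hF (929 / 1000) (3501 / 62500) (181189 / 200000) (by norm_num) (by norm_num) (pt_node (33 / 10) (3 / 10) (-19 / 100) (87 / 50) (11 / 10) (929 / 1000) (18413 / 250000) (407 / 625000) (107 / 500000) (7671 / 2500) (2802889 / 2500000) (3501 / 62500) (by norm_num) (by norm_num) (loglb' _ _ (429 / 1429) 1 (by norm_num) (by norm_num) (by norm_num) (by norm_num)) (blA_4.mid blA_5 _ (2442 / 63275) _ (by norm_num) (by norm_num) (by norm_num) (by norm_num)) (by norm_num) (by norm_num) (loglb _ _ (2671 / 12671) 1 (by norm_num) (by norm_num) (by norm_num) (by norm_num)) (by norm_num) (by norm_num) (by norm_num)) (by norm_num)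
  have S9 := S8.step hF 1 (1669 / 5000) (114973 / 125000) (by norm_num) (by norm_num) (pt_node (33 / 10) (3 / 10) (-19 / 100) (87 / 50) (11 / 10) 1 0 (2 / 25) (106919 / 500000) (2034 / 625) (59 / 50) (1669 / 5000) (by norm_num) (by norm_num) (by norm_num) (blA_5.right _ _ (by norm_num) (by norm_num)) (by norm_num) (by norm_num) (loglb _ _ (196 / 821) 1 (by norm_num) (by norm_num) (by norm_num) (by norm_num)) (by norm_num) (by norm_num) (by norm_num)) (by norm_num)
  exact node_of S9 (by norm_num)

theorem node_b : NodeOK (33 / 10) (3 / 10) (-341 / 1000) (1773 / 1000) (3 / 2) (873 / 2000) := by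
  have hF := Ft_convex (33 / 10) (3 / 10) (-341 / 1000) (1773 / 1000) (3 / 2) (by norm_num) (by norm_num)
  have hl : Real.log (109 / 5000) ≤ -(765169 / 200000) := by
    have h : (765169 / 200000) ≤ Real.log ((109 / 5000))⁻¹ := (loglb _ _ (189 / 1061) 5 (by norm_num) (by norm_num) (by norm_num) (by norm_num))
    rw [Real.log_inv] at h
    linarith
  have hb : IB (Ft (33 / 10) (3 / 10) (-341 / 1000) (1773 / 1000) (3 / 2)) 0 (109 / 5000) (197599 / 1000000) := tail_node (33 / 10) (3 / 10) (-341 / 1000) (1773 / 1000) (3 / 2) (2531 / 150000) (55193 / 10000000) (6091 / 6250) (109 / 5000) (1912923 / 500000) (765169 / 200000) (5253 / 4000) (102591 / 100000) (687 / 10000) (197599 / 1000000)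
    (by norm_num) (by norm_num) (by norm_num) blA_5 luA (by norm_num) (loglb' _ _ (247 / 1497) 6 (by norm_num) (by norm_num) (by norm_num) (by norm_num)) hl (by norm_num) (by norm_num) (by norm_num)
    (loglb _ _ (1253 / 9253) 0 (by norm_num) (by norm_num) (by norm_num) (by norm_num)) (by norm_num) (by norm_num) (loglb _ _ (2591 / 202591) 0 (by norm_num) (by norm_num) (by norm_num) (by norm_num)) (by norm_num)
    (loglb' _ _ (31 / 656) 4 (by norm_num) (by norm_num) (by norm_num) (by norm_num)) (by norm_num) (by norm_num)
  have S0 : St (Ft (33 / 10) (3 / 10) (-341 / 1000) (1773 / 1000) (3 / 2)) (109 / 5000) (4610409 / 1000000) (197599 / 1000000) := ⟨hb, (pt_node (33 / 10) (3 / 10) (-341 / 1000) (1773 / 1000) (3 / 2) (109 / 5000) (1912923 / 500000) (506659 / 1000000) (405453 / 250000) (21227 / 5000) (3614563 / 2500000) (4610409 / 1000000) (by norm_num) (by norm_num) (loglb' _ _ (247 / 1497) 6 (by norm_num) (by norm_num) (by norm_num) (by norm_num)) (blA_5.right _ _ (by norm_num) (by norm_num)) (by norm_num) (by norm_num) (loglb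 _ _ (1227 / 41227) 2 (by norm_num) (by norm_num) (by norm_num) (by norm_num)) (by norm_num) (by norm_num) (by norm_num))⟩
  have S1 := S0.step hF (31 / 1000) (3490497 / 1000000) (14679 / 62500) (by norm_num) (by norm_num) (pt_node (33 / 10) (3 / 10) (-341 / 1000) (1773 / 1000) (3 / 2) (31 / 1000) (173689 / 50000) (311731 / 1000000) (19571 / 20000) (19307 / 5000) (1350997 / 1000000) (3490497 / 1000000) (by norm_num) (by norm_num) (loglb' _ _ (123 / 373) 6 (by norm_num) (by norm_num) (by norm_num) (by norm_num)) (blA_5.right _ _ (by norm_num) (by norm_num)) (by norm_num) (by norm_num) (loglb _ _ (9307 / 29307) 1 (by norm_num) (by norm_num) (by norm_num) (by norm_num)) (by norm_num) (by norm_num) (by norm_num)) (by norm_num)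
  have S2 := S1.step hF (43 / 1000) (2539153 / 1000000) (135521 / 500000) (by norm_num) (by norm_num) (pt_node (33 / 10) (3 / 10) (-341 / 1000) (1773 / 1000) (3 / 2) (43 / 1000) (786639 / 250000) (683363 / 5000000) (400857 / 1000000) (35499 / 10000) (6334529 / 5000000) (2539153 / 1000000) (by norm_num) (by norm_num) (loglb' _ _ (47 / 297) 5 (by norm_num) (by norm_num) (by norm_num) (by norm_num)) (blA_5.right _ _ (by norm_num) (by norm_num)) (by norm_num) (by norm_num) (loglb _ _ (15499 / 55499) 1 (by norm_num) (by norm_num) (by norm_num) (by norm_num)) (by norm_num) (by norm_num) (by norm_num)) (by norm_num)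
  have S3 := S2.step hF (29 / 500) (217877 / 125000) (303159 / 1000000) (by norm_num) (by norm_num) (pt_node (33 / 10) (3 / 10) (-341 / 1000) (1773 / 1000) (3 / 2) (29 / 500) (2847317 / 1000000) (-81379 / 5000000) (2157 / 1000000) (33027 / 10000) (11947291 / 10000000) (217877 / 125000) (by norm_num) (by norm_num) (loglb' _ _ (107 / 357) 5 (by norm_num) (by norm_num) (by norm_num) (by norm_num)) (blA_3.mid blA_4 _ (508873 / 753010) _ (by norm_num) (by norm_num) (by norm_num) (by norm_num)) (by norm_num) (by norm_num) (loglb _ _ (13027 / 53027) 1 (by norm_num) (by norm_num) (by norm_num) (by norm_num)) (by norm_num) (by norm_num) (by norm_num)) (by norm_num)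
  have S4 := S3.step hF (2 / 25) (316047 / 200000) (67943 / 200000) (by norm_num) (by norm_num) (pt_node (33 / 10) (3 / 10) (-341 / 1000) (1773 / 1000) (3 / 2) (2 / 25) (2525729 / 1000000) (-851113 / 5000000) (64797 / 1000000) (15387 / 5000) (11240587 / 10000000) (316047 / 200000) (by norm_num) (by norm_num) (loglb' _ _ (7 / 57) 4 (by norm_num) (by norm_num) (by norm_num) (by norm_num)) (blA_1.mid blA_2 _ (746721 / 1484815) _ (by norm_num) (by norm_num) (by norm_num) (by norm_num)) (by norm_num) (by norm_num) (loglb _ _ (5387 / 25387) 1 (by norm_num) (by norm_num) (by norm_num) (by norm_num)) (by norm_num) (by norm_num) (by norm_num)) (by norm_num)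
  have S5 := S4.step hF (1 / 8) (36647 / 25000) (408253 / 1000000) (by norm_num) (by norm_num) (pt_node (33 / 10) (3 / 10) (-341 / 1000) (1773 / 1000) (3 / 2) (1 / 8) (1039721 / 500000) (-1791049 / 5000000) (109107 / 500000) (3547 / 1250) (1303697 / 1250000) (36647 / 25000) (by norm_num) (by norm_num) (loglb' _ _ 0 3 (by norm_num) (by norm_num) (by norm_num) (by norm_num)) (blA_0.mid blA_1 _ (24073 / 2097160) _ (by norm_num) (by norm_num) (by norm_num) (by norm_num)) (by norm_num) (by norm_num) (loglb _ _ (1047 / 6047) 1 (by norm_num) (by norm_num) (by norm_num) (by norm_num)) (by norm_num) (by norm_num) (by norm_num)) (by norm_num)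
  have S6 := S5.step hF (357 / 500) (105359 / 250000) (241017 / 250000) (by norm_num) (by norm_num) (pt_node (33 / 10) (3 / 10) (-341 / 1000) (1773 / 1000) (3 / 2) (357 / 500) (336873 / 1000000) (-1797271 / 5000000) (13707 / 62500) (8393 / 2500) (12110839 / 10000000) (105359 / 250000) (by norm_num) (by norm_num) (loglb' _ _ (107 / 607) 1 (by norm_num) (by norm_num) (by norm_num) (by norm_num)) (blA_0.mid blA_1 _ (5407 / 2097160) _ (by norm_num) (by norm_num) (by norm_num) (by norm_num)) (by norm_num) (by norm_num) (loglb _ _ (3393 / 13393) 1 (by norm_num) (by norm_num) (by norm_num) (by norm_num)) (by norm_num) (by norm_num) (by norm_num)) (by norm_num)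
  have S7 := S6.step hF (857 / 1000) (185971 / 1000000) (503749 / 500000) (by norm_num) (by norm_num) (pt_node (33 / 10) (3 / 10) (-341 / 1000) (1773 / 1000) (3 / 2) (857 / 1000) (154319 / 1000000) (-538619 / 2500000) (93379 / 1000000) (37587 / 10000) (13240567 / 10000000) (185971 / 1000000) (by norm_num) (by norm_num) (loglb' _ _ (357 / 1357) 1 (by norm_num) (by norm_num) (by norm_num) (by norm_num)) (blA_1.mid blA_2 _ (68346 / 1484815) _ (by norm_num) (by norm_num) (by norm_num) (by norm_num)) (by norm_num) (by norm_num) (loglb _ _ (17587 / 57587) 1 (by norm_num) (by norm_num) (by norm_num) (by norm_num)) (by norm_num) (by norm_num) (by norm_num)) (by norm_num)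
  have S8 := S7.step hF (117 / 125) (94909 / 1000000) (1018593 / 1000000) (by norm_num) (by norm_num) (pt_node (33 / 10) (3 / 10) (-341 / 1000) (1773 / 1000) (3 / 2) (117 / 125) (33073 / 500000) (-320711 / 2500000) (38293 / 1000000) (502 / 125) (6951359 / 5000000) (94909 / 1000000) (by norm_num) (by norm_num) (loglb' _ _ (109 / 359) 1 (by norm_num) (by norm_num) (by norm_num) (by norm_num)) (blA_1.mid blA_2 _ (1375794 / 1484815) _ (by norm_num) (by norm_num) (by norm_num) (by norm_num)) (by norm_num) (by norm_num) (loglb _ _ (1 / 501) 2 (by norm_num) (by norm_num) (by norm_num) (by norm_num)) (by norm_num) (by norm_num) (by norm_num)) (by norm_num)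
  have S9 := S8.step hF 1 (231 / 500) (207283 / 200000) (by norm_num) (by norm_num) (pt_node (33 / 10) (3 / 10) (-341 / 1000) (1773 / 1000) (3 / 2) 1 0 (-109 / 2000) (4147 / 500000) (1061 / 250) (2891 / 2000) (231 / 500) (by norm_num) (by norm_num) (by norm_num) (blA_2.mid blA_3 _ (199549 / 212447) _ (by norm_num) (by norm_num) (by norm_num) (by norm_num)) (by norm_num) (by norm_num) (loglb _ _ (61 / 2061) 2 (by norm_num) (by norm_num) (by norm_num) (by norm_num)) (by norm_num) (by norm_num) (by norm_num)) (by norm_num)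
  exact node_of S9 (by norm_num)

theorem node_c : NodeOK (33 / 10) (1 / 2) (-543 / 1000) (1543 / 500) (3 / 2) (23423 / 30000) := by
  have hF := Ft_convex (33 / 10) (1 / 2) (-543 / 1000) (1543 / 500) (3 / 2) (by norm_num) (by norm_num)
  have hl : Real.log (109 / 5000) ≤ -(765169 / 200000) := by
    have h : (765169 / 200000) ≤ Real.log ((109 / 5000))⁻¹ := (loglb _ _ (189 / 1061) 5 (by norm_num) (by norm_num) (by norm_num) (by norm_num))
    rw [Real.log_inv] at h
    linarith
  have hb : IB (Ft (33 / 10) (1 / 2) (-543 / 1000) (1543 / 500) (3 / 2)) 0 (109 / 5000) (174421 / 500000) := tail_node (33 / 10) (1 / 2) (-543 / 1000) (1543 / 500) (3 / 2) (2531 / 150000) (55193 / 10000000) (6091 / 6250) (109 / 5000) (1912923 / 500000) (765169 / 200000) (11131 / 20000) (104653 / 100000) (2953 / 20000) (174421 / 500000)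
    (by norm_num) (by norm_num) (by norm_num) blA_5 luA (by norm_num) (loglb' _ _ (247 / 1497) 6 (by norm_num) (by norm_num) (by norm_num) (by norm_num)) hl (by norm_num) (by norm_num) (by norm_num)
    (loglb' _ _ (1131 / 21131) 1 (by norm_num) (by norm_num) (by norm_num) (by norm_num)) (by norm_num) (by norm_num) (loglb _ _ (4653 / 204653) 0 (by norm_num) (by norm_num) (by norm_num) (by norm_num)) (by norm_num)
    (loglb' _ _ (453 / 5453) 3 (by norm_num) (by norm_num) (by norm_num) (by norm_num)) (by norm_num) (by norm_num)
  have S0 : St (Ft (33 / 10) (1 / 2) (-543 / 1000) (1543 / 500) (3 / 2)) (109 / 5000) (6920437 / 1000000) (174421 / 500000) := ⟨hb, (pt_node (33 / 10) (1 / 2) (-543 / 1000) (1543 / 500) (3 / 2) (109 / 5000) (1912923 / 500000) (1008901 / 1250000) (326667 / 125000) (39449 / 10000) (6861989 / 5000000) (6920437 / 1000000) (by norm_num) (by norm_num) (loglb' _ _ (247 / 1497) 6 (by norm_num) (by norm_num) (by norm_num) (by norm_num)) (blA_5.right _ _ (by norm_num) (by norm_num)) (by norm_num) (by norm_num) (loglb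 _ _ (19449 / 59449) 1 (by norm_num) (by norm_num) (by norm_num) (by norm_num)) (by norm_num) (by norm_num) (by norm_num))⟩
  have S1 := S0.step hF (3 / 100) (2669137 / 500000) (399103 / 1000000) (by norm_num) (by norm_num) (pt_node (33 / 10) (1 / 2) (-543 / 1000) (1543 / 500) (3 / 2) (3 / 100) (1753283 / 500000) (256573 / 500000) (82161 / 50000) (2138 / 625) (1229863 / 1000000) (2669137 / 500000) (by norm_num) (by norm_num) (loglb' _ _ (23 / 73) 6 (by norm_num) (by norm_num) (by norm_num) (by norm_num)) (blA_5.right _ _ (by norm_num) (by norm_num)) (by norm_num) (by norm_num) (loglb _ _ (222 / 847) 1 (by norm_num) (by norm_num) (by norm_num) (by norm_num)) (by norm_num) (by norm_num) (by norm_num)) (by norm_num)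
  have S2 := S1.step hF (41 / 1000) (989963 / 250000) (450243 / 1000000) (by norm_num) (by norm_num) (pt_node (33 / 10) (1 / 2) (-543 / 1000) (1543 / 500) (3 / 2) (41 / 1000) (399273 / 125000) (23471 / 100000) (724381 / 1000000) (29941 / 10000) (548309 / 500000) (989963 / 250000) (by norm_num) (by norm_num) (loglb' _ _ (39 / 289) 5 (by norm_num) (by norm_num) (by norm_num) (by norm_num)) (blA_5.right _ _ (by norm_num) (by norm_num)) (by norm_num) (by norm_num) (loglb _ _ (9941 / 49941) 1 (by norm_num) (by norm_num) (by norm_num) (by norm_num)) (by norm_num) (by norm_num) (by norm_num)) (by norm_num)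
  have S3 := S2.step hF (53 / 1000) (147119 / 50000) (491657 / 1000000) (by norm_num) (by norm_num) (pt_node (33 / 10) (1 / 2) (-543 / 1000) (1543 / 500) (3 / 2) (53 / 1000) (587493 / 200000) (15023 / 1000000) (983 / 200000) (13501 / 5000) (1986581 / 2000000) (147119 / 50000) (by norm_num) (by norm_num) (loglb' _ _ (87 / 337) 5 (by norm_num) (by norm_num) (by norm_num) (by norm_num)) (blA_4.mid blA_5 _ (45069 / 50620) _ (by norm_num) (by norm_num) (by norm_num) (by norm_num)) (by norm_num) (by norm_num) (loglb _ _ (3501 / 23501) 1 (by norm_num) (by norm_num) (by norm_num) (by norm_num)) (by norm_num) (by norm_num) (by norm_num)) (by norm_num)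
  have S4 := S3.step hF (67 / 1000) (1385811 / 500000) (66457 / 125000) (by norm_num) (by norm_num) (pt_node (33 / 10) (1 / 2) (-543 / 1000) (1543 / 500) (3 / 2) (67 / 1000) (2703063 / 1000000) (-7047 / 40000) (68559 / 1000000) (1 + (33 / 10) / 2) (974559 / 1000000) (1385811 / 500000) (by norm_num) (by norm_num) (loglb' _ _ (9 / 259) 4 (by norm_num) (by norm_num) (by norm_num) (by norm_num)) (blA_1.mid blA_2 _ (3207 / 7243) _ (by norm_num) (by norm_num) (by norm_num) (by norm_num)) (by norm_num) (by norm_num) lhA (by norm_num) (by norm_num) (by norm_num)) (by norm_num)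
  have S5 := S4.step hF (87 / 1000) (2677333 / 1000000) (293073 / 500000) (by norm_num) (by norm_num) (pt_node (33 / 10) (1 / 2) (-543 / 1000) (1543 / 500) (3 / 2) (87 / 1000) (305231 / 125000) (-37567 / 100000) (47097 / 200000) (1 + (33 / 10) / 2) (974559 / 1000000) (2677333 / 1000000) (by norm_num) (by norm_num) (loglb' _ _ (49 / 299) 4 (by norm_num) (by norm_num) (by norm_num) (by norm_num)) (blA_0.left _ _ (by norm_num) (by norm_num)) (by norm_num) (by norm_num) lhA (by norm_num) (by norm_num) (by norm_num)) (by norm_num)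
  have S6 := S5.step hF (407 / 500) (433811 / 1000000) (1717047 / 1000000) (by norm_num) (by norm_num) (pt_node (33 / 10) (1 / 2) (-543 / 1000) (1543 / 500) (3 / 2) (407 / 500) (51449 / 250000) (-1841 / 5000) (45603 / 200000) (337 / 100) (607451 / 500000) (433811 / 1000000) (by norm_num) (by norm_num) (loglb' _ _ (157 / 657) 1 (by norm_num) (by norm_num) (by norm_num) (by norm_num)) (blA_0.left _ _ (by norm_num) (by norm_num)) (by norm_num) (by norm_num) (loglb _ _ (137 / 537) 1 (by norm_num) (by norm_num) (by norm_num) (by norm_num)) (by norm_num) (by norm_num) (by norm_num)) (by norm_num)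
  have S7 := S6.step hF (893 / 1000) (207551 / 1000000) (1742381 / 1000000) (by norm_num) (by norm_num) (pt_node (33 / 10) (1 / 2) (-543 / 1000) (1543 / 500) (3 / 2) (893 / 1000) (28293 / 250000) (-21703 / 100000) (94379 / 1000000) (37939 / 10000) (166673 / 125000) (207551 / 1000000) (by norm_num) (by norm_num) (loglb' _ _ (393 / 1393) 1 (by norm_num) (by norm_num) (by norm_num) (by norm_num)) (blA_1.mid blA_2 _ (8922 / 296963) _ (by norm_num) (by norm_num) (by norm_num) (by norm_num)) (by norm_num) (by norm_num) (loglb _ _ (17939 / 57939) 1 (by norm_num) (by norm_num) (by norm_num) (by norm_num)) (by norm_num) (by norm_num) (by norm_num)) (by norm_num)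
  have S8 := S7.step hF (117 / 125) (136949 / 1000000) (437447 / 250000) (by norm_num) (by norm_num) (pt_node (33 / 10) (1 / 2) (-543 / 1000) (1543 / 500) (3 / 2) (117 / 125) (33073 / 500000) (-65679 / 500000) (10059 / 250000) (8107 / 2000) (1399569 / 1000000) (136949 / 1000000) (by norm_num) (by norm_num) (loglb' _ _ (109 / 359) 1 (by norm_num) (by norm_num) (by norm_num) (by norm_num)) (blA_1.mid blA_2 _ (265938 / 296963) _ (by norm_num) (by norm_num) (by norm_num) (by norm_num)) (by norm_num) (by norm_num) (loglb _ _ (107 / 16107) 2 (by norm_num) (by norm_num) (by norm_num) (by norm_num)) (by norm_num) (by norm_num) (by norm_num)) (by norm_num)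
  have S9 := S8.step hF 1 (2071 / 2500) (44517 / 25000) (by norm_num) (by norm_num) (pt_node (33 / 10) (1 / 2) (-543 / 1000) (1543 / 500) (3 / 2) 1 0 0 0 (44817 / 10000) (3 / 2) (2071 / 2500) (by norm_num) (by norm_num) (by norm_num) (blA_3.mid blA_4 _ 1 _ (by norm_num) (by norm_num) (by norm_num) (by norm_num)) (by norm_num) (by norm_num) (loglb _ _ (4817 / 84817) 2 (by norm_num) (by norm_num) (by norm_num) (by norm_num)) (by norm_num) (by norm_num) (by norm_num)) (by norm_num)
  exact node_of S9 (by norm_num)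

theorem node_d : NodeOK (9 / 2) (9 / 25) (-499 / 1000) (1119 / 500) (7 / 4) (1591 / 2500) := by
  have hF := Ft_convex (9 / 2) (9 / 25) (-499 / 1000) (1119 / 500) (7 / 4) (by norm_num) (by norm_num)
  have hl : Real.log (241 / 10000) ≤ -(3725543 / 1000000) := by
    have h : (3725543 / 1000000) ≤ Real.log ((241 / 10000))⁻¹ := (loglb _ _ (143 / 1107) 5 (by norm_num) (by norm_num) (by norm_num) (by norm_num))
    rw [Real.log_inv] at h
    linarith
  have hb : IB (Ft (9 / 2) (9 / 25) (-499 / 1000) (1119 / 500) (7 / 4)) 0 (241 / 10000) (138421 / 500000) := tail_node (9 / 2) (9 / 25) (-499 / 1000) (1119 / 500) (7 / 4) (-129611 / 3000000) (7733 / 400000) (235731 / 200000) (241 / 10000) (465693 / 125000) (3725543 / 1000000) (114111 / 100000) (103727 / 100000) (1843 / 20000) (138421 / 500000)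
    (by norm_num) (by norm_num) (by norm_num) blB_3 luB (by norm_num) (loglb' _ _ (339 / 1589) 6 (by norm_num) (by norm_num) (by norm_num) (by norm_num)) hl (by norm_num) (by norm_num) (by norm_num)
    (loglb _ _ (14111 / 214111) 0 (by norm_num) (by norm_num) (by norm_num) (by norm_num)) (by norm_num) (by norm_num) (loglb _ _ (3727 / 203727) 0 (by norm_num) (by norm_num) (by norm_num) (by norm_num)) (by norm_num)
    (loglb' _ _ (593 / 3093) 4 (by norm_num) (by norm_num) (by norm_num) (by norm_num)) (by norm_num) (by norm_num)
  have S0 : St (Ft (9 / 2) (9 / 25) (-499 / 1000) (1119 / 500) (7 / 4)) (241 / 10000) (2543949 / 500000) (138421 / 500000) := ⟨hb, (pt_node (9 / 2) (9 / 25) (-499 / 1000) (1119 / 500) (7 / 4) (241 / 10000) (465693 / 125000) (9958187 / 25000000) (2006223 / 1000000) (22629 / 5000) (37744491 / 25000000) (2543949 / 500000) (by norm_num) (by norm_num) (loglb' _ _ (339 / 1589) 6 (by norm_num) (by norm_num) (by norm_num) (by norm_num)) (blB_3.right _ _ (by norm_num) (by norm_num)) (by norm_num) (by norm_num) (loglb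 _ _ (2629 / 42629) 2 (by norm_num) (by norm_num) (by norm_num) (by norm_num)) (by norm_num) (by norm_num) (by norm_num))⟩
  have S1 := S0.step hF (31 / 1000) (498031 / 125000) (308141 / 1000000) (by norm_num) (by norm_num) (pt_node (9 / 2) (9 / 25) (-499 / 1000) (1119 / 500) (7 / 4) (31 / 1000) (173689 / 50000) (581249 / 2500000) (629999 / 500000) (10443 / 2500) (3574047 / 2500000) (498031 / 125000) (by norm_num) (by norm_num) (loglb' _ _ (123 / 373) 6 (by norm_num) (by norm_num) (by norm_num) (by norm_num)) (blB_3.right _ _ (by norm_num) (by norm_num)) (by norm_num) (by norm_num) (loglb _ _ (443 / 20443) 2 (by norm_num) (by norm_num) (by norm_num) (by norm_num)) (by norm_num) (by norm_num) (by norm_num)) (by norm_num)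
  have S2 := S1.step hF (39 / 1000) (3045151 / 1000000) (336259 / 1000000) (by norm_num) (by norm_num) (pt_node (9 / 2) (9 / 25) (-499 / 1000) (1119 / 500) (7 / 4) (39 / 1000) (1622097 / 500000) (1063771 / 12500000) (596707 / 1000000) (2433 / 625) (8494449 / 6250000) (3045151 / 1000000) (by norm_num) (by norm_num) (loglb' _ _ (31 / 281) 5 (by norm_num) (by norm_num) (by norm_num) (by norm_num)) (blB_3.right _ _ (by norm_num) (by norm_num)) (by norm_num) (by norm_num) (loglb _ _ (1183 / 3683) 1 (by norm_num) (by norm_num) (by norm_num) (by norm_num)) (by norm_num) (by norm_num) (by norm_num)) (by norm_num)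
  have S3 := S2.step hF (6 / 125) (562303 / 250000) (90021 / 250000) (by norm_num) (by norm_num) (pt_node (9 / 2) (9 / 25) (-499 / 1000) (1119 / 500) (7 / 4) (6 / 125) (607311 / 200000) (-110641 / 2500000) (19527 / 1000000) (36621 / 10000) (6490119 / 5000000) (562303 / 250000) (by norm_num) (by norm_num) (loglb' _ _ (67 / 317) 5 (by norm_num) (by norm_num) (by norm_num) (by norm_num)) (blB_2.mid blB_3 _ (1151399 / 1167190) _ (by norm_num) (by norm_num) (by norm_num) (by norm_num)) (by norm_num) (by norm_num) (loglb _ _ (16621 / 56621) 1 (by norm_num) (by norm_num) (by norm_num) (by norm_num)) (by norm_num) (by norm_num) (by norm_num)) (by norm_num)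
  have S4 := S3.step hF (11 / 200) (2125537 / 1000000) (93849 / 250000) (by norm_num) (by norm_num) (pt_node (9 / 2) (9 / 25) (-499 / 1000) (1119 / 500) (7 / 4) (11 / 200) (116017 / 40000) (-31651 / 250000) (37231 / 1000000) (17621 / 5000) (1259643 / 1000000) (2125537 / 1000000) (by norm_num) (by norm_num) (loglb' _ _ (19 / 69) 5 (by norm_num) (by norm_num) (by norm_num) (by norm_num)) (blB_1.mid blB_2 _ (280200 / 296963) _ (by norm_num) (by norm_num) (by norm_num) (by norm_num)) (by norm_num) (by norm_num) (loglb _ _ (7621 / 27621) 1 (by norm_num) (by norm_num) (by norm_num) (by norm_num)) (by norm_num) (by norm_num) (by norm_num)) (by norm_num)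
  have S5 := S4.step hF (17 / 200) (1003793 / 500000) (437393 / 1000000) (by norm_num) (by norm_num) (pt_node (9 / 2) (9 / 25) (-499 / 1000) (1119 / 500) (7 / 4) (17 / 200) (493021 / 200000) (-233059 / 625000) (23271 / 100000) (1 + (9 / 2) / 2) (589327 / 500000) (1003793 / 500000) (by norm_num) (by norm_num) (loglb' _ _ (9 / 59) 4 (by norm_num) (by norm_num) (by norm_num) (by norm_num)) (blB_0.left _ _ (by norm_num) (by norm_num)) (by norm_num) (by norm_num) lhB (by norm_num) (by norm_num) (by norm_num)) (by norm_num)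
  have S6 := S5.step hF (407 / 500) (94021 / 250000) (1306241 / 1000000) (by norm_num) (by norm_num) (pt_node (9 / 2) (9 / 25) (-499 / 1000) (1119 / 500) (7 / 4) (407 / 500) (51449 / 250000) (-2300593 / 6250000) (22791 / 100000) (42281 / 10000) (4505433 / 3125000) (94021 / 250000) (by norm_num) (by norm_num) (loglb' _ _ (157 / 657) 1 (by norm_num) (by norm_num) (by norm_num) (by norm_num)) (blB_0.left _ _ (by norm_num) (by norm_num)) (by norm_num) (by norm_num) (loglb _ _ (2281 / 82281) 2 (by norm_num) (by norm_num) (by norm_num) (by norm_num)) (by norm_num) (by norm_num) (by norm_num)) (by norm_num)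
  have S7 := S6.step hF (457 / 500) (33563 / 200000) (333359 / 250000) (by norm_num) (by norm_num) (pt_node (9 / 2) (9 / 25) (-499 / 1000) (1119 / 500) (7 / 4) (457 / 500) (89929 / 1000000) (-2846489 / 12500000) (51533 / 500000) (47201 / 10000) (38795661 / 25000000) (33563 / 200000) (by norm_num) (by norm_num) (loglb' _ _ (207 / 707) 1 (by norm_num) (by norm_num) (by norm_num) (by norm_num)) (blB_0.mid blB_1 _ (4953583 / 5242900) _ (by norm_num) (by norm_num) (by norm_num) (by norm_num)) (by norm_num) (by norm_num) (loglb _ _ (7201 / 87201) 2 (by norm_num) (by norm_num) (by norm_num) (by norm_num)) (by norm_num) (by norm_num) (by norm_num)) (by norm_num)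
  have S8 := S7.step hF (19 / 20) (52853 / 500000) (33459 / 25000) (by norm_num) (by norm_num) (pt_node (9 / 2) (9 / 25) (-499 / 1000) (1119 / 500) (7 / 4) (19 / 20) (513 / 10000) (-43741 / 250000) (33897 / 500000) (12291 / 2500) (199071 / 125000) (52853 / 500000) (by norm_num) (by norm_num) (loglb' _ _ (9 / 29) 1 (by norm_num) (by norm_num) (by norm_num) (by norm_num)) (blB_1.mid blB_2 _ (135120 / 296963) _ (by norm_num) (by norm_num) (by norm_num) (by norm_num)) (by norm_num) (by norm_num) (loglb _ _ (2291 / 22291) 2 (by norm_num) (by norm_num) (by norm_num) (by norm_num)) (by norm_num) (by norm_num) (by norm_num)) (by norm_num)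
  have S9 := S8.step hF 1 (307 / 500) (1356353 / 1000000) (by norm_num) (by norm_num) (pt_node (9 / 2) (9 / 25) (-499 / 1000) (1119 / 500) (7 / 4) 1 0 (-1 / 10) (1491 / 50000) (5207 / 1000) (33 / 20) (307 / 500) (by norm_num) (by norm_num) (by norm_num) (blB_2.mid blB_3 _ (63049 / 233438) _ (by norm_num) (by norm_num) (by norm_num) (by norm_num)) (by norm_num) (by norm_num) (loglb _ _ (1207 / 9207) 2 (by norm_num) (by norm_num) (by norm_num) (by norm_num)) (by norm_num) (by norm_num) (by norm_num)) (by norm_num)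
  exact node_of S9 (by norm_num)

theorem node_e : NodeOK (9 / 2) (1 / 2) (-747 / 1000) (404 / 125) (19 / 10) (29339 / 30000) := by
  have hF := Ft_convex (9 / 2) (1 / 2) (-747 / 1000) (404 / 125) (19 / 10) (by norm_num) (by norm_num)
  have hl : Real.log (31 / 2000) ≤ -(833383 / 200000) := by
    have h : (833383 / 200000) ≤ Real.log ((31 / 2000))⁻¹ := (loglb _ _ (1 / 249) 6 (by norm_num) (by norm_num) (by norm_num) (by norm_num))
    rw [Real.log_inv] at h
    linarith
  have hb : IB (Ft (9 / 2) (1 / 2) (-747 / 1000) (404 / 125) (19 / 10)) 0 (31 / 2000) (330737 / 1000000) := tail_node (9 / 2) (1 / 2) (-747 / 1000) (404 / 125) (19 / 10) (-129611 / 3000000) (7733 / 400000) (235731 / 200000) (31 / 2000) (4166927 / 1000000) (833383 / 200000) (3147 / 5000) (103521 / 100000) (12451 / 100000) (330737 / 1000000)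
    (by norm_num) (by norm_num) (by norm_num) blB_3 luB (by norm_num) (loglb' _ _ (123 / 373) 7 (by norm_num) (by norm_num) (by norm_num) (by norm_num)) hl (by norm_num) (by norm_num) (by norm_num)
    (loglb' _ _ (647 / 5647) 1 (by norm_num) (by norm_num) (by norm_num) (by norm_num)) (by norm_num) (by norm_num) (loglb _ _ (3521 / 203521) 0 (by norm_num) (by norm_num) (by norm_num) (by norm_num)) (by norm_num)
    (loglb' _ _ (6201 / 18701) 4 (by norm_num) (by norm_num) (by norm_num) (by norm_num)) (by norm_num) (by norm_num)
  have S0 : St (Ft (9 / 2) (1 / 2) (-747 / 1000) (404 / 125) (19 / 10)) (31 / 2000) (1136743 / 125000) (330737 / 1000000) := ⟨hb, (pt_node (9 / 2) (1 / 2) (-747 / 1000) (404 / 125) (19 / 10) (31 / 2000) (4166927 / 1000000) (854023 / 1000000) (4056853 / 1000000) (26167 / 5000) (3310119 / 2000000) (1136743 / 125000) (by norm_num) (by norm_num) (loglb' _ _ (123 / 373) 7 (by norm_num) (by norm_num) (by norm_num) (by norm_num)) (blB_3.right _ _ (by norm_num) (by norm_num)) (by norm_num) (by norm_num) (loglb _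 _ (6167 / 46167) 2 (by norm_num) (by norm_num) (by norm_num) (by norm_num)) (by norm_num) (by norm_num) (by norm_num))⟩
  have S1 := S0.step hF (1 / 50) (3680587 / 500000) (183881 / 500000) (by norm_num) (by norm_num) (pt_node (9 / 2) (1 / 2) (-747 / 1000) (404 / 125) (19 / 10) (1 / 50) (489003 / 125000) (19177 / 31250) (2975237 / 1000000) (46537 / 10000) (384413 / 250000) (3680587 / 500000) (by norm_num) (by norm_num) (loglb' _ _ (7 / 57) 6 (by norm_num) (by norm_num) (by norm_num) (by norm_num)) (blB_3.right _ _ (by norm_num) (by norm_num)) (by norm_num) (by norm_num) (loglb _ _ (6537 / 86537) 2 (by norm_num) (by norm_num) (by norm_num) (by norm_num)) (by norm_num) (by norm_num) (by norm_num)) (by norm_num)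
  have S2 := S1.step hF (3 / 125) (3108147 / 500000) (394917 / 1000000) (by norm_num) (by norm_num) (pt_node (9 / 2) (1 / 2) (-747 / 1000) (404 / 125) (19 / 10) (3 / 125) (1864851 / 500000) (44427 / 100000) (553241 / 250000) (42863 / 10000) (1455419 / 1000000) (3108147 / 500000) (by norm_num) (by norm_num) (loglb' _ _ (67 / 317) 6 (by norm_num) (by norm_num) (by norm_num) (by norm_num)) (blB_3.right _ _ (by norm_num) (by norm_num)) (by norm_num) (by norm_num) (loglb _ _ (2863 / 82863) 2 (by norm_num) (by norm_num) (by norm_num) (by norm_num)) (by norm_num) (by norm_num) (by norm_num)) (by norm_num)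
  have S3 := S2.step hF (3 / 100) (2456427 / 500000) (85661 / 200000) (by norm_num) (by norm_num) (pt_node (9 / 2) (1 / 2) (-747 / 1000) (404 / 125) (19 / 10) (3 / 100) (1753283 / 500000) (120263 / 500000) (324029 / 250000) (7771 / 2000) (1357243 / 1000000) (2456427 / 500000) (by norm_num) (by norm_num) (loglb' _ _ (23 / 73) 6 (by norm_num) (by norm_num) (by norm_num) (by norm_num)) (blB_3.right _ _ (by norm_num) (by norm_num)) (by norm_num) (by norm_num) (loglb _ _ (3771 / 11771) 1 (by norm_num) (by norm_num) (by norm_num) (by norm_num)) (by norm_num) (by norm_num) (by norm_num)) (by norm_num)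
  have S4 := S3.step hF (9 / 250) (392143 / 100000) (56851 / 125000) (by norm_num) (by norm_num) (pt_node (9 / 2) (1 / 2) (-747 / 1000) (404 / 125) (19 / 10) (9 / 250) (3324237 / 1000000) (77589 / 1000000) (5629 / 10000) (8987 / 2500) (2558941 / 2000000) (392143 / 100000) (by norm_num) (by norm_num) (loglb' _ _ (19 / 269) 5 (by norm_num) (by norm_num) (by norm_num) (by norm_num)) (blB_3.right _ _ (by norm_num) (by norm_num)) (by norm_num) (by norm_num) (loglb _ _ (3987 / 13987) 1 (by norm_num) (by norm_num) (by norm_num) (by norm_num)) (by norm_num) (by norm_num) (by norm_num)) (by norm_num)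
  have S5 := S4.step hF (21 / 500) (1595999 / 500000) (476149 / 1000000) (by norm_num) (by norm_num) (pt_node (9 / 2) (1 / 2) (-747 / 1000) (404 / 125) (19 / 10) (21 / 500) (1585043 / 500000) (-5717 / 100000) (2739 / 125000) (3373 / 1000) (1215787 / 1000000) (1595999 / 500000) (by norm_num) (by norm_num) (loglb' _ _ (43 / 293) 5 (by norm_num) (by norm_num) (by norm_num) (by norm_num)) (blB_2.mid blB_3 _ (191539 / 233438) _ (by norm_num) (by norm_num) (by norm_num) (by norm_num)) (by norm_num) (by norm_num) (loglb _ _ (1373 / 5373) 1 (by norm_num) (by norm_num) (by norm_num) (by norm_num)) (by norm_num) (by norm_num) (by norm_num)) (by norm_num)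
  have S6 := S5.step hF (31 / 500) (3022431 / 1000000) (269147 / 500000) (by norm_num) (by norm_num) (pt_node (9 / 2) (1 / 2) (-747 / 1000) (404 / 125) (19 / 10) (31 / 500) (2780633 / 1000000) (-381983 / 1000000) (120899 / 500000) (1 + (9 / 2) / 2) (589327 / 500000) (3022431 / 1000000) (by norm_num) (by norm_num) (loglb' _ _ (123 / 373) 5 (by norm_num) (by norm_num) (by norm_num) (by norm_num)) (blB_0.left _ _ (by norm_num) (by norm_num)) (by norm_num) (by norm_num) lhB (by norm_num) (by norm_num) (by norm_num)) (by norm_num)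
  have S7 := S6.step hF (893 / 1000) (336639 / 1000000) (483497 / 250000) (by norm_num) (by norm_num) (pt_node (9 / 2) (1 / 2) (-747 / 1000) (404 / 125) (19 / 10) (893 / 1000) (28293 / 250000) (-90913 / 250000) (223467 / 1000000) (48879 / 10000) (793381 / 500000) (336639 / 1000000) (by norm_num) (by norm_num) (loglb' _ _ (393 / 1393) 1 (by norm_num) (by norm_num) (by norm_num) (by norm_num)) (blB_0.left _ _ (by norm_num) (by norm_num)) (by norm_num) (by norm_num) (loglb _ _ (8879 / 88879) 2 (by norm_num) (by norm_num) (by norm_num) (by norm_num)) (by norm_num) (by norm_num) (by norm_num)) (by norm_num)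
  have S8 := S7.step hF (19 / 20) (3327 / 20000) (487081 / 250000) (by norm_num) (by norm_num) (pt_node (9 / 2) (1 / 2) (-747 / 1000) (404 / 125) (19 / 10) (19 / 20) (513 / 10000) (-2413 / 10000) (2301 / 20000) (2691 / 500) (33661 / 20000) (3327 / 20000) (by norm_num) (by norm_num) (loglb' _ _ (9 / 29) 1 (by norm_num) (by norm_num) (by norm_num) (by norm_num)) (blB_0.mid blB_1 _ (44443 / 52429) _ (by norm_num) (by norm_num) (by norm_num) (by norm_num)) (by norm_num) (by norm_num) (loglb _ _ (691 / 4691) 2 (by norm_num) (by norm_num) (by norm_num) (by norm_num)) (by norm_num) (by norm_num) (by norm_num)) (by norm_num)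
  have S9 := S8.step hF 1 (1017 / 1000) (494477 / 250000) (by norm_num) (by norm_num) (pt_node (9 / 2) (1 / 2) (-747 / 1000) (404 / 125) (19 / 10) 1 0 (-131 / 1000) (40009 / 1000000) (1173 / 200) (1769 / 1000) (1017 / 1000) (by norm_num) (by norm_num) (by norm_num) (blB_1.mid blB_2 _ (267012 / 296963) _ (by norm_num) (by norm_num) (by norm_num) (by norm_num)) (by norm_num) (by norm_num) (loglb _ _ (373 / 1973) 2 (by norm_num) (by norm_num) (by norm_num) (by norm_num)) (by norm_num) (by norm_num) (by norm_num)) (by norm_num)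
  exact node_of S9 (by norm_num)

theorem node_f : NodeOK (9 / 2) (3 / 5) (-1027 / 1000) (2007 / 500) (21 / 10) (13061 / 10000) := by
  have hF := Ft_convex (9 / 2) (3 / 5) (-1027 / 1000) (2007 / 500) (21 / 10) (by norm_num) (by norm_num)
  have hl : Real.log (163 / 10000) ≤ -(2058291 / 500000) := by
    have h : (2058291 / 500000) ≤ Real.log ((163 / 10000))⁻¹ := (loglb _ _ (299 / 951) 5 (by norm_num) (by norm_num) (by norm_num) (by norm_num))
    rw [Real.log_inv] at h
    linarith
  have hb : IB (Ft (9 / 2) (3 / 5) (-1027 / 1000) (2007 / 500) (21 / 10)) 0 (163 / 10000) (52459 / 125000) := tail_node (9 / 2) (3 / 5) (-1027 / 1000) (2007 / 500) (21 / 10) (-129611 / 3000000) (7733 / 400000) (235731 / 200000) (163 / 10000) (4116591 / 1000000) (2058291 / 500000) (19649 / 50000) (52347 / 50000) (1927 / 10000) (52459 / 125000)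
    (by norm_num) (by norm_num) (by norm_num) blB_3 luB (by norm_num) (loglb' _ _ (27 / 1277) 6 (by norm_num) (by norm_num) (by norm_num) (by norm_num)) hl (by norm_num) (by norm_num) (by norm_num)
    (loglb' _ _ (7149 / 32149) 2 (by norm_num) (by norm_num) (by norm_num) (by norm_num)) (by norm_num) (by norm_num) (loglb _ _ (2347 / 102347) 0 (by norm_num) (by norm_num) (by norm_num) (by norm_num)) (by norm_num)
    (loglb' _ _ (677 / 3177) 3 (by norm_num) (by norm_num) (by norm_num) (by norm_num)) (by norm_num) (by norm_num)
  have S0 : St (Ft (9 / 2) (3 / 5) (-1027 / 1000) (2007 / 500) (21 / 10)) (163 / 10000) (230797 / 25000) (52459 / 125000) := ⟨hb, (pt_node (9 / 2) (3 / 5) (-1027 / 1000) (2007 / 500) (21 / 10) (163 / 10000) (4116591 / 1000000) (3856687 / 5000000) (115149 / 31250) (48639 / 10000) (3954557 / 2500000) (230797 / 25000) (by norm_num) (by norm_num) (loglb' _ _ (27 / 1277) 6 (by norm_num) (by norm_num) (by norm_num) (by norm_num)) (blB_3.right _ _ (by norm_num) (by norm_num)) (by norm_num) (by norm_num) (loglb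 _ _ (8639 / 88639) 2 (by norm_num) (by norm_num) (by norm_num) (by norm_num)) (by norm_num) (by norm_num) (by norm_num))⟩
  have S1 := S0.step hF (21 / 1000) (3643071 / 500000) (45849 / 100000) (by norm_num) (by norm_num) (pt_node (9 / 2) (3 / 5) (-1027 / 1000) (2007 / 500) (21 / 10) (21 / 1000) (3863233 / 1000000) (607717 / 1250000) (2401531 / 1000000) (2646 / 625) (7215169 / 5000000) (3643071 / 500000) (by norm_num) (by norm_num) (loglb' _ _ (43 / 293) 6 (by norm_num) (by norm_num) (by norm_num) (by norm_num)) (blB_3.right _ _ (by norm_num) (by norm_num)) (by norm_num) (by norm_num) (loglb _ _ (73 / 2573) 2 (by norm_num) (by norm_num) (by norm_num) (by norm_num)) (by norm_num) (by norm_num) (by norm_num)) (by norm_num)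
  have S2 := S1.step hF (27 / 1000) (5545031 / 1000000) (62123 / 125000) (by norm_num) (by norm_num) (pt_node (9 / 2) (3 / 5) (-1027 / 1000) (2007 / 500) (21 / 10) (27 / 1000) (3611921 / 1000000) (130427 / 625000) (144103 / 125000) (3703 / 1000) (6545653 / 5000000) (5545031 / 1000000) (by norm_num) (by norm_num) (loglb' _ _ (91 / 341) 6 (by norm_num) (by norm_num) (by norm_num) (by norm_num)) (blB_3.right _ _ (by norm_num) (by norm_num)) (by norm_num) (by norm_num) (loglb _ _ (1703 / 5703) 1 (by norm_num) (by norm_num) (by norm_num) (by norm_num)) (by norm_num) (by norm_num) (by norm_num)) (by norm_num)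
  have S3 := S2.step hF (17 / 500) (818523 / 200000) (132679 / 250000) (by norm_num) (by norm_num) (pt_node (9 / 2) (3 / 5) (-1027 / 1000) (2007 / 500) (21 / 10) (17 / 500) (676279 / 200000) (-797 / 20000) (4303 / 125000) (4111 / 1250) (1190513 / 1000000) (818523 / 200000) (by norm_num) (by norm_num) (loglb' _ _ (11 / 261) 5 (by norm_num) (by norm_num) (by norm_num) (by norm_num)) (blB_3.right _ _ (by norm_num) (by norm_num)) (by norm_num) (by norm_num) (loglb _ _ (1611 / 6611) 1 (by norm_num) (by norm_num) (by norm_num) (by norm_num)) (by norm_num) (by norm_num) (by norm_num)) (by norm_num)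
  have S4 := S3.step hF (37 / 1000) (1997563 / 500000) (8482 / 15625) (by norm_num) (by norm_num) (pt_node (9 / 2) (3 / 5) (-1027 / 1000) (2007 / 500) (21 / 10) (37 / 1000) (1648419 / 500000) (-323191 / 2500000) (973 / 25000) (1 + (9 / 2) / 2) (589327 / 500000) (1997563 / 500000) (by norm_num) (by norm_num) (loglb' _ _ (23 / 273) 5 (by norm_num) (by norm_num) (by norm_num) (by norm_num)) (blB_1.mid blB_2 _ (1360914 / 1484815) _ (by norm_num) (by norm_num) (by norm_num) (by norm_num)) (by norm_num) (by norm_num) lhB (by norm_num) (by norm_num) (by norm_num)) (by norm_num)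
  have S5 := S4.step hF (6 / 125) (3901143 / 1000000) (293139 / 500000) (by norm_num) (by norm_num) (pt_node (9 / 2) (3 / 5) (-1027 / 1000) (2007 / 500) (21 / 10) (6 / 125) (607311 / 200000) (-198731 / 500000) (257277 / 1000000) (1 + (9 / 2) / 2) (589327 / 500000) (3901143 / 1000000) (by norm_num) (by norm_num) (loglb' _ _ (67 / 317) 5 (by norm_num) (by norm_num) (by norm_num) (by norm_num)) (blB_0.left _ _ (by norm_num) (by norm_num)) (by norm_num) (by norm_num) lhB (by norm_num) (by norm_num) (by norm_num)) (by norm_num)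
  have S6 := S5.step hF (943 / 1000) (308613 / 1000000) (38596 / 15625) (by norm_num) (by norm_num) (pt_node (9 / 2) (3 / 5) (-1027 / 1000) (2007 / 500) (21 / 10) (943 / 1000) (11739 / 200000) (-94591 / 250000) (238179 / 1000000) (2313 / 400) (1754819 / 1000000) (308613 / 1000000) (by norm_num) (by norm_num) (loglb' _ _ (443 / 1443) 1 (by norm_num) (by norm_num) (by norm_num) (by norm_num)) (blB_0.left _ _ (by norm_num) (by norm_num)) (by norm_num) (by norm_num) (loglb _ _ (713 / 3913) 2 (by norm_num) (by norm_num) (by norm_num) (by norm_num)) (by norm_num) (by norm_num) (by norm_num)) (by norm_num)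
  have S7 := S6.step hF (957 / 1000) (50953 / 200000) (309261 / 125000) (by norm_num) (by norm_num) (pt_node (9 / 2) (3 / 5) (-1027 / 1000) (2007 / 500) (21 / 10) (957 / 1000) (43959 / 1000000) (-212407 / 625000) (101007 / 500000) (59619 / 10000) (8926867 / 5000000) (50953 / 200000) (by norm_num) (by norm_num) (loglb' _ _ (457 / 1457) 1 (by norm_num) (by norm_num) (by norm_num) (by norm_num)) (blB_0.mid blB_1 _ (74863 / 524290) _ (by norm_num) (by norm_num) (by norm_num) (by norm_num)) (by norm_num) (by norm_num) (loglb _ _ (19619 / 99619) 2 (by norm_num) (by norm_num) (by norm_num) (by norm_num)) (by norm_num) (by norm_num) (by norm_num)) (by norm_num)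
  have S8 := S7.step hF (971 / 1000) (109259 / 200000) (154981 / 62500) (by norm_num) (by norm_num) (pt_node (9 / 2) (3 / 5) (-1027 / 1000) (2007 / 500) (21 / 10) (971 / 1000) (14719 / 500000) (-752701 / 2500000) (83901 / 500000) (15369 / 2500) (2270071 / 1250000) (109259 / 200000) (by norm_num) (by norm_num) (loglb' _ _ (471 / 1471) 1 (by norm_num) (by norm_num) (by norm_num) (by norm_num)) (blB_0.mid blB_1 _ (440507 / 1048580) _ (by norm_num) (by norm_num) (by norm_num) (by norm_num)) (by norm_num) (by norm_num) (loglb _ _ (5369 / 25369) 2 (by norm_num) (by norm_num) (by norm_num) (by norm_num)) (by norm_num) (by norm_num) (by norm_num)) (by norm_num)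
  have S9 := S8.step hF 1 (6361 / 5000) (501213 / 200000) (by norm_num) (by norm_num) (pt_node (9 / 2) (3 / 5) (-1027 / 1000) (2007 / 500) (21 / 10) 1 0 (-11 / 50) (1504 / 15625) (4096 / 625) (47 / 25) (6361 / 5000) (by norm_num) (by norm_num) (by norm_num) (blB_1.mid blB_2 _ (12 / 296963) _ (by norm_num) (by norm_num) (by norm_num) (by norm_num)) (by norm_num) (by norm_num) (loglb _ _ (399 / 1649) 2 (by norm_num) (by norm_num) (by norm_num) (by norm_num)) (by norm_num) (by norm_num) (by norm_num)) (by norm_num)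
  exact node_of S9 (by norm_num)

theorem node_g : NodeOK 5 (14 / 25) (-229 / 200) (473 / 125) (12 / 5) (10391 / 7500) := by
  have hF := Ft_convex 5 (14 / 25) (-229 / 200) (473 / 125) (12 / 5) (by norm_num) (by norm_num)
  have hl : Real.log (67 / 5000) ≤ -(69 / 16) := by
    have h : (69 / 16) ≤ Real.log ((67 / 5000))⁻¹ := (loglb _ _ (89 / 1161) 6 (by norm_num) (by norm_num) (by norm_num) (by norm_num))
    rw [Real.log_inv] at h
    linarith
  have hb : IB (Ft 5 (14 / 25) (-229 / 200) (473 / 125) (12 / 5)) 0 (67 / 5000) (374099 / 1000000) := tail_node 5 (14 / 25) (-229 / 200) (473 / 125) (12 / 5) (-218993 / 3000000) (3883 / 120000) (1252763 / 1000000) (67 / 5000) (4312503 / 1000000) (69 / 16) (6611 / 12500) (20727 / 20000) (2999 / 20000) (374099 / 1000000)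
    (by norm_num) (by norm_num) (by norm_num) blC_3 luC (by norm_num) (loglb' _ _ (447 / 1697) 7 (by norm_num) (by norm_num) (by norm_num) (by norm_num)) hl (by norm_num) (by norm_num) (by norm_num)
    (loglb' _ _ (361 / 12861) 1 (by norm_num) (by norm_num) (by norm_num) (by norm_num)) (by norm_num) (by norm_num) (loglb _ _ (727 / 40727) 0 (by norm_num) (by norm_num) (by norm_num) (by norm_num)) (by norm_num)
    (loglb' _ _ (499 / 5499) 3 (by norm_num) (by norm_num) (by norm_num) (by norm_num)) (by norm_num) (by norm_num)
  have S0 : St (Ft 5 (14 / 25) (-229 / 200) (473 / 125) (12 / 5)) (67 / 5000) (127319 / 12500) (374099 / 1000000) := ⟨hb, (pt_node 5 (14 / 25) (-229 / 200) (473 / 125) (12 / 5) (67 / 5000) (4312503 / 1000000) (4523181 / 6250000) (1003973 / 250000) (61331 / 10000) (22671241 / 12500000) (127319 / 12500) (by norm_num) (by norm_num) (loglb' _ _ (447 / 1697) 7 (by norm_num) (by norm_num) (by norm_num) (by norm_num)) (blC_3.right _ _ (by norm_num) (by norm_num)) (by norm_num) (by norm_num) (loglb _ _ (21331 / 101331)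 2 (by norm_num) (by norm_num) (by norm_num) (by norm_num)) (by norm_num) (by norm_num) (by norm_num))⟩
  have S1 := S0.step hF (2 / 125) (8607287 / 1000000) (39853 / 100000) (by norm_num) (by norm_num) (pt_node 5 (14 / 25) (-229 / 200) (473 / 125) (12 / 5) (2 / 125) (4135167 / 1000000) (3343319 / 6250000) (1536001 / 500000) (55919 / 10000) (21516469 / 12500000) (8607287 / 1000000) (by norm_num) (by norm_num) (loglb' _ _ (3 / 253) 6 (by norm_num) (by norm_num) (by norm_num) (by norm_num)) (blC_3.right _ _ (by norm_num) (by norm_num)) (by norm_num) (by norm_num) (loglb _ _ (15919 / 95919) 2 (by norm_num) (by norm_num) (by norm_num) (by norm_num)) (by norm_num) (by norm_num) (by norm_num)) (by norm_num)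
  have S2 := S1.step hF (1 / 50) (3387787 / 500000) (26831 / 62500) (by norm_num) (by norm_num) (pt_node 5 (14 / 25) (-229 / 200) (473 / 125) (12 / 5) (1 / 50) (489003 / 125000) (937959 / 3125000) (949041 / 500000) (49879 / 10000) (5021917 / 3125000) (3387787 / 500000) (by norm_num) (by norm_num) (loglb' _ _ (7 / 57) 6 (by norm_num) (by norm_num) (by norm_num) (by norm_num)) (blC_3.right _ _ (by norm_num) (by norm_num)) (by norm_num) (by norm_num) (loglb _ _ (9879 / 89879) 2 (by norm_num) (by norm_num) (by norm_num) (by norm_num)) (by norm_num) (by norm_num) (by norm_num)) (by norm_num)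
  have S3 := S2.step hF (1 / 40) (5098331 / 1000000) (458981 / 1000000) (by norm_num) (by norm_num) (pt_node 5 (14 / 25) (-229 / 200) (473 / 125) (12 / 5) (1 / 40) (46111 / 12500) (5402 / 78125) (29723 / 40000) (4461 / 1000) (116826 / 78125) (5098331 / 1000000) (by norm_num) (by norm_num) (loglb' _ _ (3 / 13) 6 (by norm_num) (by norm_num) (by norm_num) (by norm_num)) (blC_3.right _ _ (by norm_num) (by norm_num)) (by norm_num) (by norm_num) (loglb _ _ (461 / 8461) 2 (by norm_num) (by norm_num) (by norm_num) (by norm_num)) (by norm_num) (by norm_num) (by norm_num)) (by norm_num)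
  have S4 := S3.step hF (29 / 1000) (4060457 / 1000000) (477299 / 1000000) (by norm_num) (by norm_num) (pt_node 5 (14 / 25) (-229 / 200) (473 / 125) (12 / 5) (29 / 1000) (708093 / 200000) (-102429 / 1250000) (32609 / 1000000) (41493 / 10000) (3557291 / 2500000) (4060457 / 1000000) (by norm_num) (by norm_num) (loglb' _ _ (107 / 357) 6 (by norm_num) (by norm_num) (by norm_num) (by norm_num)) (blC_2.mid blC_3 _ (586097 / 720280) _ (by norm_num) (by norm_num) (by norm_num) (by norm_num)) (by norm_num) (by norm_num) (loglb _ _ (1493 / 81493) 2 (by norm_num) (by norm_num) (by norm_num) (by norm_num)) (by norm_num) (by norm_num) (by norm_num)) (by norm_num)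
  have S5 := S4.step hF (31 / 1000) (3942059 / 1000000) (242651 / 500000) (by norm_num) (by norm_num) (pt_node 5 (14 / 25) (-229 / 200) (473 / 125) (12 / 5) (31 / 1000) (173689 / 50000) (-23291 / 156250) (2057 / 40000) (8037 / 2000) (869313 / 625000) (3942059 / 1000000) (by norm_num) (by norm_num) (loglb' _ _ (123 / 373) 6 (by norm_num) (by norm_num) (by norm_num) (by norm_num)) (blC_1.mid blC_2 _ (1064124 / 1484815) _ (by norm_num) (by norm_num) (by norm_num) (by norm_num)) (by norm_num) (by norm_num) (loglb _ _ (37 / 16037) 2 (by norm_num) (by norm_num) (by norm_num) (by norm_num)) (by norm_num) (by norm_num) (by norm_num)) (by norm_num)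
  have S6 := S5.step hF (1 / 25) (241591 / 62500) (130109 / 250000) (by norm_num) (by norm_num) (pt_node 5 (14 / 25) (-229 / 200) (473 / 125) (12 / 5) (1 / 25) (804719 / 250000) (-1251559 / 3125000) (130157 / 500000) (7137 / 2000) (496926 / 390625) (241591 / 62500) (by norm_num) (by norm_num) (loglb' _ _ (7 / 57) 5 (by norm_num) (by norm_num) (by norm_num) (by norm_num)) (blC_0.left _ _ (by norm_num) (by norm_num)) (by norm_num) (by norm_num) (loglb _ _ (3137 / 11137) 1 (by norm_num) (by norm_num) (by norm_num) (by norm_num)) (by norm_num) (by norm_num) (by norm_num)) (by norm_num)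
  have S7 := S6.step hF (241 / 250) (4613 / 12500) (1238387 / 500000) (by norm_num) (by norm_num) (pt_node 5 (14 / 25) (-229 / 200) (473 / 125) (12 / 5) (241 / 250) (573 / 15625) (-1462973 / 3125000) (327967 / 1000000) (35201 / 5000) (6098851 / 3125000) (4613 / 12500) (by norm_num) (by norm_num) (loglb' _ _ (58 / 183) 1 (by norm_num) (by norm_num) (by norm_num) (by norm_num)) (blC_0.left _ _ (by norm_num) (by norm_num)) (by norm_num) (by norm_num) (loglb _ _ (15201 / 55201) 2 (by norm_num) (by norm_num) (by norm_num) (by norm_num)) (by norm_num) (by norm_num) (by norm_num)) (by norm_num)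
  have S8 := S7.step hF (971 / 1000) (237403 / 500000) (154983 / 62500) (by norm_num) (by norm_num) (pt_node 5 (14 / 25) (-229 / 200) (473 / 125) (12 / 5) (971 / 1000) (14719 / 500000) (-1405517 / 3125000) (309581 / 1000000) (35719 / 5000) (12288933 / 6250000) (237403 / 500000) (by norm_num) (by norm_num) (loglb' _ _ (471 / 1471) 1 (by norm_num) (by norm_num) (by norm_num) (by norm_num)) (blC_0.left _ _ (by norm_num) (by norm_num)) (by norm_num) (by norm_num) (loglb _ _ (15719 / 55719) 2 (by norm_num) (by norm_num) (by norm_num) (by norm_num)) (by norm_num) (by norm_num) (by norm_num)) (by norm_num)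
  have S9 := S8.step hF 1 (1295467 / 1000000) (2505397 / 1000000) (by norm_num) (by norm_num) (pt_node 5 (14 / 25) (-229 / 200) (473 / 125) (12 / 5) 1 0 (-373 / 1000) (46563 / 200000) (37957 / 5000) (2027 / 1000) (1295467 / 1000000) (by norm_num) (by norm_num) (by norm_num) (blC_0.left _ _ (by norm_num) (by norm_num)) (by norm_num) (by norm_num) (loglb _ _ (17957 / 57957) 2 (by norm_num) (by norm_num) (by norm_num) (by norm_num)) (by norm_num) (by norm_num) (by norm_num)) (by norm_num)
  exact node_of S9 (by norm_num)

theorem node_h : NodeOK 5 (7 / 10) (-177 / 125) (247 / 50) (12 / 5) (52427 / 30000) := by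
  have hF := Ft_convex 5 (7 / 10) (-177 / 125) (247 / 50) (12 / 5) (by norm_num) (by norm_num)
  have hl : Real.log (8 / 625) ≤ -(435831 / 100000) := by
    have h : (435831 / 100000) ≤ Real.log ((8 / 625))⁻¹ := (loglb _ _ (113 / 1137) 6 (by norm_num) (by norm_num) (by norm_num) (by norm_num))
    rw [Real.log_inv] at h
    linarith
  have hb : IB (Ft 5 (7 / 10) (-177 / 125) (247 / 50) (12 / 5)) 0 (8 / 625) (95009 / 200000) := tail_node 5 (7 / 10) (-177 / 125) (247 / 50) (12 / 5) (-218993 / 3000000) (3883 / 120000) (1252763 / 1000000) (8 / 625) (4358311 / 1000000) (435831 / 100000) (5657 / 25000) (26159 / 25000) (541 / 2000) (95009 / 200000)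
    (by norm_num) (by norm_num) (by norm_num) blC_3 luC (by norm_num) (loglb' _ _ (399 / 1649) 7 (by norm_num) (by norm_num) (by norm_num) (by norm_num)) hl (by norm_num) (by norm_num) (by norm_num)
    (loglb' _ _ (1266 / 4391) 3 (by norm_num) (by norm_num) (by norm_num) (by norm_num)) (by norm_num) (by norm_num) (loglb _ _ (1159 / 51159) 0 (by norm_num) (by norm_num) (by norm_num) (by norm_num)) (by norm_num)
    (loglb' _ _ (41 / 1041) 2 (by norm_num) (by norm_num) (by norm_num) (by norm_num)) (by norm_num) (by norm_num)
  have S0 : St (Ft 5 (7 / 10) (-177 / 125) (247 / 50) (12 / 5)) (8 / 625) (2849683 / 250000) (95009 / 200000) := ⟨hb, (pt_node 5 (7 / 10) (-177 / 125) (247 / 50) (12 / 5) (8 / 625) (4358311 / 1000000) (4394337 / 5000000) (1197921 / 250000) (10007 / 2000) (16101297 / 10000000) (2849683 / 250000) (by norm_num) (by norm_num) (loglb' _ _ (399 / 1649) 7 (by norm_num) (by norm_num) (by norm_num) (by norm_num)) (blC_3.right _ _ (by norm_num) (by norm_num)) (by norm_num) (by norm_num) (loglb _ _ (2007 / 18007)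 2 (by norm_num) (by norm_num) (by norm_num) (by norm_num)) (by norm_num) (by norm_num) (by norm_num))⟩
  have S1 := S0.step hF (2 / 125) (289621 / 31250) (31757 / 62500) (by norm_num) (by norm_num) (pt_node 5 (7 / 10) (-177 / 125) (247 / 50) (12 / 5) (2 / 125) (4135167 / 1000000) (2911369 / 5000000) (827179 / 250000) (43287 / 10000) (14652569 / 10000000) (289621 / 31250) (by norm_num) (by norm_num) (loglb' _ _ (3 / 253) 6 (by norm_num) (by norm_num) (by norm_num) (by norm_num)) (blC_3.right _ _ (by norm_num) (by norm_num)) (by norm_num) (by norm_num) (loglb _ _ (3287 / 83287) 2 (by norm_num) (by norm_num) (by norm_num) (by norm_num)) (by norm_num) (by norm_num) (by norm_num)) (by norm_num)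
  have S2 := S1.step hF (9 / 500) (8227071 / 1000000) (525607 / 1000000) (by norm_num) (by norm_num) (pt_node 5 (7 / 10) (-177 / 125) (247 / 50) (12 / 5) (9 / 500) (502173 / 125000) (66759 / 156250) (506727 / 200000) (8029 / 2000) (1737361 / 1250000) (8227071 / 1000000) (by norm_num) (by norm_num) (loglb' _ _ (19 / 269) 6 (by norm_num) (by norm_num) (by norm_num) (by norm_num)) (blC_3.right _ _ (by norm_num) (by norm_num)) (by norm_num) (by norm_num) (loglb _ _ (29 / 16029) 2 (by norm_num) (by norm_num) (by norm_num) (by norm_num)) (by norm_num) (by norm_num) (by norm_num)) (by norm_num)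
  have S3 := S2.step hF (11 / 500) (6571603 / 1000000) (111041 / 200000) (by norm_num) (by norm_num) (pt_node 5 (7 / 10) (-177 / 125) (247 / 50) (12 / 5) (11 / 500) (3816713 / 1000000) (830391 / 5000000) (613869 / 500000) (35381 / 10000) (12635791 / 10000000) (6571603 / 1000000) (by norm_num) (by norm_num) (loglb' _ _ (51 / 301) 6 (by norm_num) (by norm_num) (by norm_num) (by norm_num)) (blC_3.right _ _ (by norm_num) (by norm_num)) (by norm_num) (by norm_num) (loglb _ _ (15381 / 55381) 1 (by norm_num) (by norm_num) (by norm_num) (by norm_num)) (by norm_num) (by norm_num) (by norm_num)) (by norm_num)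
  have S4 := S3.step hF (27 / 1000) (5089689 / 1000000) (584359 / 1000000) (by norm_num) (by norm_num) (pt_node 5 (7 / 10) (-177 / 125) (247 / 50) (12 / 5) (27 / 1000) (3611921 / 1000000) (-479653 / 5000000) (32999 / 1000000) (1 + 5 / 2) (31319 / 25000) (5089689 / 1000000) (by norm_num) (by norm_num) (loglb' _ _ (91 / 341) 6 (by norm_num) (by norm_num) (by norm_num) (by norm_num)) (blC_2.mid blC_3 _ (188143 / 360140) _ (by norm_num) (by norm_num) (by norm_num) (by norm_num)) (by norm_num) (by norm_num) lhC (by norm_num) (by norm_num) (by norm_num)) (by norm_num)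
  have S5 := S4.step hF (7 / 200) (1243229 / 250000) (62461 / 100000) (by norm_num) (by norm_num) (pt_node 5 (7 / 10) (-177 / 125) (247 / 50) (12 / 5) (7 / 200) (419051 / 125000) (-524661 / 1250000) (34943 / 125000) (1 + 5 / 2) (31319 / 25000) (1243229 / 250000) (by norm_num) (by norm_num) (loglb' _ _ (3 / 53) 5 (by norm_num) (by norm_num) (by norm_num) (by norm_num)) (blC_0.left _ _ (by norm_num) (by norm_num)) (by norm_num) (by norm_num) lhC (by norm_num) (by norm_num) (by norm_num)) (by norm_num)
  have S6 := S5.step hF (241 / 250) (76731 / 200000) (1556369 / 500000) (by norm_num) (by norm_num) (pt_node 5 (7 / 10) (-177 / 125) (247 / 50) (12 / 5) (241 / 250) (573 / 15625) (-36914 / 78125) (166157 / 500000) (17611 / 2500) (152518 / 78125) (76731 / 200000) (by norm_num) (by norm_num) (loglb' _ _ (58 / 183) 1 (by norm_num) (by norm_num) (by norm_num) (by norm_num)) (blC_0.left _ _ (by norm_num) (by norm_num)) (by norm_num) (by norm_num) (loglb _ _ (7611 / 27611) 2 (by norm_num) (by norm_num) (by norm_num) (by norm_num)) (by norm_num) (by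 norm_num) (by norm_num)) (by norm_num)
  have S7 := S6.step hF (971 / 1000) (26671 / 50000) (778987 / 250000) (by norm_num) (by norm_num) (pt_node 5 (7 / 10) (-177 / 125) (247 / 50) (12 / 5) (971 / 1000) (14719 / 500000) (-1120117 / 2500000) (153931 / 500000) (71847 / 10000) (9859733 / 5000000) (26671 / 50000) (by norm_num) (by norm_num) (loglb' _ _ (471 / 1471) 1 (by norm_num) (by norm_num) (by norm_num) (by norm_num)) (blC_0.left _ _ (by norm_num) (by norm_num)) (by norm_num) (by norm_num) (loglb _ _ (31847 / 111847) 2 (by norm_num) (by norm_num) (by norm_num) (by norm_num)) (by norm_num) (by norm_num) (by norm_num)) (by norm_num)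
  have S8 := S7.step hF (493 / 500) (275143 / 250000) (3128203 / 1000000) (by norm_num) (by norm_num) (pt_node 5 (7 / 10) (-177 / 125) (247 / 50) (12 / 5) (493 / 500) (1411 / 100000) (-197703 / 500000) (255221 / 1000000) (74957 / 10000) (2014317 / 1000000) (275143 / 250000) (by norm_num) (by norm_num) (loglb' _ _ (243 / 743) 1 (by norm_num) (by norm_num) (by norm_num) (by norm_num)) (blC_0.left _ _ (by norm_num) (by norm_num)) (by norm_num) (by norm_num) (loglb _ _ (34957 / 114957) 2 (by norm_num) (by norm_num) (by norm_num) (by norm_num)) (by norm_num) (by norm_num) (by norm_num)) (by norm_num)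
  have S9 := S8.step hF 1 (1657067 / 1000000) (3147507 / 1000000) (by norm_num) (by norm_num) (pt_node 5 (7 / 10) (-177 / 125) (247 / 50) (12 / 5) 1 0 (-173 / 500) (2593 / 12500) (9749 / 1250) (1027 / 500) (1657067 / 1000000) (by norm_num) (by norm_num) (by norm_num) (blC_0.mid blC_1 _ (797 / 8066) _ (by norm_num) (by norm_num) (by norm_num) (by norm_num)) (by norm_num) (by norm_num) (loglb _ _ (4749 / 14749) 2 (by norm_num) (by norm_num) (by norm_num) (by norm_num)) (by norm_num) (by norm_num) (by norm_num)) (by norm_num)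
  exact node_of S9 (by norm_num)

theorem node_i : NodeOK 6 (13 / 20) (-1571 / 1000) (581 / 125) (14 / 5) (111559 / 60000) := by
  have hF := Ft_convex 6 (13 / 20) (-1571 / 1000) (581 / 125) (14 / 5) (by norm_num) (by norm_num)
  have hl : Real.log (37 / 2500) ≤ -(526641 / 125000) := by
    have h : (526641 / 125000) ≤ Real.log ((37 / 2500))⁻¹ := (loglb _ _ (33 / 1217) 6 (by norm_num) (by norm_num) (by norm_num) (by norm_num))
    rw [Real.log_inv] at h
    linarith
  have hb : IB (Ft 6 (13 / 20) (-1571 / 1000) (581 / 125) (14 / 5)) 0 (37 / 2500) (235929 / 500000) := tail_node 6 (13 / 20) (-1571 / 1000) (581 / 125) (14 / 5) (-85103 / 600000) (29309 / 500000) (277259 / 200000) (37 / 2500) (842627 / 200000) (526641 / 125000) (16727 / 50000) (2627 / 2500) (2861 / 12500) (235929 / 500000)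
    (by norm_num) (by norm_num) (by norm_num) blD_2 luD (by norm_num) (loglb' _ _ (559 / 1809) 7 (by norm_num) (by norm_num) (by norm_num) (by norm_num)) hl (by norm_num) (by norm_num) (by norm_num)
    (loglb' _ _ (4227 / 29227) 2 (by norm_num) (by norm_num) (by norm_num) (by norm_num)) (by norm_num) (by norm_num) (loglb _ _ (127 / 5127) 0 (by norm_num) (by norm_num) (by norm_num) (by norm_num)) (by norm_num)
    (loglb' _ _ (2597 / 8847) 3 (by norm_num) (by norm_num) (by norm_num) (by norm_num)) (by norm_num) (by norm_num)
  have S0 : St (Ft 6 (13 / 20) (-1571 / 1000) (581 / 125) (14 / 5)) (37 / 2500) (4455083 / 500000) (235929 / 500000) := ⟨hb, (pt_node 6 (13 / 20) (-1571 / 1000) (581 / 125) (14 / 5) (37 / 2500) (842627 / 200000) (3508659 / 10000000) (753711 / 250000) (54363 / 10000) (33861763 / 20000000) (4455083 / 500000) (by norm_num) (by norm_num) (loglb' _ _ (559 / 1809) 7 (by norm_num) (by norm_num) (by norm_num) (by norm_num)) (blD_2.right _ _ (by norm_num) (by norm_num)) (by norm_num) (by norm_num) (loglb _ _ (14363 /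 94363) 2 (by norm_num) (by norm_num) (by norm_num) (by norm_num)) (by norm_num) (by norm_num) (by norm_num))⟩
  have S1 := S0.step hF (17 / 1000) (3754441 / 500000) (489919 / 1000000) (by norm_num) (by norm_num) (pt_node 6 (13 / 20) (-1571 / 1000) (581 / 125) (14 / 5) (17 / 1000) (2037271 / 500000) (904603 / 5000000) (498793 / 250000) (50047 / 10000) (16103683 / 10000000) (3754441 / 500000) (by norm_num) (by norm_num) (loglb' _ _ (11 / 261) 6 (by norm_num) (by norm_num) (by norm_num) (by norm_num)) (blD_2.right _ _ (by norm_num) (by norm_num)) (by norm_num) (by norm_num) (loglb _ _ (10047 / 90047) 2 (by norm_num) (by norm_num) (by norm_num) (by norm_num)) (by norm_num) (by norm_num) (by norm_num)) (by norm_num)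
  have S2 := S1.step hF (1 / 50) (2982987 / 500000) (127533 / 250000) (by norm_num) (by norm_num) (pt_node 6 (13 / 20) (-1571 / 1000) (581 / 125) (14 / 5) (1 / 50) (489003 / 125000) (-20511 / 1250000) (202799 / 250000) (9097 / 2000) (3786939 / 2500000) (2982987 / 500000) (by norm_num) (by norm_num) (loglb' _ _ (7 / 57) 6 (by norm_num) (by norm_num) (by norm_num) (by norm_num)) (blD_2.right _ _ (by norm_num) (by norm_num)) (by norm_num) (by norm_num) (loglb _ _ (1097 / 17097) 2 (by norm_num) (by norm_num) (by norm_num) (by norm_num)) (by norm_num) (by norm_num) (by norm_num)) (by norm_num)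
  have S3 := S2.step hF (11 / 500) (5107269 / 1000000) (260603 / 500000) (by norm_num) (by norm_num) (pt_node 6 (13 / 20) (-1571 / 1000) (581 / 125) (14 / 5) (11 / 500) (3816713 / 1000000) (-1310171 / 10000000) (61773 / 500000) (43039 / 10000) (29190389 / 20000000) (5107269 / 1000000) (by norm_num) (by norm_num) (loglb' _ _ (51 / 301) 6 (by norm_num) (by norm_num) (by norm_num) (by norm_num)) (blD_2.right _ _ (by norm_num) (by norm_num)) (by norm_num) (by norm_num) (loglb _ _ (3039 / 83039) 2 (by norm_num) (by norm_num) (by norm_num) (by norm_num)) (by norm_num) (by norm_num) (by norm_num)) (by norm_num)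
  have S4 := S3.step hF (23 / 1000) (4982937 / 1000000) (131563 / 250000) (by norm_num) (by norm_num) (pt_node 6 (13 / 20) (-1571 / 1000) (581 / 125) (14 / 5) (23 / 1000) (1886131 / 500000) (-920777 / 5000000) (19749 / 250000) (20977 / 5000) (14339743 / 10000000) (4982937 / 1000000) (by norm_num) (by norm_num) (loglb' _ _ (59 / 309) 6 (by norm_num) (by norm_num) (by norm_num) (by norm_num)) (blD_1.mid blD_2 _ (537729 / 1172485) _ (by norm_num) (by norm_num) (by norm_num) (by norm_num)) (by norm_num) (by norm_num) (loglb _ _ (977 / 40977) 2 (by norm_num) (by norm_num) (by norm_num) (by norm_num)) (by norm_num) (by norm_num) (by norm_num)) (by norm_num)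
  have S5 := S4.step hF (27 / 1000) (123233 / 25000) (546077 / 1000000) (by norm_num) (by norm_num) (pt_node 6 (13 / 20) (-1571 / 1000) (581 / 125) (14 / 5) (27 / 1000) (3611921 / 1000000) (-3740067 / 10000000) (116911 / 500000) (1 + 6 / 2) (693147 / 500000) (123233 / 25000) (by norm_num) (by norm_num) (loglb' _ _ (91 / 341) 6 (by norm_num) (by norm_num) (by norm_num) (by norm_num)) (blD_0.left _ _ (by norm_num) (by norm_num)) (by norm_num) (by norm_num) lhD (by norm_num) (by norm_num) (by norm_num)) (by norm_num)
  have S6 := S5.step hF (971 / 1000) (67701 / 125000) (782089 / 250000) (by norm_num) (by norm_num) (pt_node 6 (13 / 20) (-1571 / 1000) (581 / 125) (14 / 5) (971 / 1000) (14719 / 500000) (-3217613 / 5000000) (251669 / 500000) (44013 / 5000) (21750427 / 10000000) (67701 / 125000) (by norm_num) (by norm_num) (loglb' _ _ (471 / 1471) 1 (by norm_num) (by norm_num) (by norm_num) (by norm_num)) (blD_0.left _ _ (by norm_num) (by norm_num)) (by norm_num) (by norm_num) (loglb _ _ (4013 / 84013) 3 (by norm_num) (by norm_num) (by norm_num) (by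 norm_num)) (by norm_num) (by norm_num) (by norm_num)) (by norm_num)
  have S7 := S6.step hF (979 / 1000) (740629 / 1000000) (626697 / 200000) (by norm_num) (by norm_num) (pt_node 6 (13 / 20) (-1571 / 1000) (581 / 125) (14 / 5) (979 / 1000) (10617 / 500000) (-3085019 / 5000000) (476819 / 1000000) (17987 / 2000) (21964941 / 10000000) (740629 / 1000000) (by norm_num) (by norm_num) (loglb' _ _ (479 / 1479) 1 (by norm_num) (by norm_num) (by norm_num) (by norm_num)) (blD_0.left _ _ (by norm_num) (by norm_num)) (by norm_num) (by norm_num) (loglb _ _ (1987 / 33987) 3 (by norm_num) (by norm_num) (by norm_num) (by norm_num)) (by norm_num) (by norm_num) (by norm_num)) (by norm_num)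
  have S8 := S7.step hF (993 / 1000) (1390717 / 1000000) (629681 / 200000) (by norm_num) (by norm_num) (pt_node 6 (13 / 20) (-1571 / 1000) (581 / 125) (14 / 5) (993 / 1000) (7037 / 1000000) (-5703879 / 10000000) (430203 / 1000000) (18677 / 2000) (44682761 / 20000000) (1390717 / 1000000) (by norm_num) (by norm_num) (loglb' _ _ (493 / 1493) 1 (by norm_num) (by norm_num) (by norm_num) (by norm_num)) (blD_0.left _ _ (by norm_num) (by norm_num)) (by norm_num) (by norm_num) (loglb _ _ (2677 / 34677) 3 (by norm_num) (by norm_num) (by norm_num) (by norm_num)) (by norm_num) (by norm_num) (by norm_num)) (by norm_num)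
  have S9 := S8.step hF 1 (8633 / 5000) (789829 / 250000) (by norm_num) (by norm_num) (pt_node 6 (13 / 20) (-1571 / 1000) (581 / 125) (14 / 5) 1 0 (-547 / 1000) (81363 / 200000) (95163 / 10000) (2253 / 1000) (8633 / 5000) (by norm_num) (by norm_num) (by norm_num) (blD_0.left _ _ (by norm_num) (by norm_num)) (by norm_num) (by norm_num) (loglb _ _ (15163 / 175163) 3 (by norm_num) (by norm_num) (by norm_num) (by norm_num)) (by norm_num) (by norm_num) (by norm_num)) (by norm_num)
  exact node_of S9 (by norm_num)

theorem node_j : NodeOK 6 (39 / 50) (-951 / 500) (587 / 100) (14 / 5) (11333 / 5000) := by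
  have hF := Ft_convex 6 (39 / 50) (-951 / 500) (587 / 100) (14 / 5) (by norm_num) (by norm_num)
  have hl : Real.log (11 / 1000) ≤ -(4509859 / 1000000) := by
    have h : (4509859 / 1000000) ≤ Real.log ((11 / 1000))⁻¹ := (loglb _ _ (37 / 213) 6 (by norm_num) (by norm_num) (by norm_num) (by norm_num))
    rw [Real.log_inv] at h
    linarith
  have hb : IB (Ft 6 (39 / 50) (-951 / 500) (587 / 100) (14 / 5)) 0 (11 / 1000) (528207 / 1000000) := tail_node 6 (39 / 50) (-951 / 500) (587 / 100) (14 / 5) (-85103 / 600000) (29309 / 500000) (277259 / 200000) (11 / 1000) (4509861 / 1000000) (4509859 / 1000000) (6521 / 50000) (13107 / 12500) (18539 / 50000) (528207 / 1000000)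
    (by norm_num) (by norm_num) (by norm_num) blD_2 luD (by norm_num) (loglb' _ _ (51 / 301) 7 (by norm_num) (by norm_num) (by norm_num) (by norm_num)) hl (by norm_num) (by norm_num) (by norm_num)
    (loglb' _ _ (271 / 12771) 3 (by norm_num) (by norm_num) (by norm_num) (by norm_num)) (by norm_num) (by norm_num) (loglb _ _ (607 / 25607) 0 (by norm_num) (by norm_num) (by norm_num) (by norm_num)) (by norm_num)
    (loglb' _ _ (6039 / 31039) 2 (by norm_num) (by norm_num) (by norm_num) (by norm_num)) (by norm_num) (by norm_num)
  have S0 : St (Ft 6 (39 / 50) (-951 / 500) (587 / 100) (14 / 5)) (11 / 1000) (1224729 / 100000) (528207 / 1000000) := ⟨hb, (pt_node 6 (39 / 50) (-951 / 500) (587 / 100) (14 / 5) (11 / 1000) (4509861 / 1000000) (17573829 / 25000000) (5127367 / 1000000) (9219 / 2000) (76405079 / 50000000) (1224729 / 100000) (by norm_num) (by norm_num) (loglb' _ _ (51 / 301) 7 (by norm_num) (by norm_num) (by norm_num) (by norm_num)) (blD_2.right _ _ (by norm_num) (by norm_num)) (by norm_num) (by norm_num) (loglb _ _ (1219 / 17219)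 2 (by norm_num) (by norm_num) (by norm_num) (by norm_num)) (by norm_num) (by norm_num) (by norm_num))⟩
  have S1 := S0.step hF (13 / 1000) (10410757 / 1000000) (275433 / 500000) (by norm_num) (by norm_num) (pt_node 6 (39 / 50) (-951 / 500) (587 / 100) (14 / 5) (13 / 1000) (4342807 / 1000000) (11352223 / 25000000) (1817091 / 500000) (20407 / 5000) (70320973 / 50000000) (10410757 / 1000000) (by norm_num) (by norm_num) (loglb' _ _ (83 / 333) 7 (by norm_num) (by norm_num) (by norm_num) (by norm_num)) (blD_2.right _ _ (by norm_num) (by norm_num)) (by norm_num) (by norm_num) (loglb _ _ (407 / 40407) 2 (by norm_num) (by norm_num) (by norm_num) (by norm_num)) (by norm_num) (by norm_num) (by norm_num)) (by norm_num)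
  have S2 := S1.step hF (2 / 125) (8247193 / 1000000) (578853 / 1000000) (by norm_num) (by norm_num) (pt_node 6 (39 / 50) (-951 / 500) (587 / 100) (14 / 5) (2 / 125) (4135167 / 1000000) (3694513 / 25000000) (449083 / 250000) (1 + 6 / 2) (693147 / 500000) (8247193 / 1000000) (by norm_num) (by norm_num) (loglb' _ _ (3 / 253) 6 (by norm_num) (by norm_num) (by norm_num) (by norm_num)) (blD_2.right _ _ (by norm_num) (by norm_num)) (by norm_num) (by norm_num) lhD (by norm_num) (by norm_num) (by norm_num)) (by norm_num)
  have S3 := S2.step hF (19 / 1000) (6476251 / 1000000) (600939 / 1000000) (by norm_num) (by norm_num) (pt_node 6 (39 / 50) (-951 / 500) (587 / 100) (14 / 5) (19 / 1000) (3963317 / 1000000) (-2567387 / 25000000) (73369 / 250000) (1 + 6 / 2) (693147 / 500000) (6476251 / 1000000) (by norm_num) (by norm_num) (loglb' _ _ (27 / 277) 6 (by norm_num) (by norm_num) (by norm_num) (by norm_num)) (blD_2.right _ _ (by norm_num) (by norm_num)) (by norm_num) (by norm_num) lhD (by norm_num) (by norm_num) (by norm_num)) (by norm_num)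
  have S4 := S3.step hF (1 / 50) (772279 / 125000) (607267 / 1000000) (by norm_num) (by norm_num) (pt_node 6 (39 / 50) (-951 / 500) (587 / 100) (14 / 5) (1 / 50) (489003 / 125000) (-552633 / 3125000) (37737 / 500000) (1 + 6 / 2) (693147 / 500000) (772279 / 125000) (by norm_num) (by norm_num) (loglb' _ _ (7 / 57) 6 (by norm_num) (by norm_num) (by norm_num) (by norm_num)) (blD_1.mid blD_2 _ (3237108 / 5862425) _ (by norm_num) (by norm_num) (by norm_num) (by norm_num)) (by norm_num) (by norm_num) lhD (by norm_num) (by norm_num) (by norm_num)) (by norm_num)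
  have S5 := S4.step hF (3 / 125) (191123 / 31250) (39491 / 62500) (by norm_num) (by norm_num) (pt_node 6 (39 / 50) (-951 / 500) (587 / 100) (14 / 5) (3 / 125) (1864851 / 500000) (-5472311 / 12500000) (186 / 625) (1 + 6 / 2) (693147 / 500000) (191123 / 31250) (by norm_num) (by norm_num) (loglb' _ _ (67 / 317) 6 (by norm_num) (by norm_num) (by norm_num) (by norm_num)) (blD_0.left _ _ (by norm_num) (by norm_num)) (by norm_num) (by norm_num) lhD (by norm_num) (by norm_num) (by norm_num)) (by norm_num)
  have S6 := S5.step hF (971 / 1000) (278523 / 500000) (3791513 / 1000000) (by norm_num) (by norm_num) (pt_node 6 (39 / 50) (-951 / 500) (587 / 100) (14 / 5) (971 / 1000) (14719 / 500000) (-4070667 / 6250000) (255561 / 500000) (21917 / 2500) (54274291 / 25000000) (278523 / 500000) (by norm_num) (by norm_num) (loglb' _ _ (471 / 1471) 1 (by norm_num) (by norm_num) (by norm_num) (by norm_num)) (blD_0.left _ _ (by norm_num) (by norm_num)) (by norm_num) (by norm_num) (loglb _ _ (1917 / 41917) 3 (by norm_num) (by norm_num) (by norm_num) (by norm_num)) (by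 norm_num) (by norm_num) (by norm_num)) (by norm_num)
  have S7 := S6.step hF (979 / 1000) (192709 / 250000) (151873 / 40000) (by norm_num) (by norm_num) (pt_node 6 (39 / 50) (-951 / 500) (587 / 100) (14 / 5) (979 / 1000) (10617 / 500000) (-964289 / 1562500) (2981 / 6250) (18033 / 2000) (54976313 / 25000000) (192709 / 250000) (by norm_num) (by norm_num) (loglb' _ _ (479 / 1479) 1 (by norm_num) (by norm_num) (by norm_num) (by norm_num)) (blD_0.left _ _ (by norm_num) (by norm_num)) (by norm_num) (by norm_num) (loglb _ _ (2033 / 34033) 3 (by norm_num) (by norm_num) (by norm_num) (by norm_num)) (by norm_num) (by norm_num) (by norm_num)) (by norm_num)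
  have S8 := S7.step hF (993 / 1000) (812677 / 500000) (3813599 / 1000000) (by norm_num) (by norm_num) (pt_node 6 (39 / 50) (-951 / 500) (587 / 100) (14 / 5) (993 / 1000) (7037 / 1000000) (-13927807 / 25000000) (416927 / 1000000) (47359 / 5000) (112415943 / 50000000) (812677 / 500000) (by norm_num) (by norm_num) (loglb' _ _ (493 / 1493) 1 (by norm_num) (by norm_num) (by norm_num) (by norm_num)) (blD_0.left _ _ (by norm_num) (by norm_num)) (by norm_num) (by norm_num) (loglb _ _ (7359 / 87359) 3 (by norm_num) (by norm_num) (by norm_num) (by norm_num)) (by norm_num) (by norm_num) (by norm_num)) (by norm_num)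
  have S9 := S8.step hF 1 (2071 / 1000) (3826537 / 1000000) (by norm_num) (by norm_num) (pt_node 6 (39 / 50) (-951 / 500) (587 / 100) (14 / 5) 1 0 (-527 / 1000) (77363 / 200000) (19417 / 2000) (2273 / 1000) (2071 / 1000) (by norm_num) (by norm_num) (by norm_num) (blD_0.left _ _ (by norm_num) (by norm_num)) (by norm_num) (by norm_num) (loglb _ _ (3417 / 35417) 3 (by norm_num) (by norm_num) (by norm_num) (by norm_num)) (by norm_num) (by norm_num) (by norm_num)) (by norm_num)
  exact node_of S9 (by norm_num)

end Sph

open MeasureTheory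
open scoped ENNReal Classical

namespace Sph

noncomputable def FA (h s : ℝ) : ℝ := (h + 1) * gk s - h * (131 / 50 * (1 - s)) - 7 / 5 * (1 - s) * phi h

theorem FA_convex (h : ℝ) (hh : -1 ≤ h) : ConvexOn ℝ (Set.Ioi 0) (FA h) := by
  refine (lin_convex (h + 1) (-(131 / 50) * h - 7 / 5 * phi h) (131 / 50 * h + 7 / 5 * phi h) (by linarith)).congr fun s _ => ?_
  simp only [FA]; ring

theorem pt_A_one : Pt FA 1 0 := by
  intro h hh
  simp [FA, gk]

theorem pt_A (s G X L m : ℝ) (hs : s ≤ 1) (hG : -G ≤ Real.log s) (hX : 0 < X) (hL : L ≤ Real.log X)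
    (hk : G - 131 / 50 * (1 - s) ≤ 7 / 5 * (1 - s) * L) (hm : G - (G - 131 / 50 * (1 - s)) - 7 / 5 * (1 - s) * L + 2 * (7 / 5 * (1 - s)) * (X - 1) ≤ m) : Pt FA s m := by
  intro h hh
  have hg : gk s ≤ G := by unfold gk; linarith
  have t := mul_le_mul_of_nonneg_left (phi_tan h X L hh hX hL) (by linarith : 0 ≤ 7 / 5 * (1 - s))
  have p := mul_le_mul_of_nonneg_left hg (by linarith : 0 ≤ h + 1)
  have p2 := mul_le_mul_of_nonneg_left hk (by linarith : 0 ≤ h + 1)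
  unfold FA
  linarith

theorem tail_A (s0 a0 Gl K E0 P c : ℝ) (hs0 : 0 < s0) (hs1 : s0 ≤ 1) (ha : a0 = 7 / 5 * (1 - s0)) (ha1 : 1 < a0) (hGl : Real.log s0 ≤ -Gl)
    (hK0 : 0 < K) (hK : -(131 / 50) / a0 ≤ Real.log K) (hE0 : 0 < E0) (hE1 : 1 ≤ E0) (hE : 131 / 50 / a0 * s0 ≤ Real.log E0) (hP0 : 0 < P)
    (hP : -((1 - 1 / a0) * Gl) ≤ Real.log P)
    (hc : 2 * a0 * K * (P / (1 - 1 / a0)) + 2 * a0 * K * ((E0 - 1) / s0) * (s0 * P / (2 - 1 / a0)) - (s0 + s0 * Gl)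
      + ((2 * (131 / 50) - 2 * a0) * s0 + (-2 * (131 / 50)) * (s0 ^ 2 / 2)) ≤ c) : IB FA 0 s0 c := by
  have ha0 : 0 < a0 := by linarith
  have inv1 : 1 / a0 < 1 := by rw [div_lt_one ha0]; exact ha1
  have hPP := rpow_le_of s0 (1 - 1 / a0) P Gl hs0 (by linarith) hP0 hGl hP
  have hEE := exp_le_of _ _ hE0 hE
  have hKK := exp_le_of _ _ hK0 hK
  set κ := (E0 - 1) / s0 with hκ
  have κ0 : 0 ≤ κ := div_nonneg (by linarith) hs0.le
  obtain ⟨ii, il⟩ := tail_int (1 - 1 / a0) (-(1 / a0)) (2 * a0 * K) (2 * a0 * K * κ) (-1) (2 * (131 / 50) - 2 * a0) (-2 * (131 / 50)) s0 Gl P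
    (by ring) (by linarith) hs0 (by positivity) (by positivity) (by linarith) hPP
  refine ⟨_, ?_, ii, ?_, il.trans (le_trans (le_of_eq ?_) hc)⟩
  · have := ker_gk.meas
    fun_prop
  · intro h s hh hs1 hs2
    have hexp : Real.exp ((gk s - 131 / 50 * (1 - s)) / a0) ≤ K * s ^ (-(1 / a0)) + K * κ * s ^ (1 - 1 / a0) := by
      have e0 : (gk s - 131 / 50 * (1 - s)) / a0 = 1 / a0 * gk s + 131 / 50 / a0 * s + -(131 / 50) / a0 := by field_simp; ring
      rw [e0, Real.exp_add, Real.exp_add]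
      have e1 : Real.exp (1 / a0 * gk s) = s ^ (-(1 / a0)) := by
        rw [Real.rpow_def_of_pos hs1]; unfold gk; congr 1; ring
      have e2 := chord_exp (131 / 50 / a0) s s0 E0 hs1.le hs0 hs2 hEE
      have e3 : s ^ (1 - 1 / a0) = s * s ^ (-(1 / a0)) := by
        rw [sub_eq_add_neg, Real.rpow_add hs1, Real.rpow_one]
      rw [e1, e3]
      have p0 : 0 ≤ s ^ (-(1 / a0)) := by positivity
      calc s ^ (-(1 / a0)) * Real.exp (131 / 50 / a0 * s) * Real.exp (-(131 / 50) / a0)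
          ≤ s ^ (-(1 / a0)) * (1 + κ * s) * K := by
            apply mul_le_mul (mul_le_mul_of_nonneg_left e2 p0) hKK (Real.exp_pos _).le
            have := hs1.le
            positivity
        _ = _ := by ring
    have yh := mul_le_mul_of_nonneg_left (young h ((gk s - 131 / 50 * (1 - s)) / a0) hh) ha0.le
    have e1 : a0 * (h * ((gk s - 131 / 50 * (1 - s)) / a0)) = h * (gk s - 131 / 50 * (1 - s)) := by field_simp
    have e2 : a0 * ((gk s - 131 / 50 * (1 - s)) / a0) = gk s - 131 / 50 * (1 - s) := by field_simp
    have hp := mul_le_mul_of_nonneg_right (by rw [ha]; linarith : a0 ≤ 7 / 5 * (1 - s)) (phi_nonneg h hh)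
    have hx := mul_le_mul_of_nonneg_left hexp (by linarith : 0 ≤ 2 * a0)
    show FA h s ≤ 2 * a0 * K * s ^ (-(1 / a0)) + 2 * a0 * K * κ * s ^ (1 - 1 / a0) + (-1) * gk s + (2 * (131 / 50) - 2 * a0 + -2 * (131 / 50) * s)
    unfold FA
    linarith
  · ring

theorem cert_A : ∃ M : ℝ → ℝ, Ker M ∧ (∀ h s, -1 ≤ h → 0 < s → s ≤ 1 → h * (gk s - 131 / 50 * (1 - s)) - 7 / 5 * (1 - s) * phi h ≤ M s) ∧ ∫ s in (0:ℝ)..1, M s ≤ 13 / 20 := by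
  have hl : Real.log (1 / 100) ≤ -(4605169 / 1000000) := by
    have h : (4605169 / 1000000) ≤ Real.log ((1 / 100))⁻¹ := (loglb _ _ (9 / 41) 6 (by norm_num) (by norm_num) (by norm_num) (by norm_num))
    rw [Real.log_inv] at h
    linarith
  have hb : IB FA 0 (1 / 100) (387013 / 1000000) := tail_A (1 / 100) (693 / 500) (4605169 / 1000000) (15103 / 100000) (101909 / 100000) (13867 / 50000) (387013 / 1000000) (by norm_num) (by norm_num) (by norm_num) (by norm_num) hl
    (by norm_num) (loglb' _ _ (2603 / 27603) 3 (by norm_num) (by norm_num) (by norm_num) (by norm_num)) (by norm_num) (by norm_num) (loglb _ _ (1909 / 201909) 0 (by norm_num) (by norm_num) (by norm_num) (by norm_num)) (by norm_num)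
    (loglb' _ _ (1367 / 26367) 2 (by norm_num) (by norm_num) (by norm_num) (by norm_num)) (by norm_num)
  have S0 : St FA (1 / 100) (9642157 / 1000000) (387013 / 1000000) := ⟨hb, (pt_A (1 / 100) (4605171 / 1000000) (42683 / 10000) (725603 / 500000) (9642157 / 1000000) (by norm_num) (loglb' _ _ (7 / 57) 7 (by norm_num) (by norm_num) (by norm_num) (by norm_num)) (by norm_num) (loglb _ _ (2683 / 82683) 2 (by norm_num) (by norm_num) (by norm_num) (by norm_num)) (by norm_num) (by norm_num))⟩
  have S1 := S0.step FA_convex (17 / 1000) (3252331 / 500000) (443527 / 1000000) (by norm_num) (by norm_num) (pt_A (17 / 1000) (2037271 / 500000) (14861 / 5000) (1089291 / 1000000) (3252331 / 500000) (by norm_num) (loglb' _ _ (11 / 261) 6 (by norm_num) (by norm_num) (by norm_num) (by norm_num)) (by norm_num) (loglb _ _ (4861 / 24861) 1 (by norm_num) (by norm_num) (by norm_num) (by norm_num)) (by norm_num) (by norm_num)) (by norm_num)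
  have S2 := S1.step FA_convex (27 / 1000) (941259 / 200000) (249791 / 500000) (by norm_num) (by norm_num) (pt_A (27 / 1000) (3611921 / 1000000) (10909 / 5000) (780107 / 1000000) (941259 / 200000) (by norm_num) (loglb' _ _ (91 / 341) 6 (by norm_num) (by norm_num) (by norm_num) (by norm_num)) (by norm_num) (loglb _ _ (909 / 20909) 1 (by norm_num) (by norm_num) (by norm_num) (by norm_num)) (by norm_num) (by norm_num)) (by norm_num)
  have S3 := S2.step FA_convex (43 / 1000) (3506431 / 1000000) (141321 / 250000) (by norm_num) (by norm_num) (pt_A (43 / 1000) (786639 / 250000) (8057 / 5000) (477099 / 1000000) (3506431 / 1000000) (by norm_num) (loglb' _ _ (47 / 297) 5 (by norm_num) (by norm_num) (by norm_num) (by norm_num)) (by norm_num) (loglb _ _ (3057 / 13057) 0 (by norm_num) (by norm_num) (by norm_num) (by norm_num)) (by norm_num) (by norm_num)) (by norm_num)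
  have S4 := S3.step FA_convex (17 / 250) (2737967 / 1000000) (643339 / 1000000) (by norm_num) (by norm_num) (pt_A (17 / 250) (336031 / 125000) (12079 / 10000) (11803 / 62500) (2737967 / 1000000) (by norm_num) (loglb' _ _ (11 / 261) 4 (by norm_num) (by norm_num) (by norm_num) (by norm_num)) (by norm_num) (loglb _ _ (2079 / 22079) 0 (by norm_num) (by norm_num) (by norm_num) (by norm_num)) (by norm_num) (by norm_num)) (by norm_num)
  have S5 := S4.step FA_convex (27 / 250) (139713 / 62500) (742807 / 1000000) (by norm_num) (by norm_num) (pt_A (27 / 250) (1112813 / 500000) (9147 / 10000) (-1394 / 15625) (139713 / 62500) (by norm_num) (loglb' _ _ (91 / 341) 4 (by norm_num) (by norm_num) (by norm_num) (by norm_num)) (by norm_num) (loglb' _ _ (4147 / 14147) 1 (by norm_num) (by norm_num) (by norm_num) (by norm_num)) (by norm_num) (by norm_num)) (by norm_num)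
  have S6 := S5.step FA_convex (171 / 1000) (946441 / 500000) (872849 / 1000000) (by norm_num) (by norm_num) (pt_A (171 / 1000) (441523 / 250000) (7049 / 10000) (-174861 / 500000) (946441 / 500000) (by norm_num) (loglb' _ _ (23 / 148) 3 (by norm_num) (by norm_num) (by norm_num) (by norm_num)) (by norm_num) (loglb' _ _ (2049 / 12049) 1 (by norm_num) (by norm_num) (by norm_num) (by norm_num)) (by norm_num) (by norm_num)) (by norm_num)
  have S7 := S6.step FA_convex (293 / 1000) (310129 / 200000) (216581 / 200000) (by norm_num) (by norm_num) (pt_A (293 / 1000) (1227583 / 1000000) (133 / 250) (-126239 / 200000) (310129 / 200000) (by norm_num) (loglb' _ _ (43 / 543) 2 (by norm_num) (by norm_num) (by norm_num) (by norm_num)) (by norm_num) (loglb' _ _ (4 / 129) 1 (by norm_num) (by norm_num) (by norm_num) (by norm_num)) (by norm_num) (by norm_num)) (by norm_num)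
  have S8 := S7.step FA_convex 1 0 (1631059 / 1000000) (by norm_num) (by norm_num) pt_A_one (by norm_num)
  obtain ⟨M, mm, ii, p, e⟩ := S8.1
  refine ⟨fun s => M s - gk s, ⟨mm.sub ker_gk.meas, ii.sub (gk_ii _ _)⟩, ?_, ?_⟩
  · intro h s hh hs hs1
    have := p h s hh hs hs1
    unfold FA at this
    simp only; linarith
  · rw [intervalIntegral.integral_sub ii (gk_ii _ _), int_gk]
    simp; linarith

end Sph

open MeasureTheory
open scoped ENNReal Classical

namespace Sph

variable {σ : Measure E3}

theorem RH_nonneg (f : E3 → ℝ) (H : ℝ) : 0 ≤ RH σ f H :=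
  integral_nonneg fun x => by simp

theorem int_min (h : Sph σ) {f : E3 → ℝ} (hf : Hyp σ f) (H : ℝ) (hH : 1 ≤ H) : Integrable (fun x => min (f x) H) σ := by
  have := h.prob
  refine ((hf.int.abs).add (integrable_const H)).mono' (hf.meas.min measurable_const).aestronglyMeasurable (Filter.Eventually.of_forall fun x => ?_)
  simp only [Pi.add_apply, Real.norm_eq_abs]
  have h1 := neg_abs_le (f x)
  have h2 := abs_nonneg (f x)
  rw [abs_le]
  constructor
  · apply le_min <;> linarith
  · exact (min_le_right _ _).trans (by linarith)

theorem RH_trans (h : Sph σ) {f : E3 → ℝ} (hf : Hyp σ f) (H H' : ℝ) (hH : 1 ≤ H) (hHH : H ≤ H') :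
    1 - RH σ f H' ≤ (1 - RH σ f H) * ((1 + H') / (1 + H)) := by
  have := h.prob
  have e : ∀ K, 1 ≤ K → 1 - RH σ f K = ∫ x, (1 + min (f x) K) ∂σ := by
    intro K hK
    unfold RH
    rw [integral_sub hf.int (int_min h hf K hK), hf.mean, integral_add (integrable_const 1) (int_min h hf K hK)]
    simp
  rw [e H hH, e H' (hH.trans hHH), ← integral_mul_const]
  have p : 0 < 1 + H := by linarith
  apply integral_mono ((integrable_const 1).add (int_min h hf H' (hH.trans hHH))) (((integrable_const 1).add (int_min h hf H hH)).mul_const _)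
  intro x
  have lb := hf.lb x
  simp only [Pi.add_apply]
  rw [← mul_div_assoc, le_div_iff₀ p]
  rcases le_total (f x) H with h1 | h1
  · rw [min_eq_left h1, min_eq_left (h1.trans hHH)]
    nlinarith
  · rw [min_eq_right h1]
    have := min_le_right (f x) H'
    nlinarith

theorem interp (h : Sph σ) {f : E3 → ℝ} (hf : Hyp σ f) {H R1 a1 b1 g1 c1 R2 a2 b2 g2 c2 : ℝ} (hH : 1 ≤ H)
    (n1 : NodeOK H R1 a1 b1 g1 c1) (n2 : NodeOK H R2 a2 b2 g2 c2) (h12 : R1 < R2) (hR : 0 < RH σ f H) (l1 : R1 ≤ RH σ f H) (l2 : RH σ f H ≤ R2)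
    (hc : ∀ l : ℝ, 0 ≤ l → l ≤ 1 → ((1 - l) * c1 + l * c2) - ((1 - l) * g1 + l * g2) * ((1 - l) * R1 + l * R2) - ((1 - l) * R1 + l * R2) ^ 2 / 6 ≤ 0) :
    ∫ x, f x * TT σ gk f x ∂σ ≤ ∫ x, phi (f x) ∂σ := by
  set l := (RH σ f H - R1) / (R2 - R1) with hl
  have p : 0 < R2 - R1 := by linarith
  have l0 : 0 ≤ l := div_nonneg (by linarith) p.le
  have l1' : l ≤ 1 := by rw [hl, div_le_one p]; linarith
  have n := n1.comb n2 (1 - l) l (by linarith) l0 (by ring)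
  have e : (1 - l) * R1 + l * R2 = RH σ f H := by rw [hl]; field_simp; ring
  rw [e] at n
  have c := coupling h hf hH hR n
  have hcl := hc l l0 l1'
  rw [e] at hcl
  linarith

theorem node_zero : NodeOK (33 / 10) 0 0 0 (11 / 10) 0 := by
  have lg : (974556 / 1000000 : ℝ) ≤ Real.log (1 + 33 / 10 / 2) := loglb _ _ (13 / 93) 1 (by norm_num) (by norm_num) (by norm_num) (by norm_num)
  have b := BL.tan (33 / 10) 0 0 (974556 / 1000000) 0 (by norm_num) (by norm_num) (by norm_num) (by simp) lg (by norm_num) (by norm_num)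
  have lg2 : (11 / 10 : ℝ) ≤ Real.log 3.0042 := loglb _ _ (5021 / 25021) 1 (by norm_num) (by norm_num) (by norm_num) (by norm_num)
  refine ⟨fun _ => 0, Ker.of_cont continuous_const, ?_, by simp⟩
  intro h s hh _ _
  unfold Ff
  rcases le_total h (33 / 10) with h1 | h1
  · rw [min_eq_left h1]
    have := b h hh h1
    unfold psi at this
    linarith
  · rw [min_eq_right h1]
    have := phi_tan h 3.0042 (11 / 10) hh (by norm_num) lg2
    norm_num at this ⊢
    linarith

theorem phi_min (h : ℝ) (hh : -1 ≤ h) : (min h (33 / 10)) ^ 2 / 6 ≤ phi h := by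
  have lg : (974556 / 1000000 : ℝ) ≤ Real.log (1 + 33 / 10 / 2) := loglb _ _ (13 / 93) 1 (by norm_num) (by norm_num) (by norm_num) (by norm_num)
  have b := BL.tan (33 / 10) 0 0 (974556 / 1000000) 0 (by norm_num) (by norm_num) (by norm_num) (by simp) lg (by norm_num) (by norm_num)
  rcases le_total h (33 / 10) with h1 | h1
  · rw [min_eq_left h1]
    have := b h hh h1
    unfold psi at this
    linarith
  · rw [min_eq_right h1]
    have := phi_tan h (1 + 33 / 10 / 2) _ hh (by norm_num) lg
    norm_num at this ⊢
    linarith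

theorem core_zero (h : Sph σ) {f : E3 → ℝ} (hf : Hyp σ f) (hR : RH σ f (33 / 10) = 0) :
    ∫ x, f x * TT σ gk f x ∂σ ≤ ∫ x, phi (f x) ∂σ := by
  have c := coupling0 h hf (H := 33 / 10) (by norm_num)
  rw [hR] at c
  have i6 : Integrable (fun x => f x - min (f x) (33 / 10)) σ := hf.int.sub (int_min h hf (33 / 10) (by norm_num))
  have r0 : (fun x => f x - min (f x) (33 / 10)) =ᵐ[σ] 0 := by
    rw [← integral_eq_zero_iff_of_nonneg (fun x => by simp) i6]
    exact hR
  have z : ∫ x, (f x - min (f x) (33 / 10)) * (TT σ gk (fun y => f y + min (f y) (33 / 10)) x + TT σ (fun s => 1 - 2 * s) (fun y => f y - min (f y) (33 / 10)) x) ∂σ = 0 := by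
    rw [← integral_zero E3 ℝ]
    apply integral_congr_ae
    filter_upwards [r0] with x hx
    have hx' : f x - min (f x) (33 / 10) = 0 := hx
    rw [hx']; simp
  rw [z] at c
  have m : (1/6) * ∫ x, (min (f x) (33 / 10)) ^ 2 ∂σ ≤ ∫ x, phi (f x) ∂σ := by
    rw [← integral_const_mul]
    apply integral_mono_of_nonneg (Filter.Eventually.of_forall fun x => by positivity) hf.ph
    refine Filter.Eventually.of_forall fun x => ?_
    have := phi_min (f x) (hf.lb x)
    simp only; linarith
  linarith

theorem phi_lower (h : ℝ) (hh : -1 ≤ h) : -(5382 / 10000) - 845 / 1000 * h + 3519 / 1000 * (h - min h 6) ≤ phi h := by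
  have l1 : (-(6932 / 10000) : ℝ) ≤ Real.log (1 / 2) := by
    have := Real.log_two_lt_d9
    rw [one_div, Real.log_inv]; linarith
  have l2 : (2674 / 1000 : ℝ) ≤ Real.log (29 / 2) := loglb _ _ (13 / 45) 3 (by norm_num) (by norm_num) (by norm_num) (by norm_num)
  rcases le_total h 6 with h1 | h1
  · rw [min_eq_left h1]
    have := phi_tan h _ _ hh (by norm_num) l1
    linarith
  · rw [min_eq_right h1]
    have := phi_tan h _ _ hh (by norm_num) l2
    linarith

theorem caseA (h : Sph σ) {f : E3 → ℝ} (hf : Hyp σ f) (hR : 78 / 100 ≤ RH σ f 6) :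
    ∫ x, f x * TT σ gk f x ∂σ ≤ ∫ x, phi (f x) ∂σ := by
  have := h.prob
  have hP : -(5382 / 10000) + 3519 / 1000 * RH σ f 6 ≤ ∫ x, phi (f x) ∂σ := by
    have i6 : Integrable (fun x => f x - min (f x) 6) σ := hf.int.sub (int_min h hf 6 (by norm_num))
    have i1 : Integrable (fun x => -(5382 / 10000) - 845 / 1000 * f x) σ := (integrable_const _).sub (hf.int.const_mul _)
    have le := integral_mono (i1.add (i6.const_mul (3519 / 1000))) hf.ph fun x => phi_lower (f x) (hf.lb x)
    simp only [Pi.add_apply] at le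
    rw [integral_add i1 (i6.const_mul _), integral_sub (integrable_const _) (hf.int.const_mul _), integral_const_mul, integral_const_mul, hf.mean] at le
    unfold RH
    simp only [integral_const, probReal_univ, smul_eq_mul] at le
    linarith
  obtain ⟨M, kM, bM, iM⟩ := cert_A
  have gf : Good σ f := hf.good h hf.meas 1 fun x => by rw [abs_le]; constructor <;> linarith [hf.lb x]
  have bT := gf.TT_bd h
  -- shift by one
  have one : ∫ x, TT σ gk f x ∂σ = 0 := by
    have s := gf.symm h (integrable_const (1:ℝ)) measurable_const
    have e : ∫ x, f x * TT σ gk (fun _ => (1:ℝ)) x ∂σ = ∫ x, f x ∂σ := by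
      apply integral_congr_ae
      filter_upwards [h.ae_norm] with x hx
      have : TT σ gk (fun _ => (1:ℝ)) x = 1 := by
        simp only [TT, mul_one]
        rw [h.integral_sv ker_gk.meas hx, int_gk]; simp
      rw [this, mul_one]
    rw [e, hf.mean] at s
    simpa using s
  have iT : Integrable (TT σ gk f) σ := bT.integrable h
  have iF : Integrable (fun x => f x * TT σ gk f x) σ := by
    have := bT.mul_integrable hf.int
    simpa only [mul_comm] using this
  have E1 : ∫ x, f x * TT σ gk f x ∂σ = ∫ x, (f x + 1) * TT σ gk f x ∂σ := by
    have : ∫ x, (f x + 1) * TT σ gk f x ∂σ = ∫ x, (f x * TT σ gk f x + TT σ gk f x) ∂σ := by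
      congr 1; ext x; ring
    rw [this, integral_add iF iT, one, add_zero]
  have bd1 : ∀ x, ‖x‖ = 1 → ∀ v : E3 → ℝ, Integrable v σ → Integrable (fun y => (1 - sv x y) * v y) σ := by
    intro x hx v hv
    refine hv.bdd_mul (c := 1) (by have := meas_sv x; fun_prop) ?_
    filter_upwards [h.sv_mem hx] with y hy
    rw [Real.norm_eq_abs, abs_le]; constructor <;> linarith [hy.1, hy.2]
  have pt : ∀ x, ‖x‖ = 1 → TT σ gk f x ≤ 7 / 5 * TT σ (fun s => 1 - s) (fun y => phi (f y)) x + 13 / 20 := by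
    intro x hx
    obtain ⟨_, hC⟩ := gf.pot
    have a1 := (hC x hx).1
    have a2 := bd1 x hx f hf.int
    have a3 := bd1 x hx _ hf.ph
    have z : ∫ y, (1 - sv x y) * f y ∂σ = 0 := by
      have b := hf.bary x
      have e : ∀ y, (1 - sv x y) * f y = 1 / 2 * f y + 1 / 2 * (inner ℝ x y * f y) := by
        intro y; rw [inner_eq_sv]; ring
      have ib : Integrable (fun y => inner ℝ x y * f y) σ := by
        refine (((a2.const_mul 2).sub hf.int)).congr (Filter.Eventually.of_forall fun y => ?_)
        simp only [Pi.sub_apply]; rw [inner_eq_sv]; ring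
      simp only [e]
      rw [integral_add (hf.int.const_mul _) (ib.const_mul _), integral_const_mul, integral_const_mul, b, hf.mean]; simp
    have le : ∫ y, (gk (sv x y) * f y - 131 / 50 * ((1 - sv x y) * f y)) ∂σ ≤ ∫ y, (7 / 5 * ((1 - sv x y) * phi (f y)) + M (sv x y)) ∂σ := by
      apply integral_mono_ae (a1.sub (a2.const_mul _)) ((a3.const_mul _).add (h.integrable_sv kM hx))
      filter_upwards [sv_pos_ae h hx] with y hy
      have := bM (f y) (sv x y) (hf.lb y) hy.1 hy.2
      simp only [Pi.add_apply, Pi.sub_apply]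
      linarith
    rw [integral_sub a1 (a2.const_mul _), integral_const_mul, z, integral_add (a3.const_mul _) (h.integrable_sv kM hx), integral_const_mul, h.integral_sv kM.meas hx] at le
    simp only [TT]
    linarith
  -- Fubini
  have kt : Ker (fun s : ℝ => 1 - s) := Ker.of_cont (by fun_prop)
  have hp : Integrable (fun p : E3 × E3 => (f p.1 + 1) * ((1 - sv p.1 p.2) * phi (f p.2))) (σ.prod σ) := by
    have h1 : Integrable (fun p : E3 × E3 => (f p.1 + 1) * phi (f p.2)) (σ.prod σ) := (hf.int.add (integrable_const 1)).mul_prod hf.ph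
    have h2 : Integrable (fun p : E3 × E3 => (1 - sv p.1 p.2) * ((f p.1 + 1) * phi (f p.2))) (σ.prod σ) := by
      refine h1.bdd_mul (c := 1) (kt.meas.comp meas_sv2).aestronglyMeasurable ?_
      have a1 : ∀ᵐ p ∂(σ.prod σ), ‖p.1‖ = 1 := Measure.quasiMeasurePreserving_fst.ae h.ae_norm
      have a2 : ∀ᵐ p ∂(σ.prod σ), ‖p.2‖ = 1 := Measure.quasiMeasurePreserving_snd.ae h.ae_norm
      filter_upwards [a1, a2] with p h1 h2
      have := abs_real_inner_le_norm p.1 p.2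
      rw [h1, h2, inner_eq_sv, abs_le] at this
      rw [Real.norm_eq_abs, abs_le]; constructor <;> linarith [this.1, this.2]
    refine h2.congr (Filter.Eventually.of_forall fun p => ?_)
    simp only; ring
  have fub : ∫ x, (f x + 1) * TT σ (fun s => 1 - s) (fun y => phi (f y)) x ∂σ = 1 / 2 * ∫ x, phi (f x) ∂σ := by
    simp only [TT, ← integral_const_mul]
    rw [integral_integral_swap hp]
    apply integral_congr_ae
    filter_upwards [h.ae_norm] with y hy
    have e : ∀ x, (f x + 1) * ((1 - sv x y) * phi (f y)) = ((1 - sv y x) * f x + (1 - sv y x)) * phi (f y) := by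
      intro x; rw [sv_comm x y]; ring
    simp only [e]
    rw [integral_mul_const, integral_add (bd1 y hy f hf.int) (h.integrable_sv kt hy), h.integral_sv kt.meas hy]
    have a2 := bd1 y hy f hf.int
    have z : ∫ x, (1 - sv y x) * f x ∂σ = 0 := by
      have b := hf.bary y
      have e : ∀ x, (1 - sv y x) * f x = 1 / 2 * f x + 1 / 2 * (inner ℝ y x * f x) := by
        intro x; rw [inner_eq_sv]; ring
      have ib : Integrable (fun x => inner ℝ y x * f x) σ := by
        refine (((a2.const_mul 2).sub hf.int)).congr (Filter.Eventually.of_forall fun x => ?_)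
        simp only [Pi.sub_apply]; rw [inner_eq_sv]; ring
      simp only [e]
      rw [integral_add (hf.int.const_mul _) (ib.const_mul _), integral_const_mul, integral_const_mul, b, hf.mean]; simp
    rw [z, zero_add]
    congr 1
    rw [intervalIntegral.integral_sub (by simp) (by simp)]
    simp; norm_num
  have iV : Integrable (fun x => (f x + 1) * TT σ (fun s => 1 - s) (fun y => phi (f y)) x) σ := by
    have := hp.integral_prod_left
    refine this.congr (Filter.Eventually.of_forall fun x => ?_)
    simp only [TT]
    rw [integral_const_mul]
  have fin : ∫ x, (f x + 1) * TT σ gk f x ∂σ ≤ ∫ x, (7 / 5 * ((f x + 1) * TT σ (fun s => 1 - s) (fun y => phi (f y)) x) + 13 / 20 * (f x + 1)) ∂σ := by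
    have i1 : Integrable (fun x => (f x + 1) * TT σ gk f x) σ := by
      refine (iF.add iT).congr (Filter.Eventually.of_forall fun x => ?_)
      simp only [Pi.add_apply]; ring
    apply integral_mono_ae i1 ((iV.const_mul _).add ((hf.int.add (integrable_const 1)).const_mul _))
    filter_upwards [h.ae_norm] with x hx
    have := mul_le_mul_of_nonneg_left (pt x hx) (by linarith [hf.lb x] : 0 ≤ f x + 1)
    simp only [Pi.add_apply]
    linarith
  rw [integral_add (iV.const_mul _) (by exact (hf.int.add (integrable_const 1)).const_mul _), integral_const_mul, integral_const_mul, fub, integral_add hf.int (integrable_const 1), hf.mean] at fin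
  simp only [integral_const, probReal_univ, smul_eq_mul] at fin
  rw [E1]
  linarith

theorem core (h : Sph σ) {f : E3 → ℝ} (hf : Hyp σ f) :
    ∫ x, f x * TT σ gk f x ∂σ ≤ ∫ x, phi (f x) ∂σ := by
  rcases eq_or_lt_of_le (RH_nonneg (σ := σ) f (33 / 10)) with h0 | h0
  · exact core_zero h hf h0.symm
  rcases le_or_gt (RH σ f (33 / 10)) (3 / 10) with h1 | h1
  · refine interp h hf (by norm_num) node_zero node_a (by norm_num) h0 h0.le h1 ?_
    intro l l0 l1
    nlinarith
  rcases le_or_gt (RH σ f (33 / 10)) (1 / 2) with h2 | h2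
  · refine interp h hf (by norm_num) node_b node_c (by norm_num) h0 h1.le h2 ?_
    intro l l0 l1
    nlinarith
  have t1 := RH_trans h hf (33 / 10) (9 / 2) (by norm_num) (by norm_num)
  have r1 : 9 / 25 ≤ RH σ f (9 / 2) := by norm_num at t1; linarith
  rcases le_or_gt (RH σ f (9 / 2)) (1 / 2) with h3 | h3
  · refine interp h hf (by norm_num) node_d node_e (by norm_num) (by linarith) r1 h3 ?_
    intro l l0 l1
    nlinarith
  rcases le_or_gt (RH σ f (9 / 2)) (3 / 5) with h4 | h4
  · refine interp h hf (by norm_num) node_e node_f (by norm_num) (by linarith) h3.le h4 ?_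
    intro l l0 l1
    nlinarith
  have t2 := RH_trans h hf (9 / 2) 5 (by norm_num) (by norm_num)
  have r2 : 14 / 25 ≤ RH σ f 5 := by norm_num at t2; linarith
  rcases le_or_gt (RH σ f 5) (7 / 10) with h5 | h5
  · refine interp h hf (by norm_num) node_g node_h (by norm_num) (by linarith) r2 h5 ?_
    intro l l0 l1
    nlinarith
  have t3 := RH_trans h hf 5 6 (by norm_num) (by norm_num)
  have r3 : 13 / 20 ≤ RH σ f 6 := by norm_num at t3; linarith
  rcases le_or_gt (RH σ f 6) (39 / 50) with h6 | h6
  · refine interp h hf (by norm_num) node_i node_j (by norm_num) (by linarith) r3 h6 ?_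
    intro l l0 l1
    nlinarith
  exact caseA h hf (by linarith)

end Sph

open MeasureTheory
open scoped ENNReal Classical

namespace Sph

variable {σ : Measure E3}

theorem TT_one (h : Sph σ) {x : E3} (hx : ‖x‖ = 1) : TT σ gk (fun _ => (1:ℝ)) x = 1 := by
  simp only [TT, mul_one]
  rw [h.integral_sv ker_gk.meas hx, int_gk]; simp

theorem TT_mean (h : Sph σ) {f : E3 → ℝ} (gf : Good σ f) (hm : ∫ x, f x ∂σ = 0) : ∫ x, TT σ gk f x ∂σ = 0 := by
  have := h.prob
  have s := gf.symm h (integrable_const (1:ℝ)) measurable_const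
  have e : ∫ x, f x * TT σ gk (fun _ => (1:ℝ)) x ∂σ = ∫ x, f x ∂σ := by
    apply integral_congr_ae
    filter_upwards [h.ae_norm] with x hx
    rw [h.TT_one hx, mul_one]
  rw [e, hm] at s
  simpa using s

theorem phi_conv (k r : ℝ) (hk1 : 1 ≤ k) (hk2 : k ≤ 2) (hr : 0 ≤ r) :
    phi (k * (r - 1)) ≤ k * (r * Real.log r) - k * (r - 1) := by
  have c := Real.convexOn_mul_log.2 (Set.mem_Ici.2 hr) (Set.mem_Ici.2 zero_le_one) (by linarith : 0 ≤ k / 2) (by linarith : 0 ≤ 1 - k / 2) (by ring)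
  simp only [smul_eq_mul, mul_one, Real.log_one, mul_zero, add_zero] at c
  unfold phi
  have e : 1 + k * (r - 1) / 2 = k / 2 * r + (1 - k / 2) := by ring
  rw [e]
  have e2 : 2 + k * (r - 1) = 2 * (k / 2 * r + (1 - k / 2)) := by ring
  rw [e2]
  linarith

theorem reduce (h : Sph σ) {r : E3 → ℝ} (hm : Measurable r) {k γ : ℝ} (hk1 : 1 ≤ k) (hk2 : k ≤ 2) (hr : ∀ x, 1 - 1 / k ≤ r x)
    (hri : Integrable r σ) (hr1 : ∫ x, r x ∂σ = 1) (hrb : ∀ x, ∫ y, inner ℝ x y * r y ∂σ = 0)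
    (hl : Integrable (fun x => r x * Real.log (r x)) σ) (g0 : 0 < γ) (gk' : γ ≤ k) :
    Integrable (fun p : E3 × E3 => r p.1 * (gk (sv p.1 p.2) * r p.2)) (σ.prod σ) ∧
    γ * ∫ p : E3 × E3, r p.1 * (gk (sv p.1 p.2) * r p.2) ∂(σ.prod σ) ≤ ∫ x, r x * Real.log (r x) ∂σ + γ := by
  have := h.prob
  have k0 : 0 < k := by linarith
  have rk : ∀ x, -1 ≤ k * (r x - 1) := by
    intro x
    have := mul_le_mul_of_nonneg_left (hr x) k0.le
    have e : k * (1 - 1 / k) = k - 1 := by field_simp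
    rw [e] at this
    linarith
  have r0 : ∀ x, 0 ≤ r x := by
    intro x
    refine le_trans ?_ (hr x)
    rw [sub_nonneg, div_le_one k0]; exact hk1
  have fi : Integrable (fun x => k * (r x - 1)) σ := (hri.sub (integrable_const 1)).const_mul k
  have fm : Measurable (fun x => k * (r x - 1)) := (hm.sub_const 1).const_mul k
  have ib : ∀ x (v : E3 → ℝ), Integrable v σ → Integrable (fun y => inner ℝ x y * v y) σ := by
    intro x v hv
    refine hv.bdd_mul (c := ‖x‖) (meas_inner x).aestronglyMeasurable ?_
    filter_upwards [h.abs_inner_le x] with y hy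
    rwa [Real.norm_eq_abs]
  have b1 : ∀ x, ∫ y, (inner ℝ x y : ℝ) ∂σ = 0 := by
    intro x
    have := h.integral_zonal (fun t => t) x (-x) (by simp)
    simp only [inner_neg_left, integral_neg] at this
    linarith
  have ub : ∀ x, phi (k * (r x - 1)) ≤ k * (r x * Real.log (r x)) - k * (r x - 1) := fun x => phi_conv k (r x) hk1 hk2 (r0 x)
  have iub : Integrable (fun x => k * (r x * Real.log (r x)) - k * (r x - 1)) σ := (hl.const_mul k).sub fi
  have iph : Integrable (fun x => phi (k * (r x - 1))) σ := by
    refine iub.mono' (meas_phi.comp fm).aestronglyMeasurable (Filter.Eventually.of_forall fun x => ?_)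
    rw [Real.norm_eq_abs, abs_of_nonneg (phi_nonneg _ (rk x))]
    exact ub x
  have fmean : ∫ x, k * (r x - 1) ∂σ = 0 := by
    rw [integral_const_mul, integral_sub hri (integrable_const 1), hr1]; simp
  have hf : Hyp σ (fun x => k * (r x - 1)) := by
    refine ⟨fm, rk, fi, iph, fmean, fun x => ?_⟩
    have e : ∀ y, inner ℝ x y * (k * (r y - 1)) = k * (inner ℝ x y * r y - inner ℝ x y) := fun y => by ring
    simp only [e]
    have i1 : Integrable (fun y => (inner ℝ x y : ℝ)) σ := by simpa using ib x (fun _ => 1) (integrable_const 1)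
    rw [integral_const_mul, integral_sub (ib x r hri) i1, hrb, b1]; simp
  have gf : Good σ (fun x => k * (r x - 1)) := hf.good h hf.meas 1 fun x => by rw [abs_le]; constructor <;> linarith [rk x]
  have gr : Good σ r := hf.good h hm 1 fun x => by
    rw [abs_of_nonneg (r0 x)]
    nlinarith [r0 x]
  have ip := gr.prod_integrable h hri hm
  refine ⟨ip, ?_⟩
  have c := core h hf
  have z := h.TT_mean gf fmean
  have bT := gf.TT_bd h
  have iT : Integrable (TT σ gk (fun x => k * (r x - 1))) σ := bT.integrable h
  have iF : Integrable (fun x => k * (r x - 1) * TT σ gk (fun x => k * (r x - 1)) x) σ := by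
    have := bT.mul_integrable fi
    simpa only [mul_comm] using this
  have E : ∫ p : E3 × E3, r p.1 * (gk (sv p.1 p.2) * r p.2) ∂(σ.prod σ) = 1 + 1 / k ^ 2 * ∫ x, k * (r x - 1) * TT σ gk (fun x => k * (r x - 1)) x ∂σ := by
    rw [integral_prod _ ip]
    simp only [integral_const_mul]
    have e : ∀ᵐ x ∂σ, r x * ∫ y, gk (sv x y) * r y ∂σ = (r x + 1 / k * TT σ gk (fun x => k * (r x - 1)) x) + 1 / k ^ 2 * (k * (r x - 1) * TT σ gk (fun x => k * (r x - 1)) x) := by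
      filter_upwards [h.ae_norm] with x hx
      have t : ∫ y, gk (sv x y) * r y ∂σ = 1 + 1 / k * TT σ gk (fun x => k * (r x - 1)) x := by
        have o := h.TT_one hx
        unfold TT at o ⊢
        obtain ⟨C, hC⟩ := gf.pot
        have i1 : Integrable (fun y => gk (sv x y) * (1:ℝ)) σ := by simpa using h.integrable_sv ker_gk hx
        have e2 : ∀ y, gk (sv x y) * r y = gk (sv x y) * 1 + 1 / k * (gk (sv x y) * (k * (r y - 1))) := by
          intro y
          field_simp; ring
        simp only [e2]
        rw [integral_add i1 ((hC x hx).1.const_mul _), o, integral_const_mul]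
      rw [t]
      field_simp; ring
    have i2 : Integrable (fun x => r x + 1 / k * TT σ gk (fun x => k * (r x - 1)) x) σ := hri.add (iT.const_mul _)
    rw [integral_congr_ae e, integral_add i2 (iF.const_mul _), integral_add hri (iT.const_mul _), integral_const_mul, integral_const_mul, z, hr1]
    ring
  have U : ∫ x, phi (k * (r x - 1)) ∂σ ≤ k * ∫ x, r x * Real.log (r x) ∂σ := by
    have := integral_mono iph iub ub
    rw [integral_sub (hl.const_mul k) fi, fmean, integral_const_mul] at this
    linarith
  have P0 : 0 ≤ ∫ x, phi (k * (r x - 1)) ∂σ := integral_nonneg fun x => phi_nonneg _ (rk x)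
  rw [E]
  set I := ∫ x, k * (r x - 1) * TT σ gk (fun x => k * (r x - 1)) x ∂σ
  set P := ∫ x, phi (k * (r x - 1)) ∂σ
  set D := ∫ x, r x * Real.log (r x) ∂σ
  have D0 : 0 ≤ D := by
    by_contra hD
    push Not at hD
    nlinarith
  have s1 : γ / k ^ 2 * I ≤ γ / k ^ 2 * (k * D) := mul_le_mul_of_nonneg_left (c.trans U) (by positivity)
  have s2 : γ / k ^ 2 * (k * D) = γ / k * D := by field_simp
  have s3 : γ / k * D ≤ 1 * D := mul_le_mul_of_nonneg_right (by rw [div_le_one k0]; exact gk') D0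
  have s4 : γ * (1 + 1 / k ^ 2 * I) = γ + γ / k ^ 2 * I := by ring
  linarith

theorem dist_gk {x y : E3} (hx : ‖x‖ = 1) (hy : ‖y‖ = 1) (hs : 0 < sv x y) :
    Real.log 2 - Real.log (dist x y) = 1 / 2 * gk (sv x y) := by
  have d2 : dist x y ^ 2 = 4 * sv x y := by
    rw [dist_eq_norm, norm_sub_sq_real, hx, hy, inner_eq_sv]; ring
  have l := congrArg Real.log d2
  rw [Real.log_pow, Real.log_mul (by norm_num) hs.ne'] at l
  have : Real.log 4 = 2 * Real.log 2 := by
    rw [show (4:ℝ) = 2 ^ 2 by norm_num, Real.log_pow]; norm_num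
  unfold gk
  push_cast at l
  linarith

end Sph

theorem free_energy_nonneg_with_density_bound
    (σ : Measure E3) (hσ1 : IsProbabilityMeasure σ)
    (hσs : σ (Metric.sphere (0 : E3) 1) = 1)
    (hσinv : ∀ R : E3 ≃ₗᵢ[ℝ] E3, σ.map R = σ)
    (γ : ℝ) (hγ0 : 0 < γ) (hγ : γ ≤ 2)
    (μ : Measure E3) (hμ1 : IsProbabilityMeasure μ)
    (hμs : μ (Metric.sphere (0 : E3) 1) = 1) (hbar : (∫ x, x ∂μ) = 0)
    (hdens : (ENNReal.ofReal (1 - 1 / γ)) • σ ≤ μ) :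
    ENNReal.ofReal (2 * γ) *
        (∫⁻ p : E3 × E3,
          ENNReal.ofReal (Real.log 2 - Real.log (dist p.1 p.2)) ∂(μ.prod μ)) ≤
      relEnt μ σ + ENNReal.ofReal γ := by
  unfold relEnt
  split_ifs with hc
  swap
  · simp
  obtain ⟨hac, hintg⟩ := hc
  have hfμ : IsFiniteMeasure μ := inferInstance
  have hfσ : IsFiniteMeasure σ := inferInstance
  have hsσ : SigmaFinite σ := inferInstance
  have hsμ : SFinite μ := inferInstance
  have hLD : μ.HaveLebesgueDecomposition σ := Measure.haveLebesgueDecomposition_of_sigmaFinite μ σ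
  have h : Sph σ := ⟨hσ1, hσs, hσinv⟩
  set k := max γ 1 with hk
  have hk1 : 1 ≤ k := le_max_right _ _
  have hk2 : k ≤ 2 := max_le hγ (by norm_num)
  set r : E3 → ℝ := fun x => max (μ.rnDeriv σ x).toReal (1 - 1 / k) with hrdef
  have hmρ : Measurable (fun x => (μ.rnDeriv σ x).toReal) := (Measure.measurable_rnDeriv μ σ).ennreal_toReal
  have hm : Measurable r := hmρ.max measurable_const
  have hge : ∀ᵐ x ∂σ, 1 - 1 / k ≤ (μ.rnDeriv σ x).toReal := by
    rcases le_total γ 1 with h1 | h1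
    · rw [hk, max_eq_right h1]
      simp
    · rw [hk, max_eq_left h1]
      have : (fun _ : E3 => ENNReal.ofReal (1 - 1 / γ)) ≤ᵐ[σ] μ.rnDeriv σ := by
        apply ae_le_of_forall_setLIntegral_le_of_sigmaFinite measurable_const
        intro s hs _
        rw [Measure.setLIntegral_rnDeriv hac, setLIntegral_const]
        have := hdens s
        simpa using this
      filter_upwards [this, Measure.rnDeriv_lt_top μ σ] with x hx hlt
      exact (ENNReal.ofReal_le_iff_le_toReal hlt.ne).1 hx
  have hrρ : (fun x => (μ.rnDeriv σ x).toReal) =ᵐ[σ] r := by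
    filter_upwards [hge] with x hx
    exact (max_eq_left hx).symm
  have hri : Integrable r σ := (Measure.integrable_toReal_rnDeriv (μ := μ) (ν := σ)).congr hrρ
  have hint1 : ∀ F : E3 → ℝ, ∫ x, F x ∂μ = ∫ x, F x * r x ∂σ := by
    intro F
    rw [← integral_toReal_rnDeriv_mul hac]
    apply integral_congr_ae
    filter_upwards [hrρ] with x hx
    rw [← hx, mul_comm]
  have hr1 : ∫ x, r x ∂σ = 1 := by
    have := hint1 (fun _ => 1)
    simp only [one_mul] at this
    rw [← this]; simp
  have hμn : ∀ᵐ y ∂μ, ‖y‖ = 1 := hac.ae_le h.ae_norm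
  have hidi : Integrable (fun x : E3 => x) μ :=
    Integrable.of_bound measurable_id.aestronglyMeasurable 1 (hμn.mono fun y hy => hy.le)
  have hrb : ∀ x, ∫ y, inner ℝ x y * r y ∂σ = 0 := by
    intro x
    rw [← hint1 (fun y => inner ℝ x y), integral_inner hidi, hbar, inner_zero_right]
  have hl : Integrable (fun x => r x * Real.log (r x)) σ := by
    refine ((integrable_toReal_rnDeriv_mul_iff hac).2 hintg).congr ?_
    filter_upwards [hrρ] with x hx
    rw [← hx]
  have hD : ∫ x, Real.log (μ.rnDeriv σ x).toReal ∂μ = ∫ x, r x * Real.log (r x) ∂σ := by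
    rw [← integral_toReal_rnDeriv_mul hac]
    apply integral_congr_ae
    filter_upwards [hrρ] with x hx
    rw [← hx]
  have hr0 : ∀ x, 0 ≤ r x := fun x => le_max_of_le_left ENNReal.toReal_nonneg
  obtain ⟨ip, le⟩ := Sph.reduce h hm hk1 hk2 (fun x => le_max_right _ _) hri hr1 hrb hl hγ0 (le_max_left γ 1)
  have hμ : μ = σ.withDensity (fun x => ENNReal.ofReal (r x)) := by
    conv_lhs => rw [← Measure.withDensity_rnDeriv_eq μ σ hac]
    apply withDensity_congr_ae
    filter_upwards [hrρ, Measure.rnDeriv_lt_top μ σ] with x hx hlt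
    rw [← hx, ENNReal.ofReal_toReal hlt.ne]
  have hsv : ∀ᵐ p ∂(σ.prod σ), ‖p.1‖ = 1 ∧ ‖p.2‖ = 1 ∧ 0 < Sph.sv p.1 p.2 ∧ Sph.sv p.1 p.2 ≤ 1 := by
    have a1 : ∀ᵐ p ∂(σ.prod σ), ‖p.1‖ = 1 := Measure.quasiMeasurePreserving_fst.ae h.ae_norm
    have a2 : ∀ᵐ p ∂(σ.prod σ), ‖p.2‖ = 1 := Measure.quasiMeasurePreserving_snd.ae h.ae_norm
    have a3 : ∀ᵐ p ∂(σ.prod σ), 0 < Sph.sv p.1 p.2 ∧ Sph.sv p.1 p.2 ≤ 1 := by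
      rw [Measure.ae_prod_iff_ae_ae]
      · filter_upwards [h.ae_norm] with x hx
        exact Sph.sv_pos_ae h hx
      · exact (measurableSet_lt measurable_const Sph.meas_sv2).inter (measurableSet_le Sph.meas_sv2 measurable_const)
    filter_upwards [a1, a2, a3] with p h1 h2 h3
    exact ⟨h1, h2, h3⟩
  have hL : ∫⁻ p : E3 × E3, ENNReal.ofReal (Real.log 2 - Real.log (dist p.1 p.2)) ∂(μ.prod μ)
      = ENNReal.ofReal (∫ p : E3 × E3, 1 / 2 * (r p.1 * (Sph.gk (Sph.sv p.1 p.2) * r p.2)) ∂(σ.prod σ)) := by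
    have mr : Measurable (fun x => ENNReal.ofReal (r x)) := hm.ennreal_ofReal
    rw [hμ, prod_withDensity mr mr, lintegral_withDensity_eq_lintegral_mul _ (by fun_prop) (by fun_prop)]
    rw [ofReal_integral_eq_lintegral_ofReal (ip.const_mul _)]
    · apply lintegral_congr_ae
      filter_upwards [hsv] with p ⟨h1, h2, h3, h4⟩
      simp only [Pi.mul_apply]
      rw [Sph.dist_gk h1 h2 h3, ← ENNReal.ofReal_mul (hr0 _), ← ENNReal.ofReal_mul (mul_nonneg (hr0 _) (hr0 _))]
      congr 1; ring
    · filter_upwards [hsv] with p ⟨h1, h2, h3, h4⟩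
      have := Sph.gk_nonneg ⟨h3.le, h4⟩
      have := hr0 p.1
      have := hr0 p.2
      simp only [Pi.zero_apply]
      positivity
  rw [hL, hD, ← ENNReal.ofReal_mul (by linarith)]
  refine le_trans (ENNReal.ofReal_le_ofReal ?_) ENNReal.ofReal_add_le
  rw [integral_const_mul]
  linarith
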